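/- Let q₁,…,q_N < 0 and let r₁,…,r_N : ℝ → ℝ³ be T-periodic C² functions with |ṙ_i(t)| < c for all t and r_i(t) ≠ r_j(t) for all t ∈ [0,T] and i ≠ j. On Ω = {(t,x) : x ≠ r_j(t) for all j}, define for each i the retarded time t_i = t_i(t,x) as the unique solution of t_i = t − |x − r_i(t_i)|/c, set β_i(s) = ṙ_i(s)/c, η_i(s,x) = (x − r_i(s))/|x − r_i(s)|, and define the Liénard–Wiechert potentials V_i(t,x) = (q_i/(4πε₀)) · 1/((1 − η_i(t_i,x)·β_i(t_i)) |x − r_i(t_i)|) and A_i(t,x) = (β_i(t_i)/c) V_i(t,x); set V = Σ_{i=1}^N V_i and A = Σ_{i=1}^N A_i. Then the Lorentz force equation d/dt( ẋ / √(1 − |ẋ|²/c²) ) = −∇_x V(t,x) − ∂_t A(t,x) + ẋ × curl_x A(t,x) has infinitely many T-periodic classical solutions x with (t,x(t)) ∈ Ω for all t. -/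

import Mathlib

open Filter Topology Set MeasureTheory Function
open scoped ENNReal NNReal

noncomputable section

namespace LW

/-- `ℝ³` with the Euclidean norm. -/
abbrev E3 : Type := EuclideanSpace ℝ (Fin 3)

def toFn (u : E3) : Fin 3 → ℝ := (WithLp.equiv 2 (Fin 3 → ℝ)) u

def fromFn (f : Fin 3 → ℝ) : E3 := (WithLp.equiv 2 (Fin 3 → ℝ)).symm f

/-- Euclidean inner product on `ℝ³`. -/
def dot (u v : E3) : ℝ := ∑ i, toFn u i * toFn v i

/-- Cross product on `ℝ³`. -/
def cross (u v : E3) : E3 :=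
  fromFn ![toFn u 1 * toFn v 2 - toFn u 2 * toFn v 1,
           toFn u 2 * toFn v 0 - toFn u 0 * toFn v 2,
           toFn u 0 * toFn v 1 - toFn u 1 * toFn v 0]

/-- Partial derivative `∂ᵢ Fⱼ` of a vector field on `ℝ³`. -/
def pd (F : E3 → E3) (x : E3) (i j : Fin 3) : ℝ :=
  toFn (fderiv ℝ F x (EuclideanSpace.single i 1)) j

/-- Curl of a vector field on `ℝ³`. -/
def curl (F : E3 → E3) (x : E3) : E3 :=
  fromFn ![pd F x 1 2 - pd F x 2 1, pd F x 2 0 - pd F x 0 2, pd F x 0 1 - pd F x 1 0]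

/-- The open set `Ω = {(t,x) : x ≠ rⱼ(t) for all j}`. -/
def Omega (N : ℕ) (r : Fin N → ℝ → E3) : Set (ℝ × E3) := {p | ∀ i, p.2 ≠ r i p.1}

/-- The Liénard–Wiechert scalar potential generated by the charge `q i` moving along
`r i`, computed at the retarded time `τ i t x`:
`V_i = (q_i/4πε₀) · 1/((1 - η_i·β_i)|x - r_i(t_i)|)`. -/
def Vi (c ε₀ : ℝ) {N : ℕ} (q : Fin N → ℝ) (r : Fin N → ℝ → E3) (τ : Fin N → ℝ → E3 → ℝ)
    (i : Fin N) (t : ℝ) (x : E3) : ℝ :=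
  q i / (4 * Real.pi * ε₀) *
    (1 / ((1 - dot ((‖x - r i (τ i t x)‖)⁻¹ • (x - r i (τ i t x)))
        (c⁻¹ • deriv (r i) (τ i t x))) * ‖x - r i (τ i t x)‖))

/-- The total Liénard–Wiechert scalar potential `V = ∑ V_i`. -/
def VLW (c ε₀ : ℝ) {N : ℕ} (q : Fin N → ℝ) (r : Fin N → ℝ → E3) (τ : Fin N → ℝ → E3 → ℝ)
    (t : ℝ) (x : E3) : ℝ :=
  ∑ i, Vi c ε₀ q r τ i t x

/-- The total Liénard–Wiechert vector potential `A = ∑ (β_i(t_i)/c) V_i`. -/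
def ALW (c ε₀ : ℝ) {N : ℕ} (q : Fin N → ℝ) (r : Fin N → ℝ → E3) (τ : Fin N → ℝ → E3 → ℝ)
    (t : ℝ) (x : E3) : E3 :=
  ∑ i, (Vi c ε₀ q r τ i t x / c ^ 2) • deriv (r i) (τ i t x)

/-- `x` is a classical `T`-periodic solution of the Lorentz force equation associated with
the potentials `V`, `A`. -/
def IsSolution (T c : ℝ) {N : ℕ} (r : Fin N → ℝ → E3)
    (V : ℝ → E3 → ℝ) (A : ℝ → E3 → E3) (x : ℝ → E3) : Prop :=
  Periodic x T ∧ ContDiff ℝ 1 x ∧ (∀ t, (t, x t) ∈ Omega N r) ∧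
  (∀ t, ‖deriv x t‖ < c) ∧
  ∀ t : ℝ, HasDerivAt (fun s => (Real.sqrt (1 - ‖deriv x s‖ ^ 2 / c ^ 2))⁻¹ • deriv x s)
    (-(gradient (V t) (x t)) - deriv (fun s => A s (x t)) t
      + cross (deriv x t) (curl (A t) (x t))) t

end LW

namespace LW

/-! ### Parity of fully labelled chains -/

/-- Deleting one entry from a list of `n + 2` labels out of `n + 1` leaves all the labels for an
even number of choices of the entry. -/
theorem sum_bijective_succAbove {n : ℕ} {L : Type*} [Fintype L] [DecidableEq L]
    (hL : Fintype.card L = n + 1) (a : Fin (n + 2) → L) :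
    ∑ j : Fin (n + 2), (open Classical in
      if Bijective (fun i : Fin (n + 1) => a (j.succAbove i)) then (1 : ZMod 2) else 0) = 0 := by
  classical
  by_cases hs : Surjective a
  · obtain ⟨i, i', hne, heq⟩ := Fintype.exists_ne_map_eq_of_card_lt a (by simp [hL])
    have key : ∀ j : Fin (n + 2), Bijective (fun i : Fin (n + 1) => a (j.succAbove i)) ↔
        j = i ∨ j = i' := by
      intro j
      constructor
      · intro hb
        by_contra! hj
        obtain ⟨u, hu⟩ := Fin.exists_succAbove_eq hj.1.symm
        obtain ⟨u', hu'⟩ := Fin.exists_succAbove_eq hj.2.symm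
        have : u = u' := hb.1 (by simp only [hu, hu', heq])
        exact hne (by rw [← hu, ← hu', this])
      · intro hj
        rw [Fintype.bijective_iff_surjective_and_card]
        refine ⟨fun l => ?_, by simp [hL]⟩
        obtain ⟨p, rfl⟩ := hs l
        by_cases hp : p = j
        · rcases hj with rfl | rfl
          · obtain ⟨u, hu⟩ := Fin.exists_succAbove_eq hne.symm
            exact ⟨u, by simp only [hu, hp, heq]⟩
          · obtain ⟨u, hu⟩ := Fin.exists_succAbove_eq hne
            exact ⟨u, by simp only [hu, hp, heq]⟩
        · obtain ⟨u, hu⟩ := Fin.exists_succAbove_eq hp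
          exact ⟨u, by simp only [hu]⟩
    simp only [key]
    rw [← Finset.sum_filter]
    have : (Finset.univ.filter fun j => j = i ∨ j = i') = {i, i'} := by
      ext j; simp
    rw [this, Finset.sum_pair hne]
    decide
  · refine Finset.sum_eq_zero fun j _ => ?_
    rw [if_neg]
    intro hb
    exact hs fun l => let ⟨u, hu⟩ := hb.2 l; ⟨_, hu⟩

/-- The first `i` elements in the ordering `π`. -/
def flag {n : ℕ} {J : Type*} [Fintype J] (π : Fin n ≃ J) (i : ℕ) : Finset J :=
  Finset.univ.filter fun d => (π.symm d : ℕ) < i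

theorem mem_flag {n : ℕ} {J : Type*} [Fintype J] (π : Fin n ≃ J) (i : ℕ) (d : J) :
    d ∈ flag π i ↔ (π.symm d : ℕ) < i := by
  simp [flag]

theorem flag_swap {n : ℕ} {J : Type*} [Fintype J] (π : Fin (n + 1) ≃ J) (j : Fin n) (i : ℕ)
    (hi : i ≠ j + 1) :
    flag ((Equiv.swap j.castSucc j.succ).trans π) i = flag π i := by
  ext d
  rw [mem_flag, mem_flag, Equiv.symm_trans_apply, Equiv.symm_swap]
  rw [Equiv.swap_apply_def]
  split_ifs with h1 h2
  · rw [h1]; simp only [Fin.val_succ, Fin.val_castSucc]; omega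
  · rw [h2]; simp only [Fin.val_succ, Fin.val_castSucc]; omega
  · rfl

/-- The labels of the chain obtained from the flag of `π` by omitting its `j`-th member are all
the labels, each exactly once. -/
def Full {n : ℕ} {J L : Type*} [Fintype J] (f : Finset J → L) (π : Fin (n + 1) ≃ J)
    (j : Fin (n + 2)) : Prop :=
  Bijective fun i : Fin (n + 1) => f (flag π (j.succAbove i))

open Classical in
/-- Indicator of `Full` with values in `ZMod 2`. -/
def fullInd {n : ℕ} {J L : Type*} [Fintype J] (f : Finset J → L) (π : Fin (n + 1) ≃ J)
    (j : Fin (n + 2)) : ZMod 2 := if Full f π j then 1 else 0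

theorem fullInd_ne_zero {n : ℕ} {J L : Type*} [Fintype J] (f : Finset J → L)
    (π : Fin (n + 1) ≃ J) (j : Fin (n + 2)) : fullInd f π j ≠ 0 ↔ Full f π j := by
  unfold fullInd
  split_ifs with h <;> simp [h]

theorem sum_fullInd_ends {n : ℕ} {J L : Type*} [Fintype J] [DecidableEq J] [Fintype L]
    [DecidableEq L]
    (hL : Fintype.card L = n + 1) (f : Finset J → L) :
    ∑ π : Fin (n + 1) ≃ J, (fullInd f π 0 + fullInd f π (Fin.last _)) = 0 := by
  classical
  have h1 : ∑ π : Fin (n + 1) ≃ J, ∑ j : Fin (n + 2), fullInd f π j = 0 :=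
    Finset.sum_eq_zero fun π _ => by
      have := sum_bijective_succAbove hL (fun i : Fin (n + 2) => f (flag π i))
      refine Eq.trans (Finset.sum_congr rfl fun j _ => ?_) this
      unfold fullInd Full
      split_ifs <;> rfl
  have h2 : ∀ j : Fin n, ∑ π : Fin (n + 1) ≃ J, fullInd f π j.castSucc.succ = 0 := by
    intro j
    have hfl : ∀ π : Fin (n + 1) ≃ J,
        fullInd f ((Equiv.swap j.castSucc j.succ).trans π) j.castSucc.succ
          = fullInd f π j.castSucc.succ := by
      intro π
      have : ∀ i : Fin (n + 1),
          flag ((Equiv.swap j.castSucc j.succ).trans π) (j.castSucc.succ.succAbove i)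
            = flag π (j.castSucc.succ.succAbove i) := by
        intro i
        apply flag_swap
        have := Fin.succAbove_ne j.castSucc.succ i
        intro h
        apply this
        ext
        simpa using h
      have hF : Full f ((Equiv.swap j.castSucc j.succ).trans π) j.castSucc.succ
          ↔ Full f π j.castSucc.succ := by simp only [Full, this]
      simp only [fullInd, hF]
    refine Finset.sum_involution (fun π _ => (Equiv.swap j.castSucc j.succ).trans π) ?_ ?_ ?_ ?_
    · intro π _
      rw [hfl]
      exact CharTwo.add_self_eq_zero _
    · intro π _ _ h
      have := congrArg (fun e : Fin (n + 1) ≃ J => e j.castSucc) h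
      simp only [Equiv.trans_apply, Equiv.swap_apply_left, EmbeddingLike.apply_eq_iff_eq] at this
      exact absurd this (by simp [Fin.ext_iff])
    · intro π _; exact Finset.mem_univ _
    · intro π _
      ext x
      simp
  have h3 : ∀ π : Fin (n + 1) ≃ J, ∑ j : Fin (n + 2), fullInd f π j
      = (fullInd f π 0 + fullInd f π (Fin.last _)) + ∑ j : Fin n, fullInd f π j.castSucc.succ := by
    intro π
    rw [Fin.sum_univ_succ, Fin.sum_univ_castSucc]
    simp only [Fin.succ_last]
    ring
  simp only [h3] at h1
  have hc : ∑ π : Fin (n + 1) ≃ J, ∑ j : Fin n, fullInd f π j.castSucc.succ = 0 := by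
    rw [Finset.sum_comm]
    exact Finset.sum_eq_zero fun j _ => h2 j
  rw [Finset.sum_add_distrib, hc, add_zero] at h1
  exact h1

/-- The sum over all orderings of the full chains with first vertex `v` and of those starting one
step further in the omitted direction vanishes modulo 2. -/
theorem sum_fullInd_shift {n : ℕ} {J L V : Type*} [Fintype J] [DecidableEq J] [Fintype L]
    [DecidableEq L] [AddCommGroup V]
    (hL : Fintype.card L = n + 1) (g : V → L) (e : J → V) (v : V) :
    ∑ π : Fin (n + 1) ≃ J,
      (fullInd (fun A => g (v + ∑ d ∈ A, e d)) π (Fin.last _)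
        + fullInd (fun A => g (v + e (π (Fin.last n)) + ∑ d ∈ A, e d)) π (Fin.last _)) = 0 := by
  classical
  rw [← sum_fullInd_ends hL (fun A => g (v + ∑ d ∈ A, e d)), Finset.sum_add_distrib,
    Finset.sum_add_distrib, add_comm]
  congr 1
  refine (Fintype.sum_equiv (Equiv.equivCongr (finRotate (n + 1)).symm (Equiv.refl J)) _ _ ?_).symm
  intro π
  have hflag : ∀ i : Fin (n + 1),
      flag π (i.succ : Fin (n + 2)) = insert (π 0)
        (flag ((finRotate (n + 1)).trans π) (i.castSucc : Fin (n + 2))) ∧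
      π 0 ∉ (flag ((finRotate (n + 1)).trans π) (i.castSucc : Fin (n + 2))) := by
    intro i
    have hrot : ∀ p : Fin (n + 1), (((finRotate (n + 1)).symm p : Fin (n + 1)) : ℕ)
        = if (p : ℕ) = 0 then n else (p : ℕ) - 1 := by
      intro p
      obtain ⟨q, rfl⟩ := (finRotate (n + 1)).surjective p
      rw [Equiv.symm_apply_apply]
      induction q using Fin.lastCases with
      | last => simp
      | cast q =>
        rw [finRotate_of_lt (by simp)]
        simp
    constructor
    · ext d
      obtain ⟨p, rfl⟩ := π.surjective d
      simp only [flag, Finset.mem_insert, Finset.mem_filter, Finset.mem_univ, true_and,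
        Equiv.symm_trans_apply, Equiv.symm_apply_apply, EmbeddingLike.apply_eq_iff_eq, hrot,
        Fin.ext_iff, Fin.val_succ, Fin.val_castSucc, Fin.val_zero]
      have := i.2
      split_ifs <;> omega
    · simp only [flag, Finset.mem_filter, Finset.mem_univ, true_and,
        Equiv.symm_trans_apply, Equiv.symm_apply_apply, hrot, Fin.val_zero, Fin.val_castSucc]
      have := i.2
      simp only [if_true]
      omega
  have hπ : (Equiv.equivCongr (finRotate (n + 1)).symm (Equiv.refl J)) π
      = (finRotate (n + 1)).trans π := by
    ext x; simp [Equiv.equivCongr]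
  rw [hπ]
  simp only [fullInd, Full]
  congr 1
  congr 1
  funext i
  simp only [Fin.succAbove_zero, Fin.succAbove_last]
  rw [(hflag i).1, Finset.sum_insert (hflag i).2]
  simp [Equiv.trans_apply, add_assoc]

/-- The unit steps in `G × ℤ`: the steps `d i` inside `G` and the step `1` in `ℤ`. -/
def unitStep {ι G : Type*} [AddCommGroup G] (d : ι → G) : Option ι → G × ℤ
  | none => (0, 1)
  | some i => (d i, 0)

/-- The number, modulo 2, of full chains with first vertex `v` and steps in the order `π`, the
last step being omitted. -/
def chainInd {n : ℕ} {ι G L : Type*} [Fintype ι] [DecidableEq ι] [AddCommGroup G]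
    (d : ι → G) (g : G × ℤ → L) (v : G × ℤ) (π : Fin (n + 1) ≃ Option ι) : ZMod 2 :=
  fullInd (fun A => g (v + ∑ a ∈ A, unitStep d a)) π (Fin.last _)

open Classical in
/-- The number of full tagged chains at level `l`. -/
def levelCount (n : ℕ) {ι G L : Type*} [Fintype ι] [DecidableEq ι] [Fintype G] [AddCommGroup G]
    (d : ι → G) (g : G × ℤ → L) (u : G × ℤ → ZMod 2) (l : ℤ) : ZMod 2 :=
  ∑ π : Fin (n + 1) ≃ Option ι, if π (Fin.last n) = none then
    ∑ w : G, u (w, l) * chainInd d g (w, l) π else 0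

theorem levelCount_succ {n : ℕ} {ι G L : Type*} [Fintype ι] [DecidableEq ι] [Fintype G]
    [AddCommGroup G] [Fintype L] [DecidableEq L] (hL : Fintype.card L = n + 1) (d : ι → G) (g : G × ℤ → L)
    (u : G × ℤ → ZMod 2) (l : ℤ)
    (h1 : ∀ w (π : Fin (n + 1) ≃ Option ι) i, π (Fin.last n) = some i →
      chainInd d g (w, l) π ≠ 0 → u (w, l) = u (w - d i, l))
    (h2 : ∀ w (π : Fin (n + 1) ≃ Option ι), π (Fin.last n) = none →
      chainInd d g (w, l + 1) π ≠ 0 → u (w, l) = u (w, l + 1)) :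
    levelCount n d g u l = levelCount n d g u (l + 1) := by
  classical
  have key : ∑ π : Fin (n + 1) ≃ Option ι, ∑ w : G, u (w, l) *
      (chainInd d g (w, l) π + chainInd d g ((w, l) + unitStep d (π (Fin.last n))) π) = 0 := by
    rw [Finset.sum_comm]
    refine Finset.sum_eq_zero fun w _ => ?_
    rw [← Finset.mul_sum]
    have := sum_fullInd_shift (n := n) (J := Option ι) (L := L) hL g
      (unitStep d) (w, l)
    simp only [chainInd]
    rw [this, mul_zero]
  have h3 : ∀ π : Fin (n + 1) ≃ Option ι, ∑ w : G, u (w, l) *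
      (chainInd d g (w, l) π + chainInd d g ((w, l) + unitStep d (π (Fin.last n))) π)
      = (if π (Fin.last n) = none then ∑ w : G, u (w, l) * chainInd d g (w, l) π else 0)
        + (if π (Fin.last n) = none then ∑ w : G, u (w, l + 1) * chainInd d g (w, l + 1) π
            else 0) := by
    intro π
    simp only [mul_add, Finset.sum_add_distrib]
    rcases hπ : π (Fin.last n) with _ | i
    · simp only [if_true, unitStep, Prod.mk_add_mk, add_zero]
      congr 1
      refine Finset.sum_congr rfl fun w _ => ?_
      by_cases h0 : chainInd d g (w, l + 1) π = 0
      · rw [h0, mul_zero, mul_zero]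
      · rw [h2 w π hπ h0]
    · simp only [reduceCtorEq, if_false, unitStep, Prod.mk_add_mk, add_zero]
      have : ∑ w : G, u (w, l) * chainInd d g (w + d i, l) π
          = ∑ w : G, u (w - d i, l) * chainInd d g (w, l) π :=
        Fintype.sum_equiv (Equiv.addRight (d i)) _ _ fun w => by simp
      rw [this, ← Finset.sum_add_distrib]
      refine Finset.sum_eq_zero fun w _ => ?_
      by_cases h0 : chainInd d g (w, l) π = 0
      · rw [h0, mul_zero, mul_zero, add_zero]
      · rw [← h1 w π i hπ h0]
        exact CharTwo.add_self_eq_zero _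
  simp only [h3] at key
  rw [Finset.sum_add_distrib] at key
  exact CharTwo.add_eq_zero.mp key

theorem levelCount_zero_eq {n : ℕ} {ι G L : Type*} [Fintype ι] [DecidableEq ι] [Fintype G]
    [AddCommGroup G] [Fintype L] [DecidableEq L] (hL : Fintype.card L = n + 1) (d : ι → G) (g : G × ℤ → L)
    (u : G × ℤ → ZMod 2) (M : ℕ)
    (h1 : ∀ w (l : ℕ) (π : Fin (n + 1) ≃ Option ι) i, l < M → π (Fin.last n) = some i →
      chainInd d g (w, (l : ℤ)) π ≠ 0 → u (w, (l : ℤ)) = u (w - d i, (l : ℤ)))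
    (h2 : ∀ w (l : ℕ) (π : Fin (n + 1) ≃ Option ι), l < M → π (Fin.last n) = none →
      chainInd d g (w, (l : ℤ) + 1) π ≠ 0 → u (w, (l : ℤ)) = u (w, (l : ℤ) + 1)) :
    levelCount n d g u 0 = levelCount n d g u M := by
  have : ∀ m : ℕ, m ≤ M → levelCount n d g u 0 = levelCount n d g u m := by
    intro m
    induction m with
    | zero => intro _; rfl
    | succ m ih =>
      intro hm
      rw [ih (by omega), levelCount_succ hL d g u m (fun w π i => h1 w m π i (by omega))
        (fun w π => h2 w m π (by omega))]
      push_cast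
      rfl
  exact this M le_rfl

end LW

namespace LW

/-! ### Continuation of zeros of periodic maps -/

open Classical in
/-- The first index satisfying `P`, or `Fin.last n` if there is none. -/
def firstIdx {n : ℕ} (P : Fin n → Prop) : Fin (n + 1) :=
  (Finset.univ.filter fun m : Fin (n + 1) => ∀ i : Fin n, i.castSucc = m → P i).min'
    ⟨Fin.last n, by
      simp only [Finset.mem_filter, Finset.mem_univ, true_and]
      intro i h
      exact absurd h (Fin.castSucc_lt_last i).ne⟩

theorem firstIdx_spec {n : ℕ} (P : Fin n → Prop) (i : Fin n) (h : firstIdx P = i.castSucc) :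
    P i := by
  classical
  have := Finset.min'_mem (Finset.univ.filter fun m : Fin (n + 1) =>
    ∀ i : Fin n, i.castSucc = m → P i) ⟨Fin.last n, by
      simp only [Finset.mem_filter, Finset.mem_univ, true_and]
      intro i h
      exact absurd h (Fin.castSucc_lt_last i).ne⟩
  rw [Finset.mem_filter] at this
  exact this.2 i (by rw [← h]; unfold firstIdx; congr)

theorem firstIdx_le {n : ℕ} (P : Fin n → Prop) (i : Fin n) (h : P i) :
    firstIdx P ≤ i.castSucc := by
  classical
  unfold firstIdx
  refine Finset.min'_le _ _ ?_
  simp only [Finset.mem_filter, Finset.mem_univ, true_and]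
  intro j hj
  rw [Fin.castSucc_inj] at hj
  exact hj ▸ h

theorem firstIdx_eq_last {n : ℕ} (P : Fin n → Prop) (h : firstIdx P = Fin.last n) (i : Fin n) :
    ¬ P i := fun hi => by
  have := firstIdx_le P i hi
  rw [h] at this
  exact absurd this (not_le.mpr (Fin.castSucc_lt_last i))

theorem firstIdx_anti {n : ℕ} {P Q : Fin n → Prop} (h : ∀ i, Q i → P i) :
    firstIdx P ≤ firstIdx Q := by
  induction hq : firstIdx Q using Fin.lastCases with
  | last => exact Fin.le_last _
  | cast i => exact firstIdx_le P i (h i (firstIdx_spec Q i hq))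

theorem firstIdx_eq {n : ℕ} (P : Fin n → Prop) (m : Fin (n + 1))
    (h : ∀ j : Fin n, P j ↔ m ≤ j.castSucc) : firstIdx P = m := by
  apply le_antisymm
  · induction m using Fin.lastCases with
    | last => exact Fin.le_last _
    | cast i => exact firstIdx_le P i ((h i).2 le_rfl)
  · induction hq : firstIdx P using Fin.lastCases with
    | last => exact Fin.le_last _
    | cast i => exact (h i).1 (firstIdx_spec P i hq)

theorem eq_id_of_monotone_bijective {n : ℕ} {f : Fin n → Fin n} (hm : Monotone f)
    (hb : Bijective f) : ∀ i, f i = i := by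
  have hs : StrictMono f := hm.strictMono_of_injective hb.1
  intro i
  have : hs.orderIsoOfSurjective f hb.2 = OrderIso.refl _ := Subsingleton.elim _ _
  exact congrArg (fun o : Fin n ≃o Fin n => o i) this

theorem add_sum_unitStep {ι R : Type*} [Fintype ι] [DecidableEq ι] [CommRing R]
    (v : (ι → R) × ℤ) (A : Finset (Option ι)) :
    v + ∑ a ∈ A, unitStep (fun b : ι => Pi.single b (1 : R)) a
      = (fun b => v.1 b + if some b ∈ A then 1 else 0, v.2 + if none ∈ A then 1 else 0) := by
  have h : ∀ a : Option ι, unitStep (fun b : ι => Pi.single b (1 : R)) a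
      = (fun b => if a = some b then 1 else 0, if a = none then 1 else 0) := by
    rintro (_ | i)
    · ext <;> simp [unitStep]
    · ext b <;> simp [unitStep, Pi.single_apply, eq_comm]
  ext b
  · simp only [Prod.fst_add, Pi.add_apply, Prod.fst_sum, Finset.sum_apply, h]
    simp
  · simp only [Prod.snd_add, Prod.snd_sum, h]
    simp

section continuation

variable {ι : Type*} {n : ℕ}

/-- The label of a point: the first negative component of `F`. -/
def signLabel (e : Fin n ≃ ι) (F : ℝ × (ι → ℝ) → ι → ℝ) (p : ℝ × (ι → ℝ)) : Fin (n + 1) :=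
  firstIdx fun i => F p (e i) < 0

theorem exists_eventually_signLabel_ne (e : Fin n ≃ ι) {F : ℝ × (ι → ℝ) → ι → ℝ}
    (hF : Continuous F) {p : ℝ × (ι → ℝ)} (hp : F p ≠ 0) :
    ∃ m, ∀ᶠ q in 𝓝 p, signLabel e F q ≠ m := by
  obtain ⟨a, ha⟩ := Function.ne_iff.mp hp
  have hc : Continuous fun q => F q a := by fun_prop
  rcases lt_or_gt_of_ne ha with h | h
  · refine ⟨Fin.last n, ?_⟩
    filter_upwards [hc.continuousAt.eventually (gt_mem_nhds h)] with q hq hl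
    have := firstIdx_eq_last _ hl (e.symm a)
    simp only [Equiv.apply_symm_apply] at this
    exact this hq
  · refine ⟨(e.symm a).castSucc, ?_⟩
    filter_upwards [hc.continuousAt.eventually (lt_mem_nhds h)] with q hq hl
    have := firstIdx_spec _ _ hl
    simp only [Equiv.apply_symm_apply] at this
    exact lt_asymm hq this

/-- Small balls either miss a label or lie in a prescribed neighbourhood of a zero. -/
theorem exists_lebesgue_number [Fintype ι] (e : Fin n ≃ ι) {F : ℝ × (ι → ℝ) → ι → ℝ}
    (hF : Continuous F) (Q : ℝ × (ι → ℝ) → ℝ × (ι → ℝ) → Prop)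
    {K : Set (ℝ × (ι → ℝ))} (hK : IsCompact K)
    (hQ : ∀ p ∈ K, F p = 0 → ∀ᶠ q in 𝓝 p, Q p q) :
    ∃ η > 0, ∀ p ∈ K, (∃ m, ∀ q ∈ Metric.ball p η, signLabel e F q ≠ m) ∨
      ∃ p₀ ∈ K, F p₀ = 0 ∧ ∀ q ∈ Metric.ball p η, Q p₀ q := by
  have h : ∀ p : K, ∃ r > 0, (∃ m, ∀ q ∈ Metric.ball (p : ℝ × (ι → ℝ)) r, signLabel e F q ≠ m) ∨
      (F p = 0 ∧ ∀ q ∈ Metric.ball (p : ℝ × (ι → ℝ)) r, Q p q) := by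
    rintro ⟨p, hp⟩
    by_cases h0 : F p = 0
    · obtain ⟨r, hr, hb⟩ := Metric.eventually_nhds_iff_ball.mp (hQ p hp h0)
      exact ⟨r, hr, Or.inr ⟨h0, hb⟩⟩
    · obtain ⟨m, hm⟩ := exists_eventually_signLabel_ne e hF h0
      obtain ⟨r, hr, hb⟩ := Metric.eventually_nhds_iff_ball.mp hm
      exact ⟨r, hr, Or.inl ⟨m, hb⟩⟩
  choose r hr h using h
  obtain ⟨η, hη, hη'⟩ := lebesgue_number_lemma_of_metric hK
    (c := fun p : K => Metric.ball (p : ℝ × (ι → ℝ)) (r p)) (fun p => Metric.isOpen_ball)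
    (fun p hp => Set.mem_iUnion.mpr ⟨⟨p, hp⟩, Metric.mem_ball_self (hr _)⟩)
  refine ⟨η, hη, fun p hp => ?_⟩
  obtain ⟨p₀, h₀⟩ := hη' p hp
  rcases h p₀ with ⟨m, hm⟩ | ⟨hz, hm⟩
  · exact Or.inl ⟨m, fun q hq => hm q (h₀ hq)⟩
  · exact Or.inr ⟨p₀, p₀.2, hz, fun q hq => hm q (h₀ hq)⟩

/-- The grid point with integer coordinates. -/
def gridPt (M : ℕ) (x : ι → ℤ) (l : ℤ) : ℝ × (ι → ℝ) := ((l : ℝ) / M, fun b => (x b : ℝ) / M)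

theorem dist_gridPt_lt [Fintype ι] {M : ℕ} (hM : 0 < M) {η : ℝ} (hη : 1 / (M : ℝ) < η) {x y : ι → ℤ}
    {l m : ℤ} (hxy : ∀ b, |x b - y b| ≤ 1) (hlm : |l - m| ≤ 1) :
    dist (gridPt M x l) (gridPt M y m) < η := by
  have hM' : (0 : ℝ) < M := by exact_mod_cast hM
  have key : ∀ a b : ℤ, |a - b| ≤ 1 → dist ((a : ℝ) / M) ((b : ℝ) / M) ≤ 1 / (M : ℝ) := by
    intro a b h
    rw [Real.dist_eq, ← sub_div, abs_div, abs_of_pos hM']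
    gcongr
    exact_mod_cast h
  have h0 : (0 : ℝ) ≤ 1 / (M : ℝ) := by positivity
  refine lt_of_le_of_lt ?_ hη
  rw [Prod.dist_eq]
  refine max_le (key _ _ hlm) ?_
  rw [dist_pi_le_iff h0]
  exact fun b => key _ _ (hxy b)

theorem apply_gridPt_val {α : Type*} {Φ : ℝ × (ι → ℝ) → α}
    (hΦ : ∀ l z (m : ι → ℤ), Φ (l, fun i => z i + m i) = Φ (l, z)) {M : ℕ} [NeZero M]
    (x : ι → ℤ) (l : ℤ) :
    Φ (gridPt M (fun b => (((x b : ZMod M)).val : ℤ)) l) = Φ (gridPt M x l) := by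
  have hM : (M : ℝ) ≠ 0 := by exact_mod_cast NeZero.ne M
  have : gridPt M x l = ((l : ℝ) / M,
      fun b => (((((x b : ZMod M)).val : ℤ) : ℝ) / M) + ((x b / (M : ℤ) : ℤ) : ℝ)) := by
    unfold gridPt
    refine Prod.ext rfl (funext fun b => ?_)
    simp only
    rw [ZMod.val_intCast]
    have h := Int.emod_add_mul_ediv (x b) M
    have h' : ((x b : ℤ) : ℝ) = ((x b % (M : ℤ) : ℤ) : ℝ) + M * ((x b / (M : ℤ) : ℤ) : ℝ) := by
      exact_mod_cast h.symm
    rw [h']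
    field_simp
  rw [this, hΦ]
  rfl

theorem chainInd_ne_zero_iff [Fintype ι] [DecidableEq ι] (e : Fin n ≃ ι)
    {F : ℝ × (ι → ℝ) → ι → ℝ}
    (hF : ∀ l z (m : ι → ℤ), F (l, fun i => z i + m i) = F (l, z)) {M : ℕ} [NeZero M]
    (x : ι → ℤ) (l : ℤ) (π : Fin (n + 1) ≃ Option ι) :
    chainInd (fun b : ι => Pi.single b (1 : ZMod M))
      (fun v => signLabel e F (gridPt M (fun b => ((v.1 b).val : ℤ)) v.2))
      ((fun b => (x b : ZMod M)), l) π ≠ 0 ↔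
    Bijective fun i : Fin (n + 1) => signLabel e F (gridPt M
      (fun b => x b + if some b ∈ flag π i then 1 else 0)
      (l + if none ∈ flag π i then 1 else 0)) := by
  have hΦ : ∀ l z (m : ι → ℤ), signLabel e F (l, fun i => z i + m i) = signLabel e F (l, z) := by
    intro l z m
    simp only [signLabel, hF]
  unfold chainInd
  rw [fullInd_ne_zero]
  simp only [Full, Fin.succAbove_last,
    add_sum_unitStep, Fin.val_castSucc]
  refine iff_of_eq (congrArg Bijective (funext fun i => ?_))
  rw [← apply_gridPt_val hΦ (fun b => x b + if some b ∈ flag π i then 1 else 0)]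
  congr 3
  funext b
  split_ifs <;> simp

/-- A full chain through an explicitly given sign pattern is unique. -/
theorem bijective_signLabel_iff [Fintype ι] [DecidableEq ι] (e : Fin n ≃ ι)
    {F : ℝ × (ι → ℝ) → ι → ℝ} {M : ℕ} [NeZero M] (x : ι → ℤ)
    (π : Fin (n + 1) ≃ Option ι) (hπ : π (Fin.last n) = none) (ζ : ι → ℝ) (σ : ι ≃ ι)
    (h : ∀ y : ι → ℤ, (∀ b, |y b - x b| ≤ 1) → ∀ a,
      F (gridPt M y 0) a < 0 ↔ (y (σ a) : ℝ) / M < ζ (σ a)) :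
    (Bijective fun i : Fin (n + 1) => signLabel e F (gridPt M
      (fun b => x b + if some b ∈ flag π i then 1 else 0)
      (0 + if none ∈ flag π i then 1 else 0))) ↔
    (∀ i : Fin n, π i.castSucc = some (σ (e i))) ∧
      ∀ b, (x b : ℝ) < M * ζ b ∧ M * ζ b ≤ x b + 1 := by
  have hM : (0 : ℝ) < M := by exact_mod_cast (NeZero.pos M)
  set f : Fin (n + 1) → Fin (n + 1) := fun i : Fin (n + 1) => signLabel e F (gridPt M
      (fun b => x b + if some b ∈ flag π i then 1 else 0)
      (0 + if none ∈ flag π i then 1 else 0)) with hf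
  have hnone : ∀ i : Fin (n + 1), none ∉ flag π i := by
    intro i
    rw [mem_flag, ← hπ, Equiv.symm_apply_apply]
    simp only [Fin.val_last, not_lt]
    omega
  have hf' : ∀ i, f i = firstIdx fun j => ((x (σ (e j)) : ℝ) +
      if some (σ (e j)) ∈ flag π i then 1 else 0) < M * ζ (σ (e j)) := by
    intro i
    simp only [hf, signLabel, if_neg (hnone i), add_zero]
    congr 1
    funext j
    rw [h _ (fun b => by split_ifs <;> simp) (e j), div_lt_iff₀ hM, mul_comm]
    push_cast
    rfl
  constructor
  · intro hb
    have hm : Monotone f := by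
      intro i j hij
      rw [hf', hf']
      refine firstIdx_anti fun m hm => lt_of_le_of_lt ?_ hm
      have : some (σ (e m)) ∈ flag π i → some (σ (e m)) ∈ flag π j := by
        simp only [mem_flag]
        intro h
        exact lt_of_lt_of_le h hij
      split_ifs with h1 h2 h2
      · exact le_rfl
      · exact absurd (this h1) h2
      · linarith
      · exact le_rfl
    have hid := eq_id_of_monotone_bijective hm hb
    have h1 : ∀ i : Fin n, ((x (σ (e i)) : ℝ) +
        if some (σ (e i)) ∈ flag π (i.castSucc : Fin (n + 1)) then 1 else 0)
          < M * ζ (σ (e i)) := by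
      intro i
      have := hid i.castSucc
      rw [hf'] at this
      exact firstIdx_spec _ _ this
    have h2 : ∀ i : Fin n, ¬ ((x (σ (e i)) : ℝ) +
        if some (σ (e i)) ∈ flag π (i.succ : Fin (n + 1)) then 1 else 0)
          < M * ζ (σ (e i)) := by
      intro i hi
      have := hid i.succ
      rw [hf'] at this
      have h3 := firstIdx_le (fun j => ((x (σ (e j)) : ℝ) +
        if some (σ (e j)) ∈ flag π (i.succ : Fin (n + 1)) then 1 else 0)
          < M * ζ (σ (e j))) i hi
      rw [this] at h3
      exact absurd h3 (not_le.mpr Fin.castSucc_lt_succ)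
    have h3 : ∀ i : Fin n, some (σ (e i)) ∈ flag π (i.succ : Fin (n + 1)) ∧
        some (σ (e i)) ∉ flag π (i.castSucc : Fin (n + 1)) := by
      intro i
      have a := h1 i
      have b := h2 i
      have hle : some (σ (e i)) ∈ flag π (i.castSucc : Fin (n + 1)) →
          some (σ (e i)) ∈ flag π (i.succ : Fin (n + 1)) := by
        simp only [mem_flag, Fin.val_succ, Fin.val_castSucc]
        omega
      by_cases c1 : some (σ (e i)) ∈ flag π (i.castSucc : Fin (n + 1))
      · have c2 := hle c1
        rw [if_pos c1] at a
        rw [if_pos c2] at b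
        exact absurd a b
      · refine ⟨?_, c1⟩
        by_contra c2
        rw [if_neg c1] at a
        rw [if_neg c2] at b
        exact b a
    constructor
    · intro i
      have := h3 i
      simp only [mem_flag, Fin.val_succ, Fin.val_castSucc] at this
      rw [← Equiv.eq_symm_apply]
      ext
      simp only [Fin.val_castSucc]
      omega
    · intro b
      obtain ⟨a, rfl⟩ := σ.surjective b
      obtain ⟨i, rfl⟩ := e.surjective a
      have a1 := h1 i
      have a2 := h2 i
      rw [if_neg (h3 i).2] at a1
      rw [if_pos (h3 i).1] at a2
      exact ⟨by linarith, by linarith⟩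
  · rintro ⟨h1, h2⟩
    have : f = id := by
      funext i
      rw [hf']
      refine firstIdx_eq _ _ fun j => ?_
      have hmem : some (σ (e j)) ∈ flag π i ↔ (j : ℕ) < i := by
        rw [mem_flag, ← h1 j, Equiv.symm_apply_apply, Fin.val_castSucc]
      have := h2 (σ (e j))
      simp only [hmem, id, Fin.le_def, Fin.val_castSucc]
      by_cases hj : (j : ℕ) < i
      · simp only [if_pos hj]
        constructor
        · intro h; linarith
        · intro h; omega
      · simp only [if_neg hj]
        constructor
        · intro h; omega
        · intro h; linarith
    rw [this]
    exact bijective_id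

end continuation

end LW

namespace LW

theorem eq_one_of_ne_zero_zmod_two {a : ZMod 2} (h : a ≠ 0) : a = 1 := by
  revert h
  revert a
  decide

/-- A continuous family of maps, periodic in the space variables, that starts with an odd number of
simple zeros in `U` has a zero in `U` at the end, provided that `U` is locally constant along the
zeros of the family. -/
theorem exists_zero_of_odd {ι κ : Type*} [Fintype ι] [Fintype κ]
    {F : ℝ × (ι → ℝ) → ι → ℝ} (hF : Continuous F)
    (hper : ∀ l z (m : ι → ℤ), F (l, fun i => z i + m i) = F (l, z))
    {U : Set (ℝ × (ι → ℝ))}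
    (hU : ∀ l z (m : ι → ℤ), ((l, fun i => z i + m i) : ℝ × (ι → ℝ)) ∈ U ↔ (l, z) ∈ U)
    (hloc : ∀ p : ℝ × (ι → ℝ), p.1 ∈ Icc (0 : ℝ) 1 → F p = 0 → ∀ᶠ q in 𝓝 p, (q ∈ U ↔ p ∈ U))
    (Z : κ → ι → ℝ) (σ : κ → ι ≃ ι)
    (hZ : ∀ z, F (0, z) = 0 → (0, z) ∈ U → ∃ k, ∃ m : ι → ℤ, z = fun i => Z k i + m i)
    (hZ0 : ∀ k, F (0, Z k) = 0) (hZU : ∀ k, ((0 : ℝ), Z k) ∈ U)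
    (hZinj : ∀ k k' (m : ι → ℤ), (Z k = fun i => Z k' i + m i) → k = k')
    (hsign : ∀ k, ∀ᶠ z in 𝓝 (Z k), ∀ a, F (0, z) a < 0 ↔ z (σ k a) < Z k (σ k a))
    (hodd : Odd (Fintype.card κ)) :
    ∃ z, F (1, z) = 0 ∧ ((1 : ℝ), z) ∈ U := by
  classical
  set n := Fintype.card ι with hn
  let e : Fin n ≃ ι := (Fintype.equivFin ι).symm
  let K : Set (ℝ × (ι → ℝ)) := Icc (0 : ℝ) 1 ×ˢ (Set.univ.pi fun _ => Icc (0 : ℝ) 1)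
  have hK : IsCompact K := isCompact_Icc.prod (isCompact_univ_pi fun _ => isCompact_Icc)
  let Q : ℝ × (ι → ℝ) → ℝ × (ι → ℝ) → Prop := fun p q =>
    (q ∈ U ↔ p ∈ U) ∧ (p.1 ≠ 0 → q.1 ≠ 0) ∧ (p.1 ≠ 1 → q.1 ≠ 1) ∧
      (p.1 = 0 → ∀ k (m : ι → ℤ), (p.2 = fun i => Z k i + m i) → ∀ a,
        F (0, q.2) a < 0 ↔ q.2 (σ k a) < p.2 (σ k a))
  have hQ : ∀ p ∈ K, F p = 0 → ∀ᶠ q in 𝓝 p, Q p q := by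
    rintro ⟨l, z⟩ hp h0
    have h1 := hloc (l, z) hp.1 h0
    have h2 : ∀ a : ℝ, ∀ᶠ q : ℝ × (ι → ℝ) in 𝓝 (l, z), (l ≠ a → q.1 ≠ a) := by
      intro a
      by_cases hl : l = a
      · exact Eventually.of_forall fun q h => absurd hl h
      · filter_upwards [(continuous_fst.tendsto (l, z)).eventually
          (isOpen_ne.mem_nhds (show l ≠ a from hl))] with q hq _
        exact hq
    have h3 : ∀ᶠ q : ℝ × (ι → ℝ) in 𝓝 (l, z), (l = 0 → ∀ k (m : ι → ℤ),
        (z = fun i => Z k i + m i) → ∀ a, F (0, q.2) a < 0 ↔ q.2 (σ k a) < z (σ k a)) := by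
      by_cases hex : ∃ k, ∃ m : ι → ℤ, z = fun i => Z k i + m i
      · obtain ⟨k, m, hkm⟩ := hex
        have ht : Tendsto (fun q : ℝ × (ι → ℝ) => fun i => q.2 i + ((-m i : ℤ) : ℝ))
            (𝓝 (l, z)) (𝓝 (Z k)) := by
          have hc : Continuous fun q : ℝ × (ι → ℝ) => fun i => q.2 i + ((-m i : ℤ) : ℝ) := by
            fun_prop
          convert hc.tendsto (l, z) using 2
          funext i
          simp [hkm]
        filter_upwards [ht.eventually (hsign k)] with q hq _ k' m' hkm' a
        have hkk : k = k' := by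
          refine hZinj k k' (fun i => m' i - m i) (funext fun i => ?_)
          have := congrFun (hkm.symm.trans hkm') i
          beta_reduce at this
          push_cast
          linarith
        subst hkk
        have := hq a
        rw [hper 0 q.2 (fun i => -m i)] at this
        rw [this, hkm]
        push_cast
        constructor <;> intro h <;> linarith
      · exact Eventually.of_forall fun q _ k m hkm => absurd ⟨k, m, hkm⟩ hex
    filter_upwards [h1, h2 0, h2 1, h3] with q a b c d
    exact ⟨a, b, c, d⟩
  obtain ⟨η, hη, hη'⟩ := exists_lebesgue_number e hF Q hK hQ
  have hlim : Tendsto (fun M : ℕ => 2 / (M : ℝ)) atTop (𝓝 0) :=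
    tendsto_const_div_atTop_nhds_zero_nat 2
  have hball : ∀ k, ∃ δ > 0, ∀ z : ι → ℝ, dist z (Z k) < δ →
      ((0 : ℝ), z) ∈ U ∧ ∀ a, F (0, z) a < 0 ↔ z (σ k a) < Z k (σ k a) := by
    intro k
    have h1 := hloc (0, Z k) ⟨le_rfl, zero_le_one⟩ (hZ0 k)
    have h2 : ∀ᶠ z : ι → ℝ in 𝓝 (Z k), ((0 : ℝ), z) ∈ U := by
      have hc : Continuous fun z : ι → ℝ => ((0 : ℝ), z) := by fun_prop
      filter_upwards [(hc.tendsto (Z k)).eventually h1] with z hz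
      exact hz.2 (hZU k)
    exact Metric.eventually_nhds_iff.mp (h2.and (hsign k))
  choose δ hδ hδ' using hball
  have hgap : ∀ k k', k ≠ k' → ∃ g > 0, ∃ b, ∀ m : ℤ, g ≤ |Z k b - Z k' b - m| := by
    intro k k' hkk
    have : ∃ b, ∀ m : ℤ, Z k b ≠ Z k' b + m := by
      by_contra! hcon
      choose m hm using hcon
      exact hkk (hZinj k k' m (funext hm))
    obtain ⟨b, hb⟩ := this
    refine ⟨|Z k b - Z k' b - round (Z k b - Z k' b)|, ?_, b, fun m => round_le _ m⟩
    rw [gt_iff_lt, abs_pos]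
    intro h
    exact hb (round (Z k b - Z k' b)) (by linarith)
  choose! g hg bb hg' using hgap
  have hev : ∀ᶠ M : ℕ in atTop, 0 < M ∧ 2 / (M : ℝ) < η ∧ (∀ k, 2 / (M : ℝ) < δ k) ∧
      ∀ k k', k ≠ k' → 2 / (M : ℝ) < g k k' := by
    refine (eventually_gt_atTop 0).and ((hlim.eventually (gt_mem_nhds hη)).and
      ((eventually_all.2 fun k => hlim.eventually (gt_mem_nhds (hδ k))).and
      (eventually_all.2 fun k => eventually_all.2 fun k' => ?_)))
    by_cases h : k = k'
    · exact Eventually.of_forall fun M h' => absurd h h'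
    · filter_upwards [hlim.eventually (gt_mem_nhds (hg k k' h))] with M hM _
      exact hM
  obtain ⟨M, hM, hMη, hMδ, hMg⟩ := hev.exists
  have : NeZero M := ⟨hM.ne'⟩
  have hM' : (0 : ℝ) < M := by exact_mod_cast hM
  have h12 : 1 / (M : ℝ) < 2 / (M : ℝ) := by gcongr; norm_num
  let D : ι → (ι → ZMod M) := fun b => Pi.single b (1 : ZMod M)
  let G : (ι → ZMod M) × ℤ → Fin (n + 1) :=
    fun v => signLabel e F (gridPt M (fun b => ((v.1 b).val : ℤ)) v.2)
  let u : (ι → ZMod M) × ℤ → ZMod 2 :=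
    fun v => if gridPt M (fun b => ((v.1 b).val : ℤ)) v.2 ∈ U then 1 else 0
  have hUper : ∀ l z (m : ι → ℤ), (fun p => p ∈ U) (l, fun i => z i + m i)
      = (fun p => p ∈ U) (l, z) := fun l z m => propext (hU l z m)
  have hu : ∀ (x : ι → ℤ) (l : ℤ), u ((fun b => (x b : ZMod M)), l)
      = if gridPt M x l ∈ U then 1 else 0 := by
    intro x l
    have := apply_gridPt_val hUper (M := M) x l
    beta_reduce at this
    simp only [u, this]
  have hval : ∀ w : ι → ZMod M, (fun b => (((w b).val : ℤ) : ZMod M)) = w := by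
    intro w; funext b; simp
  have hchain : ∀ (w : ι → ZMod M) (l : ℕ) (π : Fin (n + 1) ≃ Option ι), l ≤ M →
      chainInd D G (w, (l : ℤ)) π ≠ 0 → ∃ p₀ ∈ K, F p₀ = 0 ∧ ∀ (y : ι → ℤ) (m : ℤ),
        (∀ b, |y b - (w b).val| ≤ 1) → |m - l| ≤ 1 → Q p₀ (gridPt M y m) := by
    intro w l π hl hc
    have hb := (chainInd_ne_zero_iff e hper (M := M) (fun b => ((w b).val : ℤ)) l π).1
      (by rw [hval]; exact hc)
    have hp : gridPt M (fun b => ((w b).val : ℤ)) (l : ℤ) ∈ K := by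
      refine ⟨⟨?_, ?_⟩, fun b _ => ⟨?_, ?_⟩⟩
      · simp only [gridPt]; positivity
      · simp only [gridPt]
        rw [div_le_one hM']
        exact_mod_cast hl
      · simp only [gridPt]; positivity
      · simp only [gridPt]
        rw [div_le_one hM']
        exact_mod_cast (ZMod.val_lt (w b)).le
    rcases hη' _ hp with ⟨m, hm⟩ | ⟨p₀, hp₀, hz, hall⟩
    · exfalso
      obtain ⟨i, hi⟩ := hb.2 m
      refine hm _ ?_ hi
      rw [Metric.mem_ball]
      refine dist_gridPt_lt hM (h12.trans hMη) (fun b => ?_) ?_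
      · split_ifs <;> simp
      · split_ifs <;> simp
    · refine ⟨p₀, hp₀, hz, fun y m hy hm => hall _ ?_⟩
      rw [Metric.mem_ball]
      exact dist_gridPt_lt hM (h12.trans hMη) hy hm
  have hcount := levelCount_zero_eq (n := n) (L := Fin (n + 1)) (by simp) D G u M
    (by
      intro w l π i hl _ hc
      obtain ⟨p₀, -, -, hall⟩ := hchain w l π hl.le hc
      have e1 : (w - D i) = fun b => ((((w b).val : ℤ) - (if b = i then 1 else 0) : ℤ) : ZMod M) := by
        funext b
        simp only [D, Pi.sub_apply, Pi.single_apply]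
        push_cast
        simp
      rw [e1, hu]
      have a1 := (hall (fun b => ((w b).val : ℤ)) l (fun b => by simp) (by simp)).1
      have a2 := (hall (fun b => ((w b).val : ℤ) - (if b = i then 1 else 0)) l
        (fun b => by split_ifs <;> simp) (by simp)).1
      simp only [u, a1, a2])
    (by
      intro w l π hl _ hc
      obtain ⟨p₀, -, -, hall⟩ := hchain w (l + 1) π hl (by push_cast; exact hc)
      have a1 := (hall (fun b => ((w b).val : ℤ)) l (fun b => by simp) (by simp)).1
      have a2 := (hall (fun b => ((w b).val : ℤ)) (l + 1) (fun b => by simp) (by simp)).1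
      simp only [u, a1, a2])
  by_contra hno
  have hlast : levelCount n D G u M = 0 := by
    unfold levelCount
    refine Finset.sum_eq_zero fun π _ => ?_
    split_ifs with hπ
    · refine Finset.sum_eq_zero fun w _ => ?_
      by_contra hne
      obtain ⟨p₀, hp₀, hz, hall⟩ := hchain w M π le_rfl (right_ne_zero_of_mul hne)
      have h1 := hall (fun b => ((w b).val : ℤ)) M (fun b => by simp) (by simp)
      have huw := left_ne_zero_of_mul hne
      have hmem : gridPt M (fun b => ((w b).val : ℤ)) M ∈ U := by
        by_contra h
        simp only [u, if_neg h, ne_eq, not_true] at huw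
      have hp1 : p₀.1 = 1 := by
        by_contra h
        refine h1.2.2.1 h ?_
        simp only [gridPt, Int.cast_natCast]
        exact div_self hM'.ne'
      refine hno ⟨p₀.2, ?_, ?_⟩
      · rw [← hz, ← hp1]
      · rw [← hp1]
        exact h1.1.1 hmem
    · rfl
  let πk : κ → (Fin (n + 1) ≃ Option ι) := fun k =>
    finSuccEquivLast.trans (Equiv.optionCongr (e.trans (σ k)))
  let xk : κ → ι → ℤ := fun k b => ⌈(M : ℝ) * Z k b⌉ - 1
  let φ : κ → (Fin (n + 1) ≃ Option ι) × (ι → ZMod M) := fun k =>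
    (πk k, fun b => (xk k b : ZMod M))
  have hφ : Injective φ := by
    intro k k' hkk
    by_contra hne
    have h2 : ∀ b, (xk k b : ZMod M) = (xk k' b : ZMod M) := fun b =>
      congrFun (congrArg Prod.snd hkk) b
    obtain ⟨m, hm⟩ := (ZMod.intCast_eq_intCast_iff_dvd_sub _ _ _).1 (h2 (bb k k' hne))
    have h3 := hg' k k' hne (-m)
    have h4 := hMg k k' hne
    have h5 : |Z k (bb k k' hne) - Z k' (bb k k' hne) - ((-m : ℤ) : ℝ)| < 1 / M := by
      have c1 := Int.ceil_lt_add_one ((M : ℝ) * Z k (bb k k' hne))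
      have c2 := Int.le_ceil ((M : ℝ) * Z k (bb k k' hne))
      have c3 := Int.ceil_lt_add_one ((M : ℝ) * Z k' (bb k k' hne))
      have c4 := Int.le_ceil ((M : ℝ) * Z k' (bb k k' hne))
      have c5 : ((⌈(M : ℝ) * Z k' (bb k k' hne)⌉ : ℤ) : ℝ) - (⌈(M : ℝ) * Z k (bb k k' hne)⌉ : ℤ)
          = M * m := by
        have : ⌈(M : ℝ) * Z k' (bb k k' hne)⌉ - ⌈(M : ℝ) * Z k (bb k k' hne)⌉ = M * m := by
          simp only [xk] at hm
          linarith
        exact_mod_cast this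
      rw [lt_div_iff₀ hM', ← abs_of_pos hM', ← abs_mul, abs_lt]
      push_cast
      constructor <;> nlinarith
    linarith
  have hS : ∀ p : (Fin (n + 1) ≃ Option ι) × (ι → ZMod M),
      (p.1 (Fin.last n) = none ∧ u (p.2, 0) ≠ 0 ∧ chainInd D G (p.2, 0) p.1 ≠ 0) ↔
        p ∈ Finset.univ.image φ := by
    rintro ⟨π, w⟩
    simp only [Finset.mem_image, Finset.mem_univ, true_and]
    constructor
    · rintro ⟨hπ, huw, hc⟩
      obtain ⟨p₀, hp₀, hz, hall⟩ := hchain w 0 π (Nat.zero_le _) (by exact_mod_cast hc)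
      have h1 := hall (fun b => ((w b).val : ℤ)) 0 (fun b => by simp) (by simp)
      have hmem : gridPt M (fun b => ((w b).val : ℤ)) 0 ∈ U := by
        by_contra h
        simp only [u, if_neg h, ne_eq, not_true] at huw
      have hp1 : p₀.1 = 0 := by
        by_contra h
        refine h1.2.1 h ?_
        simp [gridPt]
      have hp₀' : p₀ = (0, p₀.2) := Prod.ext hp1 rfl
      obtain ⟨k, m, hkm⟩ := hZ p₀.2 (by rw [← hp₀']; exact hz) (by rw [← hp₀']; exact h1.1.1 hmem)
      have hb := (chainInd_ne_zero_iff e hper (M := M) (fun b => ((w b).val : ℤ)) 0 π).1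
        (by rw [hval]; exact hc)
      rw [bijective_signLabel_iff e _ π hπ p₀.2 (σ k)] at hb
      · refine ⟨k, Prod.ext ?_ ?_⟩
        · ext1 i
          induction i using Fin.lastCases with
          | last => rw [hπ]; simp [φ, πk]
          | cast i => rw [hb.1 i]; simp [φ, πk]
        · funext b
          have hb2 := hb.2 b
          rw [hkm] at hb2
          push_cast at hb2
          have : xk k b = (w b).val - M * m b := by
            have : ⌈(M : ℝ) * Z k b⌉ = (w b).val + 1 - M * m b := by
              rw [Int.ceil_eq_iff]
              push_cast
              constructor <;> linarith
            simp only [xk, this]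
            ring
          simp only [φ, this]
          push_cast
          simp
      · intro y hy a
        have h2 := (hall y 0 (by simpa using hy) (by simp)).2.2.2 hp1 k m hkm a
        have : gridPt M y 0 = (0, fun b => (y b : ℝ) / M) := by simp [gridPt]
        rw [this] at h2 ⊢
        exact h2
    · rintro ⟨k, hk⟩
      simp only [φ, Prod.mk.injEq] at hk
      obtain ⟨rfl, rfl⟩ := hk
      have hx : ∀ b, (xk k b : ℝ) < M * Z k b ∧ M * Z k b ≤ xk k b + 1 := by
        intro b
        have c1 := Int.ceil_lt_add_one ((M : ℝ) * Z k b)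
        have c2 := Int.le_ceil ((M : ℝ) * Z k b)
        simp only [xk]
        push_cast
        constructor <;> linarith
      have hnear : ∀ y : ι → ℤ, (∀ b, |y b - xk k b| ≤ 1) →
          dist (fun b => (y b : ℝ) / M) (Z k) < δ k := by
        intro y hy
        refine lt_of_le_of_lt ?_ (hMδ k)
        rw [dist_pi_le_iff (by positivity)]
        intro b
        have h1 := hx b
        have h2 : |(y b : ℝ) - xk k b| ≤ 1 := by exact_mod_cast hy b
        rw [abs_le] at h2
        rw [Real.dist_eq, abs_le]
        have h3 : (y b : ℝ) / M - Z k b = (y b - M * Z k b) / M := by field_simp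
        rw [h3, ← neg_div, div_le_div_iff_of_pos_right hM', div_le_div_iff_of_pos_right hM']
        constructor <;> linarith
      have hpt : ∀ y : ι → ℤ, gridPt M y 0 = (0, fun b => (y b : ℝ) / M) := by
        intro y; simp [gridPt]
      have hπ : πk k (Fin.last n) = none := by simp [πk]
      refine ⟨hπ, ?_, ?_⟩
      · rw [hu, hpt, if_pos (hδ' k _ (hnear (xk k) fun b => by simp)).1]
        exact one_ne_zero
      · refine (chainInd_ne_zero_iff e hper (M := M) (xk k) 0 (πk k)).2 ?_
        rw [bijective_signLabel_iff e _ (πk k) hπ (Z k) (σ k)]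
        · exact ⟨fun i => by simp [πk], hx⟩
        · intro y hy a
          rw [hpt]
          exact (hδ' k _ (hnear y hy)).2 a
  have hfirst : levelCount n D G u 0 = (Fintype.card κ : ZMod 2) := by
    have h1 : levelCount n D G u 0 = ∑ p : (Fin (n + 1) ≃ Option ι) × (ι → ZMod M),
        if p ∈ Finset.univ.image φ then 1 else 0 := by
      rw [Fintype.sum_prod_type]
      unfold levelCount
      refine Finset.sum_congr rfl fun π _ => ?_
      split_ifs with hπ
      · refine Finset.sum_congr rfl fun w _ => ?_
        have := hS (π, w)
        simp only [hπ, true_and] at this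
        by_cases h : (π, w) ∈ Finset.univ.image φ
        · rw [if_pos h, eq_one_of_ne_zero_zmod_two (this.2 h).1,
            eq_one_of_ne_zero_zmod_two (this.2 h).2, mul_one]
        · rw [if_neg h]
          by_contra hne
          exact h (this.1 ⟨left_ne_zero_of_mul hne, right_ne_zero_of_mul hne⟩)
      · symm
        refine Finset.sum_eq_zero fun w _ => ?_
        rw [if_neg]
        intro h
        exact hπ ((hS (π, w)).2 h).1
    rw [h1, Finset.sum_boole, Finset.filter_mem_eq_inter, Finset.univ_inter,
      Finset.card_image_of_injective _ hφ, Finset.card_univ]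
  rw [hfirst, hlast, ZMod.natCast_eq_zero_iff_even] at hcount
  exact (Nat.not_even_iff_odd.2 hodd) hcount

end LW

namespace LW

/-! ### An explicit family of loops -/

/-- The function `f` restricted to the unit intervals `[n, n + 1)` with `n` congruent to `j`. -/
def cut (k : ℕ) (j : ZMod k) (f : ℝ → ℝ) (u : ℝ) : ℝ :=
  if ((⌊u⌋ : ℤ) : ZMod k) = j then f u else 0

theorem abs_cut_sub_le {k : ℕ} (j : ZMod k) {f : ℝ → ℝ} {L : ℝ} (hL : 0 ≤ L)
    (hf : ∀ u v, |f u - f v| ≤ L * |u - v|) (h0 : ∀ n : ℤ, f n = 0) (u v : ℝ) :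
    |cut k j f u - cut k j f v| ≤ L * |u - v| := by
  wlog h : u ≤ v generalizing u v
  · rw [abs_sub_comm, abs_sub_comm u v]
    exact this v u (le_of_not_ge h)
  rcases (Int.floor_mono h).eq_or_lt with hfl | hfl
  · unfold cut
    rw [hfl]
    split_ifs
    · exact hf u v
    · rw [sub_self, abs_zero]; positivity
  · have h1 : |cut k j f u| ≤ L * (⌊u⌋ + 1 - u) := by
      have hu := Int.lt_floor_add_one u
      unfold cut
      split_ifs
      · have := hf u ((⌊u⌋ + 1 : ℤ) : ℝ)
        rw [h0, sub_zero, abs_sub_comm] at this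
        push_cast at this
        rwa [abs_of_nonneg (show (0 : ℝ) ≤ ⌊u⌋ + 1 - u by linarith)] at this
      · rw [abs_zero]
        exact mul_nonneg hL (by linarith)
    have h2 : |cut k j f v| ≤ L * (v - ⌊v⌋) := by
      have hv := Int.floor_le v
      unfold cut
      split_ifs
      · have := hf v (⌊v⌋ : ℤ)
        rw [h0, sub_zero] at this
        rwa [abs_of_nonneg (show (0 : ℝ) ≤ v - ⌊v⌋ by linarith)] at this
      · rw [abs_zero]
        exact mul_nonneg hL (by linarith)
    have h3 : ((⌊u⌋ : ℤ) : ℝ) + 1 ≤ (⌊v⌋ : ℤ) := by exact_mod_cast hfl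
    calc |cut k j f u - cut k j f v| ≤ |cut k j f u| + |cut k j f v| := abs_sub _ _
      _ ≤ L * (⌊u⌋ + 1 - u) + L * (v - ⌊v⌋) := add_le_add h1 h2
      _ ≤ L * (v - u) := by nlinarith
      _ = L * |u - v| := by rw [abs_sub_comm, abs_of_nonneg (sub_nonneg.2 h)]

theorem abs_cos_two_pi_sub_le (u v : ℝ) :
    |Real.cos (2 * Real.pi * u) - Real.cos (2 * Real.pi * v)| ≤ 2 * Real.pi * |u - v| := by
  have := Real.lipschitzWith_cos.dist_le_mul (2 * Real.pi * u) (2 * Real.pi * v)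
  rw [Real.dist_eq, Real.dist_eq, ← mul_sub, abs_mul,
    abs_of_pos (show 0 < 2 * Real.pi by positivity)] at this
  simpa using this

theorem abs_sin_two_pi_sub_le (u v : ℝ) :
    |Real.sin (2 * Real.pi * u) - Real.sin (2 * Real.pi * v)| ≤ 2 * Real.pi * |u - v| := by
  have := Real.lipschitzWith_sin.dist_le_mul (2 * Real.pi * u) (2 * Real.pi * v)
  rw [Real.dist_eq, Real.dist_eq, ← mul_sub, abs_mul,
    abs_of_pos (show 0 < 2 * Real.pi by positivity)] at this
  simpa using this

theorem cos_two_pi_mul_int (n : ℤ) : Real.cos (2 * Real.pi * n) = 1 := by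
  rw [mul_comm]; exact Real.cos_int_mul_two_pi n

theorem sin_two_pi_mul_int (n : ℤ) : Real.sin (2 * Real.pi * n) = 0 := by
  rw [show 2 * Real.pi * (n : ℝ) = ((2 * n : ℤ) : ℝ) * Real.pi by push_cast; ring]
  exact Real.sin_int_mul_pi _

/-- The three profiles of the loops. -/
def prof : Fin 3 → ℝ → ℝ :=
  ![fun u => Real.cos (2 * Real.pi * u) - 1, fun u => max 0 (-Real.cos (2 * Real.pi * u)),
    fun u => Real.sin (2 * Real.pi * u)]

theorem abs_prof_sub_le (a : Fin 3) (u v : ℝ) :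
    |prof a u - prof a v| ≤ 2 * Real.pi * |u - v| := by
  fin_cases a
  · simpa [prof] using abs_cos_two_pi_sub_le u v
  · refine le_trans ?_ (abs_cos_two_pi_sub_le u v)
    simp only [prof, Fin.mk_one, Matrix.cons_val_one, Matrix.cons_val_zero]
    have := abs_max_sub_max_le_abs (-Real.cos (2 * Real.pi * u)) (-Real.cos (2 * Real.pi * v)) 0
    rw [max_comm 0, max_comm 0]
    refine this.trans (le_of_eq ?_)
    rw [← abs_neg]
    congr 1
    ring
  · simpa [prof] using abs_sin_two_pi_sub_le u v

theorem prof_int (a : Fin 3) (n : ℤ) : prof a n = 0 := by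
  fin_cases a <;> simp [prof, cos_two_pi_mul_int, sin_two_pi_mul_int]

theorem prof_add_int (a : Fin 3) (u : ℝ) (n : ℤ) : prof a (u + n) = prof a u := by
  have h : 2 * Real.pi * (u + n) = 2 * Real.pi * u + n * (2 * Real.pi) := by ring
  fin_cases a <;> simp [prof, h, Real.cos_add_int_mul_two_pi, Real.sin_add_int_mul_two_pi]

/-- The amplitude of the loop. -/
def ampl (s : ℝ) : ℝ := max 0 (min 1 (1 / 2 + Real.cos (2 * Real.pi * s)))

/-- The weights of the three profiles. -/
def wt : Fin 3 → ℝ → ℝ := ![ampl, fun s => Real.sin (2 * Real.pi * s), ampl]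

theorem ampl_nonneg (s : ℝ) : 0 ≤ ampl s := le_max_left _ _

theorem ampl_le_one (s : ℝ) : ampl s ≤ 1 := max_le zero_le_one (min_le_left _ _)

theorem wt_abs_le (a : Fin 3) (s : ℝ) : |wt a s| ≤ 1 := by
  have h : |ampl s| ≤ 1 := by rw [abs_of_nonneg (ampl_nonneg s)]; exact ampl_le_one s
  fin_cases a
  · exact h
  · exact Real.abs_sin_le_one _
  · exact h

theorem continuous_wt (a : Fin 3) : Continuous (wt a) := by
  have h : Continuous ampl := by unfold ampl; fun_prop
  fin_cases a
  · exact h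
  · simp only [wt, Fin.mk_one, Matrix.cons_val_one, Matrix.cons_val_zero]; fun_prop
  · exact h

theorem wt_add_int (a : Fin 3) (s : ℝ) (n : ℤ) : wt a (s + n) = wt a s := by
  have h : 2 * Real.pi * (s + n) = 2 * Real.pi * s + n * (2 * Real.pi) := by ring
  fin_cases a <;> simp [wt, ampl, h, Real.cos_add_int_mul_two_pi, Real.sin_add_int_mul_two_pi]

/-- The family of loops: on the `j`-th of `k` subintervals the loop has shape parameter `s j`. -/
def loopFam (k : ℕ) [NeZero k] (s : ZMod k → ℝ) (t : ℝ) (a : Fin 3) : ℝ :=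
  (if a = 0 then 1 else 0) + ∑ j, wt a (s j) * cut k j (prof a) (k * t)

theorem loopFam_eq {k : ℕ} [NeZero k] (s : ZMod k → ℝ) (t : ℝ) (a : Fin 3) :
    loopFam k s t a = (if a = 0 then 1 else 0)
      + wt a (s ((⌊k * t⌋ : ℤ) : ZMod k)) * prof a (k * t) := by
  simp [loopFam, cut]

theorem abs_loopFam_sub_le {k : ℕ} [NeZero k] (s : ZMod k → ℝ) (a : Fin 3) (t t' : ℝ) :
    |loopFam k s t a - loopFam k s t' a| ≤ k * (2 * Real.pi * k) * |t - t'| := by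
  have h : loopFam k s t a - loopFam k s t' a
      = ∑ j, wt a (s j) * (cut k j (prof a) (k * t) - cut k j (prof a) (k * t')) := by
    simp only [loopFam, mul_sub, Finset.sum_sub_distrib]
    ring
  rw [h]
  calc |∑ j, wt a (s j) * (cut k j (prof a) (k * t) - cut k j (prof a) (k * t'))|
      ≤ ∑ j : ZMod k, |wt a (s j) * (cut k j (prof a) (k * t) - cut k j (prof a) (k * t'))| :=
        Finset.abs_sum_le_sum_abs _ _
    _ ≤ ∑ j : ZMod k, 2 * Real.pi * k * |t - t'| := by
        refine Finset.sum_le_sum fun j _ => ?_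
        rw [abs_mul]
        have h1 := abs_cut_sub_le j (by positivity) (abs_prof_sub_le a) (prof_int a)
          (k * t) (k * t')
        rw [← mul_sub, abs_mul, Nat.abs_cast, ← mul_assoc] at h1
        calc _ ≤ 1 * (2 * Real.pi * k * |t - t'|) :=
              mul_le_mul (wt_abs_le _ _) h1 (abs_nonneg _) zero_le_one
          _ = _ := one_mul _
    _ = _ := by simp [mul_assoc]

theorem continuous_loopFam (k : ℕ) [NeZero k] (a : Fin 3) :
    Continuous fun p : (ZMod k → ℝ) × ℝ => loopFam k p.1 p.2 a := by
  have h : ∀ j : ZMod k, Continuous (cut k j (prof a)) := by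
    intro j
    have : LipschitzWith (Real.toNNReal (2 * Real.pi)) (cut k j (prof a)) := by
      refine LipschitzWith.of_dist_le_mul fun u v => ?_
      rw [Real.dist_eq, Real.dist_eq, Real.coe_toNNReal _ (by positivity)]
      exact abs_cut_sub_le j (by positivity) (abs_prof_sub_le a) (prof_int a) u v
    exact this.continuous
  unfold loopFam
  refine continuous_const.add (continuous_finsetSum _ fun j _ => ?_)
  have h1 := continuous_wt a
  have h2 := h j
  fun_prop

theorem loopFam_add_int_left {k : ℕ} [NeZero k] (s : ZMod k → ℝ) (m : ZMod k → ℤ) (t : ℝ)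
    (a : Fin 3) : loopFam k (fun j => s j + m j) t a = loopFam k s t a := by
  simp only [loopFam, wt_add_int]

theorem loopFam_add_int_right {k : ℕ} [NeZero k] (s : ZMod k → ℝ) (t : ℝ) (m : ℤ)
    (a : Fin 3) : loopFam k s (t + m) a = loopFam k s t a := by
  have h : (k : ℝ) * (t + m) = k * t + ((k * m : ℤ) : ℝ) := by push_cast; ring
  rw [loopFam_eq, loopFam_eq, h, prof_add_int, Int.floor_add_intCast]
  simp

theorem abs_loopFam_le {k : ℕ} [NeZero k] (s : ZMod k → ℝ) (t : ℝ) (a : Fin 3) :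
    |loopFam k s t a| ≤ 3 := by
  rw [loopFam_eq]
  have h1 : |prof a (k * t)| ≤ 2 := by
    have c1 := Real.neg_one_le_cos (2 * Real.pi * (k * t))
    have c2 := Real.cos_le_one (2 * Real.pi * (k * t))
    have c3 := Real.neg_one_le_sin (2 * Real.pi * (k * t))
    have c4 := Real.sin_le_one (2 * Real.pi * (k * t))
    fin_cases a
    · simp only [prof, Fin.zero_eta, Matrix.cons_val_zero]
      rw [abs_le]; constructor <;> linarith
    · simp only [prof, Fin.mk_one, Matrix.cons_val_one, Matrix.cons_val_zero]
      rw [abs_of_nonneg (le_max_left _ _)]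
      exact max_le (by norm_num) (by linarith)
    · simp only [prof, Fin.reduceFinMk, Matrix.cons_val]
      rw [abs_le]; constructor <;> linarith
  have h2 := wt_abs_le a (s ((⌊k * t⌋ : ℤ) : ZMod k))
  have h3 : |(if a = 0 then 1 else 0 : ℝ)| ≤ 1 := by split_ifs <;> simp
  refine (abs_add_le _ _).trans ?_
  rw [abs_mul]
  have := mul_le_mul h2 h1 (abs_nonneg _) zero_le_one
  linarith

end LW

namespace LW

/-- Slopes of the rays used to detect a large number of turns. -/
def slope {k : ℕ} (i : ZMod k) : ℝ :=
  if i.val + 1 = k then 0 else if Even i.val then 1 / 2 else -1 / 2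

theorem abs_slope_le {k : ℕ} (i : ZMod k) : |slope i| ≤ 1 / 2 := by
  unfold slope
  split_ifs <;> norm_num [abs_le]

theorem slope_sub_slope {k : ℕ} (hk : Odd k) (hk1 : 1 < k) (i : ZMod k) :
    1 / 2 ≤ |slope i - slope (i + 1)| := by
  have : NeZero k := ⟨by omega⟩
  have h1 : (i + 1).val = (i.val + 1) % k := by
    rw [ZMod.val_add, ZMod.val_one'' (by omega)]
  have h2 := ZMod.val_lt i
  unfold slope
  by_cases h : i.val + 1 = k
  · rw [if_pos h, h1, h, Nat.mod_self, if_neg (by omega), if_pos Even.zero]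
    norm_num
  · rw [if_neg h, h1, Nat.mod_eq_of_lt (by omega)]
    obtain ⟨m, hm⟩ := hk
    by_cases h3 : i.val + 1 + 1 = k
    · rw [if_pos h3]
      split_ifs <;> norm_num
    · rw [if_neg h3]
      simp only [Nat.even_add_one]
      split_ifs <;> norm_num

/-- The shape parameter for which the loop has a corner on the ray of slope `h`. -/
def shape (h : ℝ) : ℝ := Real.arcsin h / (2 * Real.pi)

theorem abs_shape_lt {h : ℝ} (hh : |h| ≤ 1 / 2) : |shape h| < 1 / 6 := by
  have hp := Real.pi_pos
  rw [abs_le] at hh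
  have h1 : Real.arcsin h ≤ Real.pi / 6 := by
    rw [Real.arcsin_le_iff_le_sin' ⟨by linarith, by linarith⟩, Real.sin_pi_div_six]
    exact hh.2
  have h2 : -(Real.pi / 6) ≤ Real.arcsin h := by
    rw [Real.le_arcsin_iff_sin_le' ⟨by linarith, by linarith⟩, Real.sin_neg, Real.sin_pi_div_six]
    exact hh.1
  unfold shape
  rw [abs_lt, lt_div_iff₀ (by positivity), div_lt_iff₀ (by positivity)]
  constructor <;> nlinarith

theorem sin_shape {h : ℝ} (hh : |h| ≤ 1 / 2) : Real.sin (2 * Real.pi * shape h) = h := by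
  have hp := Real.pi_pos
  rw [abs_le] at hh
  unfold shape
  rw [mul_div_cancel₀ _ (by positivity)]
  exact Real.sin_arcsin (by linarith) (by linarith)

theorem half_lt_cos {s : ℝ} (hs : |s| < 1 / 6) : 1 / 2 < Real.cos (2 * Real.pi * s) := by
  have hp := Real.pi_pos
  rw [← Real.cos_abs, ← Real.cos_pi_div_three]
  have : |2 * Real.pi * s| = 2 * Real.pi * |s| := by
    rw [abs_mul, abs_of_pos (by positivity)]
  rw [this]
  refine Real.cos_lt_cos_of_nonneg_of_le_pi (by positivity) (by linarith) ?_
  nlinarith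

theorem ampl_eq_one {s : ℝ} (hs : |s| < 1 / 6) : ampl s = 1 := by
  have := half_lt_cos hs
  unfold ampl
  rw [min_eq_left (by linarith), max_eq_right zero_le_one]

theorem sin_lt_iff_lt_shape {h s : ℝ} (hh : |h| ≤ 1 / 2) (hs : |s| < 1 / 6) :
    Real.sin (2 * Real.pi * s) < h ↔ s < shape h := by
  have hp := Real.pi_pos
  have key : ∀ s : ℝ, |s| < 1 / 6 → 2 * Real.pi * s ∈ Icc (-(Real.pi / 2)) (Real.pi / 2) := by
    intro s hs
    rw [abs_lt] at hs
    constructor <;> nlinarith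
  conv_lhs => rw [← sin_shape hh]
  rw [Real.strictMonoOn_sin.lt_iff_lt (key s hs) (key _ (abs_shape_lt hh))]
  exact mul_lt_mul_iff_right₀ (by positivity)

theorem exists_eq_shape_add_int {s h : ℝ} (h1 : Real.sin (2 * Real.pi * s) = h)
    (h2 : 0 < Real.cos (2 * Real.pi * s)) : ∃ m : ℤ, s = shape h + m := by
  have hp := Real.pi_pos
  refine ⟨round s, ?_⟩
  have h3 := abs_le.1 (abs_sub_round s)
  have h4 : 2 * Real.pi * s = 2 * Real.pi * (s - round s) + (round s : ℤ) * (2 * Real.pi) := by ring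
  rw [h4, Real.sin_add_int_mul_two_pi] at h1
  rw [h4, Real.cos_add_int_mul_two_pi] at h2
  have h5 : 2 * Real.pi * (s - round s) ≤ Real.pi / 2 := by
    by_contra h
    push Not at h
    exact absurd (Real.cos_nonpos_of_pi_div_two_le_of_le h.le (by nlinarith)) (not_le.2 h2)
  have h6 : -(Real.pi / 2) ≤ 2 * Real.pi * (s - round s) := by
    by_contra h
    push Not at h
    rw [← Real.cos_neg] at h2
    exact absurd (Real.cos_nonpos_of_pi_div_two_le_of_le (by linarith) (by nlinarith))
      (not_le.2 h2)
  have h7 : shape h = s - round s := by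
    unfold shape
    rw [← h1, Real.arcsin_sin h6 h5]
    field_simp
  rw [h7]
  ring

theorem prof_half {u : ℝ} {n : ℤ} (hu : u = n + 1 / 2) :
    prof 0 u = -2 ∧ prof 1 u = 1 ∧ prof 2 u = 0 := by
  have h : 2 * Real.pi * u = Real.pi + n * (2 * Real.pi) := by rw [hu]; ring
  simp only [prof, h, Matrix.cons_val_zero, Matrix.cons_val_one, Matrix.cons_val,
    Real.cos_add_int_mul_two_pi, Real.sin_add_int_mul_two_pi, Real.cos_pi, Real.sin_pi]
  norm_num

theorem eq_of_mem_ray {s u h : ℝ} (hh : |h| ≤ 1 / 2) (h0 : 1 + wt 0 s * prof 0 u < 0)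
    (h1 : wt 1 s * prof 1 u + h * (1 + wt 0 s * prof 0 u) = 0) (h2 : wt 2 s * prof 2 u = 0) :
    (∃ n : ℤ, u = n + 1 / 2) ∧ Real.sin (2 * Real.pi * s) = h ∧ 0 < Real.cos (2 * Real.pi * s) := by
  have e0 : wt 0 s = ampl s := rfl
  have e1 : wt 1 s = Real.sin (2 * Real.pi * s) := rfl
  have e2 : wt 2 s = ampl s := rfl
  rw [e0] at h0 h1
  rw [e1] at h1
  rw [e2] at h2
  have hp := Real.pi_pos
  have hpos : 0 < ampl s := by
    rcases (ampl_nonneg s).eq_or_lt with h | h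
    · rw [← h] at h0; norm_num at h0
    · exact h
  have hsin : Real.sin (2 * Real.pi * u) = 0 := by
    rcases mul_eq_zero.1 h2 with h | h
    · exact absurd h hpos.ne'
    · exact h
  have hcos : Real.cos (2 * Real.pi * u) = -1 := by
    have h3 := Real.sin_sq_add_cos_sq (2 * Real.pi * u)
    rw [hsin] at h3
    have h4 : (Real.cos (2 * Real.pi * u) - 1) * (Real.cos (2 * Real.pi * u) + 1) = 0 := by
      nlinarith
    rcases mul_eq_zero.1 h4 with h | h
    · exfalso
      have : prof 0 u = 0 := h
      rw [this] at h0
      norm_num at h0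
    · linarith
  obtain ⟨n, hn⟩ := Real.cos_eq_neg_one_iff.1 hcos
  have hu : u = n + 1 / 2 := by
    have : 2 * Real.pi * (n + 1 / 2 - u) = 0 := by linarith
    rcases mul_eq_zero.1 this with h | h
    · exact absurd h (by positivity)
    · linarith
  obtain ⟨p0, p1, p2⟩ := prof_half hu
  rw [p0] at h0 h1
  rw [p1] at h1
  have hhalf : 1 / 2 < ampl s := by linarith
  have hc : 0 < Real.cos (2 * Real.pi * s) := by
    unfold ampl at hhalf
    rcases lt_max_iff.1 hhalf with h | h
    · norm_num at h
    · linarith [(lt_min_iff.1 h).2]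
  refine ⟨⟨n, hu⟩, ?_, hc⟩
  rcases le_or_gt (1 / 2) (Real.cos (2 * Real.pi * s)) with hle | hgt
  · have : ampl s = 1 := by
      unfold ampl
      rw [min_eq_left (by linarith), max_eq_right zero_le_one]
    rw [this] at h1
    linarith
  · exfalso
    have ha : ampl s = 1 / 2 + Real.cos (2 * Real.pi * s) := by
      unfold ampl
      rw [min_eq_right (by linarith), max_eq_right (by linarith)]
    rw [ha] at h1
    have h5 : Real.sin (2 * Real.pi * s) = 2 * h * Real.cos (2 * Real.pi * s) := by linarith
    have h6 := Real.sin_sq_add_cos_sq (2 * Real.pi * s)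
    rw [h5] at h6
    have h7 : h ^ 2 ≤ 1 / 4 := by
      rw [← sq_abs]
      nlinarith [abs_nonneg h]
    nlinarith

theorem loopFam_ne_zero {k : ℕ} [NeZero k] (s : ZMod k → ℝ) (t : ℝ) : loopFam k s t ≠ 0 := by
  intro h
  have h0 := congrFun h 0
  have h1 := congrFun h 1
  have h2 := congrFun h 2
  rw [loopFam_eq] at h0 h1 h2
  generalize s ((⌊k * t⌋ : ℤ) : ZMod k) = s' at *
  generalize (k : ℝ) * t = u at *
  simp only [if_true, Fin.reduceEq, if_false, zero_add, Pi.zero_apply] at h0 h1 h2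
  have e0 : wt 0 s' = ampl s' := rfl
  have e1 : wt 1 s' = Real.sin (2 * Real.pi * s') := rfl
  have e2 : wt 2 s' = ampl s' := rfl
  rw [e0] at h0
  rw [e1] at h1
  rw [e2] at h2
  rcases mul_eq_zero.1 h2 with h | h
  · rw [h] at h0; norm_num at h0
  have hsin : Real.sin (2 * Real.pi * u) = 0 := h
  have h3 := Real.sin_sq_add_cos_sq (2 * Real.pi * u)
  rw [hsin] at h3
  have h4 : (Real.cos (2 * Real.pi * u) - 1) * (Real.cos (2 * Real.pi * u) + 1) = 0 := by
    nlinarith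
  rcases mul_eq_zero.1 h4 with h | h
  · have : prof 0 u = 0 := h
    rw [this] at h0
    norm_num at h0
  · have hc : Real.cos (2 * Real.pi * u) = -1 := by linarith
    have p0 : prof 0 u = -2 := by
      change Real.cos (2 * Real.pi * u) - 1 = -2
      linarith
    have p1 : prof 1 u = 1 := by
      change max 0 (-Real.cos (2 * Real.pi * u)) = 1
      rw [hc]; norm_num
    rw [p0] at h0
    rw [p1] at h1
    have ha : ampl s' = 1 / 2 := by linarith
    have hc' : Real.cos (2 * Real.pi * s') = 0 := by
      unfold ampl at ha
      rcases max_choice 0 (min 1 (1 / 2 + Real.cos (2 * Real.pi * s'))) with h | h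
      · rw [h] at ha; norm_num at ha
      · rw [h] at ha
        rcases min_choice 1 (1 / 2 + Real.cos (2 * Real.pi * s')) with h | h
        · rw [h] at ha; norm_num at ha
        · rw [h] at ha; linarith
    have := Real.sin_sq_add_cos_sq (2 * Real.pi * s')
    rw [hc'] at this
    rw [mul_one] at h1
    rw [h1] at this
    norm_num at this

/-- The loops stay uniformly away from the origin. -/
theorem exists_le_norm_loopFam (k : ℕ) [NeZero k] :
    ∃ g > 0, ∀ (s : ZMod k → ℝ) (t : ℝ), g ≤ ‖loopFam k s t‖ := by
  have hc : Continuous fun p : (ZMod k → ℝ) × ℝ => ‖loopFam k p.1 p.2‖ :=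
    (continuous_pi fun a => continuous_loopFam k a).norm
  have hK : IsCompact ((Set.univ.pi fun _ : ZMod k => Icc (0 : ℝ) 1) ×ˢ Icc (0 : ℝ) 1) :=
    (isCompact_univ_pi fun _ => isCompact_Icc).prod isCompact_Icc
  have hmem : ∀ q : (ZMod k → ℝ) × ℝ, (∀ j, q.1 j ∈ Icc (0 : ℝ) 1) → q.2 ∈ Icc (0 : ℝ) 1 →
      q ∈ (Set.univ.pi fun _ : ZMod k => Icc (0 : ℝ) 1) ×ˢ Icc (0 : ℝ) 1 :=
    fun q h1 h2 => Set.mem_prod.2 ⟨fun j _ => h1 j, h2⟩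
  obtain ⟨p, -, hp⟩ := hK.exists_isMinOn ⟨(fun _ => 0, 0), hmem _ (fun _ => by simp) (by simp)⟩
    hc.continuousOn
  rw [isMinOn_iff] at hp
  refine ⟨‖loopFam k p.1 p.2‖, norm_pos_iff.2 (loopFam_ne_zero _ _), fun s t => ?_⟩
  have h1 : loopFam k s t = loopFam k (fun j => Int.fract (s j)) (Int.fract t) := by
    funext a
    conv_lhs => rw [← Int.fract_add_floor t, loopFam_add_int_right,
      ← show (fun j => Int.fract (s j) + (⌊s j⌋ : ℤ)) = s from
        funext fun j => Int.fract_add_floor (s j), loopFam_add_int_left]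
  rw [h1]
  exact hp (fun j => Int.fract (s j), Int.fract t) (hmem _
    (fun j => ⟨Int.fract_nonneg _, (Int.fract_lt_one _).le⟩)
    ⟨Int.fract_nonneg _, (Int.fract_lt_one _).le⟩)

end LW

namespace LW

/-- The total cyclic increment of `t`, as an element of the reals; it is always an integer. -/
def winding {k : ℕ} [NeZero k] (t : ZMod k → ℝ) : ℝ := ∑ i, Int.fract (t (i + 1) - t i)

theorem exists_int_eq_winding {k : ℕ} [NeZero k] (t : ZMod k → ℝ) : ∃ n : ℤ, winding t = n := by
  refine ⟨-∑ i, ⌊t (i + 1) - t i⌋, ?_⟩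
  have h : ∑ i, t (i + 1) = ∑ i, t i := Equiv.sum_comp (Equiv.addRight (1 : ZMod k)) t
  simp only [winding, Int.fract, Finset.sum_sub_distrib]
  rw [h]
  push_cast
  ring

theorem winding_add_int {k : ℕ} [NeZero k] (t : ZMod k → ℝ) (m : ZMod k → ℤ) :
    winding (fun i => t i + m i) = winding t := by
  unfold winding
  refine Finset.sum_congr rfl fun i _ => ?_
  rw [show t (i + 1) + m (i + 1) - (t i + m i) = t (i + 1) - t i + ((m (i + 1) - m i : ℤ) : ℝ) by
    push_cast; ring, Int.fract_add_intCast]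

theorem eventually_winding_eq {k : ℕ} [NeZero k] {t : ZMod k → ℝ}
    (ht : ∀ i, ∀ n : ℤ, t (i + 1) - t i ≠ n) : ∀ᶠ t' in 𝓝 t, winding t' = winding t := by
  have hc : ContinuousAt (winding : (ZMod k → ℝ) → ℝ) t := by
    unfold winding
    refine tendsto_finsetSum _ fun i _ => ?_
    have h1 : ContinuousAt (Int.fract : ℝ → ℝ) (t (i + 1) - t i) := by
      refine continuousAt_fract ?_
      intro h
      exact ht i _ h
    have h2 : Continuous fun t : ZMod k → ℝ => t (i + 1) - t i := by fun_prop
    exact ContinuousAt.comp (f := fun t : ZMod k → ℝ => t (i + 1) - t i) h1 h2.continuousAt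
  have := Metric.continuousAt_iff'.1 hc 1 one_pos
  filter_upwards [this] with t' h
  obtain ⟨n, hn⟩ := exists_int_eq_winding t
  obtain ⟨n', hn'⟩ := exists_int_eq_winding t'
  rw [hn, hn', Real.dist_eq] at h
  rw [hn, hn']
  have h1 : |n' - n| < 1 := by exact_mod_cast h
  have : n' - n = 0 := Int.abs_lt_one_iff.1 h1
  exact_mod_cast sub_eq_zero.1 this

theorem intCast_eq_add_of_winding {k : ℕ} [NeZero k] {n : ZMod k → ℤ} {t : ZMod k → ℝ}
    (hn : ∀ i, (k : ℝ) * t i = n i + 1 / 2) (hw : winding t = 1)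
    (hne : ∀ i, ((n (i + 1) : ℤ) : ZMod k) ≠ n i) (i : ZMod k) :
    ((n i : ℤ) : ZMod k) = n 0 + i := by
  have hk : (0 : ℝ) < k := Nat.cast_pos.2 (NeZero.pos k)
  have hkz : (0 : ℤ) < k := Nat.cast_pos.2 (NeZero.pos k)
  have ht : ∀ i, t i = (n i + 1 / 2) / k := fun i => by rw [← hn, mul_div_cancel_left₀ _ hk.ne']
  have hfr : ∀ i, Int.fract (t (i + 1) - t i) = (((n (i + 1) - n i) % (k : ℤ) : ℤ) : ℝ) / k := by
    intro i
    have : t (i + 1) - t i = ((n (i + 1) - n i : ℤ) : ℝ) / k := by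
      rw [ht, ht]; push_cast; ring
    rw [this, Int.fract_div_intCast_eq_div_intCast_mod]
  have hsum : ∑ i, (n (i + 1) - n i) % (k : ℤ) = ∑ _i : ZMod k, (1 : ℤ) := by
    have h1 : (∑ i, (((n (i + 1) - n i) % (k : ℤ) : ℤ) : ℝ)) / k = 1 := by
      rw [Finset.sum_div, ← hw]
      exact Finset.sum_congr rfl fun i _ => (hfr i).symm
    rw [div_eq_one_iff_eq hk.ne'] at h1
    rw [Finset.sum_const, Finset.card_univ, ZMod.card]
    have : (∑ i, (n (i + 1) - n i) % (k : ℤ)) = (k : ℤ) := by exact_mod_cast h1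
    rw [this]; simp
  have hge : ∀ i ∈ Finset.univ, 1 ≤ (n (i + 1) - n i) % (k : ℤ) := by
    intro i _
    have h1 := Int.emod_nonneg (n (i + 1) - n i) hkz.ne'
    rcases h1.eq_or_lt with h | h
    · exfalso
      apply hne i
      have h2 := (ZMod.intCast_zmod_eq_zero_iff_dvd (n (i + 1) - n i) k).2
        (Int.dvd_of_emod_eq_zero h.symm)
      push_cast at h2
      exact sub_eq_zero.1 h2
    · exact h
  have hone : ∀ i, (n (i + 1) - n i) % (k : ℤ) = 1 := fun i =>
    ((Finset.sum_eq_sum_iff_of_le hge).1 hsum.symm i (Finset.mem_univ i)).symm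
  have hstep : ∀ i, ((n (i + 1) : ℤ) : ZMod k) = n i + 1 := by
    intro i
    have h1 : (((n (i + 1) - n i) % (k : ℤ) : ℤ) : ZMod k) = ((n (i + 1) - n i : ℤ) : ZMod k) :=
      ZMod.intCast_mod _ _
    rw [hone] at h1
    push_cast at h1
    linear_combination -h1
  have hnat : ∀ m : ℕ, ((n (m : ZMod k) : ℤ) : ZMod k) = n 0 + m := by
    intro m
    induction m with
    | zero => simp
    | succ m ih => push_cast; rw [hstep, ih]; ring
  have := hnat i.val
  rwa [ZMod.natCast_zmod_val] at this

end LW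

namespace LW

/-- The value at parameter `p` of the family `Y` at the `i`-th marked time. -/
def marked {k : ℕ} (Y : ℝ → (ZMod k → ℝ) → ℝ → Fin 3 → ℝ)
    (p : ℝ × (ZMod k ⊕ ZMod k → ℝ)) (i : ZMod k) : Fin 3 → ℝ :=
  Y p.1 (fun j => p.2 (Sum.inl j)) (p.2 (Sum.inr i))

/-- The map that vanishes when all marked points lie on their rays. -/
def rayMap {k : ℕ} (Y : ℝ → (ZMod k → ℝ) → ℝ → Fin 3 → ℝ)
    (p : ℝ × (ZMod k ⊕ ZMod k → ℝ)) : ZMod k ⊕ ZMod k → ℝ :=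
  Sum.elim (fun i => marked Y p i 1 + slope i * marked Y p i 0) (fun i => -marked Y p i 2)

/-- The parameters for which the marked points lie in the left half space and the marked times
turn exactly once around the circle. -/
def rayDom {k : ℕ} [NeZero k] (Y : ℝ → (ZMod k → ℝ) → ℝ → Fin 3 → ℝ) :
    Set (ℝ × (ZMod k ⊕ ZMod k → ℝ)) :=
  {p | (∀ i, marked Y p i 0 < 0) ∧ winding (fun i => p.2 (Sum.inr i)) = 1}

theorem rayMap_eq_zero_iff {k : ℕ} {Y : ℝ → (ZMod k → ℝ) → ℝ → Fin 3 → ℝ}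
    {p : ℝ × (ZMod k ⊕ ZMod k → ℝ)} : rayMap Y p = 0 ↔
      ∀ i, marked Y p i 1 = -(slope i * marked Y p i 0) ∧ marked Y p i 2 = 0 := by
  constructor
  · intro h i
    have h1 := congrFun h (Sum.inl i)
    have h2 := congrFun h (Sum.inr i)
    simp only [rayMap, Sum.elim_inl, Sum.elim_inr, Pi.zero_apply] at h1 h2
    constructor <;> linarith
  · intro h
    funext a
    rcases a with i | i
    · simp [rayMap, (h i).1]
    · simp [rayMap, (h i).2]

variable {k : ℕ} [NeZero k]

theorem eventually_mem_rayDom_iff (hk : Odd k) (hk1 : 1 < k)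
    {Y : ℝ → (ZMod k → ℝ) → ℝ → Fin 3 → ℝ}
    (hY : Continuous fun p : ℝ × (ZMod k → ℝ) × ℝ => Y p.1 p.2.1 p.2.2)
    (ht : ∀ l s t (m : ℤ), Y l s (t + m) = Y l s t)
    (hne : ∀ l ∈ Icc (0 : ℝ) 1, ∀ s t, Y l s t ≠ 0)
    {p : ℝ × (ZMod k ⊕ ZMod k → ℝ)} (hp : p.1 ∈ Icc (0 : ℝ) 1) (h0 : rayMap Y p = 0) :
    ∀ᶠ q in 𝓝 p, (q ∈ rayDom Y ↔ p ∈ rayDom Y) := by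
  rw [rayMap_eq_zero_iff] at h0
  have hcm : ∀ i a, Continuous fun q => marked Y q i a := by
    intro i a
    have h1 : Continuous fun q : ℝ × (ZMod k ⊕ ZMod k → ℝ) =>
        (q.1, (fun j => q.2 (Sum.inl j)), q.2 (Sum.inr i)) := by fun_prop
    exact (continuous_apply a).comp (hY.comp h1)
  have hnz : ∀ i, marked Y p i 0 ≠ 0 := by
    intro i h
    apply hne p.1 hp (fun j => p.2 (Sum.inl j)) (p.2 (Sum.inr i))
    have h1 := (h0 i).1
    have h2 := (h0 i).2
    rw [h, mul_zero, neg_zero] at h1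
    funext a
    fin_cases a
    · exact h
    · exact h1
    · exact h2
  by_cases hall : ∀ i, marked Y p i 0 < 0
  · have e1 : ∀ᶠ q in 𝓝 p, ∀ i, marked Y q i 0 < 0 :=
      eventually_all.2 fun i => (hcm i 0).continuousAt.eventually_lt continuousAt_const (hall i)
    have hni : ∀ i, ∀ n : ℤ, p.2 (Sum.inr (i + 1)) - p.2 (Sum.inr i) ≠ n := by
      intro i n hn
      have h1 : marked Y p (i + 1) = marked Y p i := by
        unfold marked
        rw [show p.2 (Sum.inr (i + 1)) = p.2 (Sum.inr i) + n by linarith, ht]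
      have h2 := (h0 i).1
      have h3 := (h0 (i + 1)).1
      rw [h1, h2] at h3
      have h4 : (slope i - slope (i + 1)) * marked Y p i 0 = 0 := by linarith
      have h5 := slope_sub_slope hk hk1 i
      rcases mul_eq_zero.1 h4 with h | h
      · rw [h] at h5; norm_num at h5
      · exact hnz i h
    have hc2 : Continuous fun q : ℝ × (ZMod k ⊕ ZMod k → ℝ) => fun i : ZMod k => q.2 (Sum.inr i) := by
      fun_prop
    have e2 := (hc2.tendsto p).eventually (eventually_winding_eq hni)
    filter_upwards [e1, e2] with q h1 h2
    simp only [rayDom, mem_ofPred_eq, h2]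
    exact and_congr_left fun _ => ⟨fun _ => hall, fun _ => h1⟩
  · push Not at hall
    obtain ⟨i, hi⟩ := hall
    have hi' : 0 < marked Y p i 0 := lt_of_le_of_ne hi (hnz i).symm
    filter_upwards [continuousAt_const.eventually_lt (hcm i 0).continuousAt hi'] with q hq
    exact ⟨fun h => absurd (h.1 i) (not_lt.2 hq.le), fun h => absurd (h.1 i) (not_lt.2 hi)⟩

/-- The reference configurations. -/
def refPt (q : ZMod k) : ZMod k ⊕ ZMod k → ℝ :=
  Sum.elim (fun j => shape (slope (j - q))) (fun i => ((q + i).val + 1 / 2) / k)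

theorem loopFam_near {q i : ZMod k} {z : ZMod k ⊕ ZMod k → ℝ}
    (h : |(k : ℝ) * z (Sum.inr i) - ((q + i).val + 1 / 2)| < 1 / 4)
    (hs : |z (Sum.inl (q + i))| < 1 / 6) :
    loopFam k (fun j => z (Sum.inl j)) (z (Sum.inr i)) 0
        = Real.cos (2 * Real.pi * (k * z (Sum.inr i))) ∧
    loopFam k (fun j => z (Sum.inl j)) (z (Sum.inr i)) 1
        = Real.sin (2 * Real.pi * z (Sum.inl (q + i)))
          * -Real.cos (2 * Real.pi * (k * z (Sum.inr i))) ∧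
    loopFam k (fun j => z (Sum.inl j)) (z (Sum.inr i)) 2
        = Real.sin (2 * Real.pi * (k * z (Sum.inr i))) ∧
    Real.cos (2 * Real.pi * (k * z (Sum.inr i))) < 0 ∧
    (0 < Real.sin (2 * Real.pi * (k * z (Sum.inr i))) ↔
      (k : ℝ) * z (Sum.inr i) < (q + i).val + 1 / 2) := by
  have hp := Real.pi_pos
  set u := (k : ℝ) * z (Sum.inr i) with hu
  rw [abs_lt] at h
  have hfl : ⌊u⌋ = ((q + i).val : ℤ) := by
    rw [Int.floor_eq_iff]
    push_cast
    constructor <;> linarith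
  have hj : ((⌊u⌋ : ℤ) : ZMod k) = q + i := by
    rw [hfl, Int.cast_natCast, ZMod.natCast_zmod_val]
  have hrot : 2 * Real.pi * u
      = 2 * Real.pi * (u - ((q + i).val + 1 / 2)) + Real.pi
        + (((q + i).val : ℤ) : ℝ) * (2 * Real.pi) := by
    push_cast; ring
  have hcos : Real.cos (2 * Real.pi * u) < 0 := by
    rw [hrot, Real.cos_add_int_mul_two_pi, Real.cos_add_pi]
    have := Real.cos_pos_of_mem_Ioo (x := 2 * Real.pi * (u - ((q + i).val + 1 / 2)))
      ⟨by nlinarith, by nlinarith⟩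
    linarith
  refine ⟨?_, ?_, ?_, hcos, ?_⟩
  · rw [loopFam_eq, ← hu, hj]
    simp [wt, prof, ampl_eq_one hs]
  · rw [loopFam_eq, ← hu, hj]
    have : max 0 (-Real.cos (2 * Real.pi * u)) = -Real.cos (2 * Real.pi * u) :=
      max_eq_right (by linarith)
    simp [wt, prof, this]
  · rw [loopFam_eq, ← hu, hj]
    simp [wt, prof, ampl_eq_one hs]
  · rw [hrot, Real.sin_add_int_mul_two_pi, Real.sin_add_pi]
    constructor
    · intro h1
      by_contra h2
      have := Real.sin_nonneg_of_nonneg_of_le_pi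
        (x := 2 * Real.pi * (u - ((q + i).val + 1 / 2))) (by nlinarith) (by nlinarith)
      linarith
    · intro h1
      have := Real.sin_neg_of_neg_of_neg_pi_lt
        (x := 2 * Real.pi * (u - ((q + i).val + 1 / 2))) (by nlinarith) (by nlinarith)
      linarith

end LW

namespace LW

variable {k : ℕ} [NeZero k]

theorem loopFam_refPt (q i : ZMod k) :
    loopFam k (fun j => refPt q (Sum.inl j)) (refPt q (Sum.inr i)) 0 = -1 ∧
    loopFam k (fun j => refPt q (Sum.inl j)) (refPt q (Sum.inr i)) 1 = slope i ∧
    loopFam k (fun j => refPt q (Sum.inl j)) (refPt q (Sum.inr i)) 2 = 0 := by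
  have hk : (k : ℝ) ≠ 0 := Nat.cast_ne_zero.2 (NeZero.ne k)
  have hu : (k : ℝ) * refPt q (Sum.inr i) = (q + i).val + 1 / 2 := by
    simp only [refPt, Sum.elim_inr]
    rw [mul_div_cancel₀ _ hk]
  have hs : refPt q (Sum.inl (q + i)) = shape (slope i) := by
    simp [refPt]
  obtain ⟨h0, h1, h2, -, -⟩ := loopFam_near (q := q) (i := i) (z := refPt q)
    (by rw [hu]; norm_num) (by rw [hs]; exact abs_shape_lt (abs_slope_le i))
  have hrot : 2 * Real.pi * ((q + i).val + 1 / 2)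
      = Real.pi + (((q + i).val : ℤ) : ℝ) * (2 * Real.pi) := by
    push_cast; ring
  rw [hu, hrot, Real.cos_add_int_mul_two_pi, Real.cos_pi] at h0 h1
  rw [hu, hrot, Real.sin_add_int_mul_two_pi, Real.sin_pi] at h2
  rw [hs, sin_shape (abs_slope_le i)] at h1
  exact ⟨h0, by linarith, h2⟩

theorem winding_refPt (hk1 : 1 < k) (q : ZMod k) :
    winding (fun i => refPt q (Sum.inr i)) = 1 := by
  have hk : (k : ℝ) ≠ 0 := Nat.cast_ne_zero.2 (NeZero.ne k)
  have h : ∀ i, Int.fract (refPt q (Sum.inr (i + 1)) - refPt q (Sum.inr i)) = 1 / k := by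
    intro i
    have h1 : refPt q (Sum.inr (i + 1)) - refPt q (Sum.inr i)
        = (((q + i + 1).val - (q + i).val : ℤ) : ℝ) / k := by
      simp only [refPt, Sum.elim_inr]
      push_cast
      rw [add_assoc]
      ring
    rw [h1, Int.fract_div_intCast_eq_div_intCast_mod]
    have h2 : (((q + i + 1).val : ℤ) - (q + i).val) % (k : ℤ) = 1 := by
      have h3 : (((1 : ℤ)) : ZMod k) = (((q + i + 1).val : ℤ) - (q + i).val : ℤ) := by
        push_cast
        simp
      rw [← (ZMod.intCast_eq_intCast_iff' _ _ k).1 h3]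
      exact Int.emod_eq_of_lt (by norm_num) (by exact_mod_cast hk1)
    rw [h2]
    simp
  unfold winding
  rw [Finset.sum_congr rfl fun i _ => h i, Finset.sum_const, Finset.card_univ, ZMod.card,
    nsmul_eq_mul, mul_one_div_cancel hk]

theorem refPt_injective {q q' : ZMod k} (m : ZMod k ⊕ ZMod k → ℤ)
    (h : refPt q = fun i => refPt q' i + m i) : q = q' := by
  have hk : (k : ℝ) ≠ 0 := Nat.cast_ne_zero.2 (NeZero.ne k)
  have h1 := congrFun h (Sum.inr 0)
  simp only [refPt, Sum.elim_inr, add_zero] at h1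
  rw [div_add' _ _ _ hk, div_left_inj' hk] at h1
  have h2 : ((q.val : ℤ) : ℝ) = ((q'.val + m (Sum.inr 0) * k : ℤ) : ℝ) := by
    push_cast; linarith
  have h3 := congrArg (Int.cast : ℤ → ZMod k) (Int.cast_injective h2)
  push_cast at h3
  simpa using h3

/-- All zeros of the reference problem are translates of the reference configurations. -/
theorem exists_eq_refPt (hk : Odd k) (hk1 : 1 < k) {z : ZMod k ⊕ ZMod k → ℝ}
    (hneg : ∀ i, loopFam k (fun j => z (Sum.inl j)) (z (Sum.inr i)) 0 < 0)
    (h1 : ∀ i, loopFam k (fun j => z (Sum.inl j)) (z (Sum.inr i)) 1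
      = -(slope i * loopFam k (fun j => z (Sum.inl j)) (z (Sum.inr i)) 0))
    (h2 : ∀ i, loopFam k (fun j => z (Sum.inl j)) (z (Sum.inr i)) 2 = 0)
    (hw : winding (fun i => z (Sum.inr i)) = 1) :
    ∃ q, ∃ m : ZMod k ⊕ ZMod k → ℤ, z = fun i => refPt q i + m i := by
  have hk0 : (k : ℝ) ≠ 0 := Nat.cast_ne_zero.2 (NeZero.ne k)
  have key : ∀ i : ZMod k, ∃ n : ℤ, (k : ℝ) * z (Sum.inr i) = n + 1 / 2 ∧
      Real.sin (2 * Real.pi * z (Sum.inl (n : ZMod k))) = slope i ∧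
      0 < Real.cos (2 * Real.pi * z (Sum.inl (n : ZMod k))) := by
    intro i
    have a0 := hneg i
    have a1 := h1 i
    have a2 := h2 i
    rw [loopFam_eq] at a0 a1 a2
    rw [loopFam_eq] at a1
    simp only [if_true, Fin.reduceEq, if_false, zero_add] at a0 a1 a2
    obtain ⟨⟨n, hn⟩, hs, hc⟩ := eq_of_mem_ray (abs_slope_le i) a0 (by linarith) a2
    have hfl : ⌊(k : ℝ) * z (Sum.inr i)⌋ = n := by
      rw [hn, Int.floor_eq_iff]
      constructor <;> linarith
    rw [hfl] at hs hc
    exact ⟨n, hn, hs, hc⟩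
  choose n hn hs hc using key
  have hcast := intCast_eq_add_of_winding hn hw (fun i h => by
    have e1 := hs (i + 1)
    rw [h, hs i] at e1
    have e2 := slope_sub_slope hk hk1 i
    rw [e1] at e2
    norm_num at e2)
  set q : ZMod k := (n 0 : ZMod k)
  have hl : ∀ j : ZMod k, ∃ m : ℤ, z (Sum.inl j) = refPt q (Sum.inl j) + m := by
    intro j
    have e : ((n (j - q) : ℤ) : ZMod k) = j := by rw [hcast]; ring
    have e1 := hs (j - q)
    have e2 := hc (j - q)
    rw [e] at e1 e2
    exact exists_eq_shape_add_int e1 e2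
  have hr : ∀ i : ZMod k, ∃ m : ℤ, z (Sum.inr i) = refPt q (Sum.inr i) + m := by
    intro i
    have e : ((n i : ℤ) : ZMod k) = (((q + i).val : ℤ) : ZMod k) := by
      rw [hcast]
      push_cast
      simp
    obtain ⟨m, hm⟩ := (ZMod.intCast_eq_intCast_iff_dvd_sub _ _ k).1 e
    refine ⟨-m, ?_⟩
    have hm' : (((q + i).val : ℤ) : ℝ) - n i = k * m := by exact_mod_cast hm
    push_cast at hm'
    simp only [refPt, Sum.elim_inr]
    rw [div_add' _ _ _ hk0, eq_div_iff hk0, mul_comm, hn]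
    push_cast
    linarith
  choose ml hml using hl
  choose mr hmr using hr
  refine ⟨q, Sum.elim ml mr, ?_⟩
  funext a
  rcases a with j | i
  · exact hml j
  · exact hmr i

theorem eventually_sign (q : ZMod k) : ∀ᶠ z in 𝓝 (refPt q), ∀ i : ZMod k,
    (loopFam k (fun j => z (Sum.inl j)) (z (Sum.inr i)) 1
      + slope i * loopFam k (fun j => z (Sum.inl j)) (z (Sum.inr i)) 0 < 0 ↔
        z (Sum.inl (q + i)) < refPt q (Sum.inl (q + i))) ∧
    (0 < loopFam k (fun j => z (Sum.inl j)) (z (Sum.inr i)) 2 ↔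
        z (Sum.inr i) < refPt q (Sum.inr i)) := by
  have hk : (0 : ℝ) < k := Nat.cast_pos.2 (NeZero.pos k)
  rw [eventually_all]
  intro i
  have hu : (k : ℝ) * refPt q (Sum.inr i) = (q + i).val + 1 / 2 := by
    simp only [refPt, Sum.elim_inr]
    rw [mul_div_cancel₀ _ hk.ne']
  have hs : refPt q (Sum.inl (q + i)) = shape (slope i) := by
    simp [refPt]
  have e1 : ∀ᶠ z in 𝓝 (refPt q), |(k : ℝ) * z (Sum.inr i) - ((q + i).val + 1 / 2)| < 1 / 4 := by
    have hc : Continuous fun z : ZMod k ⊕ ZMod k → ℝ =>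
      |(k : ℝ) * z (Sum.inr i) - ((q + i).val + 1 / 2)| := by fun_prop
    refine hc.continuousAt.eventually_lt continuousAt_const ?_
    rw [hu]; norm_num
  have e2 : ∀ᶠ z in 𝓝 (refPt q), |z (Sum.inl (q + i))| < 1 / 6 := by
    have hc : Continuous fun z : ZMod k ⊕ ZMod k → ℝ => |z (Sum.inl (q + i))| := by fun_prop
    refine hc.continuousAt.eventually_lt continuousAt_const ?_
    rw [hs]; exact abs_shape_lt (abs_slope_le i)
  filter_upwards [e1, e2] with z h1 h2
  obtain ⟨a0, a1, a2, a3, a4⟩ := loopFam_near h1 h2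
  rw [a0, a1, a2, a4, hs, ← sin_lt_iff_lt_shape (abs_slope_le i) h2]
  constructor
  · constructor
    · intro h; nlinarith
    · intro h; nlinarith
  · rw [← hu]
    exact mul_lt_mul_iff_right₀ hk

/-- A family of closed curves deformed from the explicit loops inside `ℝ³ ∖ {0}` contains a curve
that oscillates at least as often as the explicit loops. -/
theorem loop_gap (hk : Odd k) (hk1 : 1 < k) {ρ : ℝ} (hρ : 0 < ρ)
    {Y : ℝ → (ZMod k → ℝ) → ℝ → Fin 3 → ℝ}
    (hY : Continuous fun p : ℝ × (ZMod k → ℝ) × ℝ => Y p.1 p.2.1 p.2.2)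
    (hs : ∀ l s t (m : ZMod k → ℤ), Y l (fun j => s j + m j) t = Y l s t)
    (ht : ∀ l s t (m : ℤ), Y l s (t + m) = Y l s t)
    (hne : ∀ l ∈ Icc (0 : ℝ) 1, ∀ s t, Y l s t ≠ 0)
    (h0 : ∀ s t, Y 0 s t = ρ • loopFam k s t) {L δ : ℝ}
    (hL : ∀ s t t' a, |Y 1 s t a - Y 1 s t' a| ≤ L * |t - t'|)
    (hdist : ∀ s t, δ ^ 2 ≤ ∑ a, Y 1 s t a ^ 2) : k * δ ≤ 4 * L := by
  have hm0 : ∀ z i a, marked Y (0, z) i a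
      = ρ * loopFam k (fun j => z (Sum.inl j)) (z (Sum.inr i)) a := by
    intro z i a
    simp only [marked, h0, Pi.smul_apply, smul_eq_mul]
  have hmarkper : ∀ l z (m : ZMod k ⊕ ZMod k → ℤ) i,
      marked Y (l, fun a => z a + m a) i = marked Y (l, z) i := by
    intro l z m i
    simp only [marked]
    rw [ht, hs l (fun j => z (Sum.inl j)) _ (fun j => m (Sum.inl j))]
  obtain ⟨z, hz0, hzneg, hzw⟩ := exists_zero_of_odd (F := rayMap Y) (U := rayDom Y)
    (by
      have hcm : ∀ i a, Continuous fun q => marked Y q i a := by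
        intro i a
        have h1 : Continuous fun q : ℝ × (ZMod k ⊕ ZMod k → ℝ) =>
            (q.1, (fun j => q.2 (Sum.inl j)), q.2 (Sum.inr i)) := by fun_prop
        exact (continuous_apply a).comp (hY.comp h1)
      refine continuous_pi fun a => ?_
      rcases a with i | i
      · exact (hcm i 1).add ((hcm i 0).const_mul _)
      · exact (hcm i 2).neg)
    (by intro l z m; simp only [rayMap, hmarkper])
    (by
      intro l z m
      simp only [rayDom, mem_ofPred_eq, hmarkper]
      rw [winding_add_int (fun i => z (Sum.inr i)) (fun i => m (Sum.inr i))])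
    (fun p hp h => eventually_mem_rayDom_iff hk hk1 hY ht hne hp h)
    (refPt : ZMod k → _)
    (fun q => Equiv.sumCongr (Equiv.addLeft q) (Equiv.refl _))
    (by
      intro z hz hU
      rw [rayMap_eq_zero_iff] at hz
      obtain ⟨hU1, hU2⟩ := hU
      simp only [hm0] at hz hU1
      refine exists_eq_refPt hk hk1 (fun i => ?_) (fun i => ?_) (fun i => ?_) hU2
      · have := hU1 i
        exact (pos_iff_neg_of_mul_neg this).1 hρ
      · have := (hz i).1
        have h3 : ρ * (loopFam k (fun j => z (Sum.inl j)) (z (Sum.inr i)) 1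
          + slope i * loopFam k (fun j => z (Sum.inl j)) (z (Sum.inr i)) 0) = 0 := by linarith
        rcases mul_eq_zero.1 h3 with h | h
        · exact absurd h hρ.ne'
        · linarith
      · rcases mul_eq_zero.1 (hz i).2 with h | h
        · exact absurd h hρ.ne'
        · exact h)
    (by
      intro q
      rw [rayMap_eq_zero_iff]
      intro i
      obtain ⟨a0, a1, a2⟩ := loopFam_refPt q i
      rw [hm0, hm0, hm0, a0, a1, a2]
      constructor <;> ring)
    (by
      intro q
      refine ⟨fun i => ?_, winding_refPt hk1 q⟩
      rw [hm0, (loopFam_refPt q i).1]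
      linarith)
    (fun q q' m h => refPt_injective m h)
    (by
      intro q
      filter_upwards [eventually_sign q] with z hz
      intro a
      rcases a with i | i
      · simp only [rayMap, Sum.elim_inl, hm0, Equiv.sumCongr_apply, Sum.map_inl,
          Equiv.coe_addLeft]
        rw [← (hz i).1]
        constructor
        · intro h
          refine (pos_iff_neg_of_mul_neg (a := ρ) ?_).1 hρ
          linarith
        · intro h
          have := mul_neg_of_pos_of_neg hρ h
          linarith
      · simp only [rayMap, Sum.elim_inr, hm0, Equiv.sumCongr_apply, Sum.map_inr,
          Equiv.refl_apply]
        rw [← (hz i).2, neg_lt_zero]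
        exact mul_pos_iff_of_pos_left hρ)
    (by rw [ZMod.card]; exact hk)
  rw [rayMap_eq_zero_iff] at hz0
  have hgap : ∀ i, δ ≤ 4 * L * Int.fract (z (Sum.inr (i + 1)) - z (Sum.inr i)) := by
    intro i
    set g := Int.fract (z (Sum.inr (i + 1)) - z (Sum.inr i)) with hg
    have hg0 : 0 ≤ g := Int.fract_nonneg _
    have hmk : marked Y (1, z) (i + 1) = Y 1 (fun j => z (Sum.inl j)) (z (Sum.inr i) + g) := by
      unfold marked
      dsimp only
      rw [← ht 1 _ (z (Sum.inr i) + g) ⌊z (Sum.inr (i + 1)) - z (Sum.inr i)⌋]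
      congr 1
      have := Int.fract_add_floor (z (Sum.inr (i + 1)) - z (Sum.inr i))
      rw [hg]
      linarith
    have hd : ∀ a, |marked Y (1, z) (i + 1) a - marked Y (1, z) i a| ≤ L * g := by
      intro a
      rw [hmk]
      have := hL (fun j => z (Sum.inl j)) (z (Sum.inr i) + g) (z (Sum.inr i)) a
      rwa [add_sub_cancel_left, abs_of_nonneg hg0] at this
    have d0 := hd 0
    have d1 := hd 1
    rw [(hz0 i).1, (hz0 (i + 1)).1] at d1
    have n0 := hzneg i
    have n1 := hzneg (i + 1)
    have hdi := hdist (fun j => z (Sum.inl j)) (z (Sum.inr i))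
    change δ ^ 2 ≤ ∑ a, marked Y (1, z) i a ^ 2 at hdi
    rw [Fin.sum_univ_three, (hz0 i).1, (hz0 i).2] at hdi
    have hsl := abs_slope_le i
    have hsl' := abs_slope_le (i + 1)
    have hss := slope_sub_slope hk hk1 i
    set a := marked Y (1, z) i 0
    set b := marked Y (1, z) (i + 1) 0
    set s := slope i
    set s' := slope (i + 1)
    have e1 : |a| * (1 / 2) ≤ |a| * |s - s'| := mul_le_mul_of_nonneg_left hss (abs_nonneg a)
    have e2 : |a| * |s - s'| ≤ L * g + 1 / 2 * (L * g) := by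
      rw [← abs_mul]
      calc |a * (s - s')| = |(-(s' * b) - -(s * a)) + s' * (b - a)| := by congr 1; ring
        _ ≤ |(-(s' * b) - -(s * a))| + |s'| * |b - a| := by
          rw [← abs_mul]; exact abs_add_le _ _
        _ ≤ _ := add_le_add d1 (mul_le_mul hsl' d0 (abs_nonneg _) (by norm_num))
    have e3 : |a| ≤ 3 * (L * g) := by linarith
    have e4 : s ^ 2 ≤ 1 / 4 := by
      rw [← sq_abs]
      nlinarith [abs_nonneg s]
    have e5 : δ ^ 2 ≤ (5 / 4) * a ^ 2 := by nlinarith [sq_nonneg a]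
    have e6 : a ^ 2 ≤ (3 * (L * g)) ^ 2 := by
      rw [← sq_abs a]
      exact pow_le_pow_left₀ (abs_nonneg a) e3 2
    have e7 : 0 ≤ L * g := by linarith [abs_nonneg a]
    have e8 : δ ^ 2 ≤ (4 * (L * g)) ^ 2 := by nlinarith [sq_nonneg (L * g)]
    rw [mul_assoc]
    exact (le_abs_self δ).trans (abs_le_of_sq_le_sq e8 (by linarith))
  have hsum : ∑ _i : ZMod k, δ ≤ ∑ i, 4 * L * Int.fract (z (Sum.inr (i + 1)) - z (Sum.inr i)) :=
    Finset.sum_le_sum fun i _ => hgap i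
  rw [← Finset.mul_sum, Finset.sum_const, Finset.card_univ, ZMod.card, nsmul_eq_mul] at hsum
  have hw : ∑ i, Int.fract (z (Sum.inr (i + 1)) - z (Sum.inr i)) = 1 := hzw
  rwa [hw, mul_one] at hsum

end LW

namespace LW

/-! ### A deformation lemma on convex sets -/

section Deformation

variable {W : Type*} [NormedAddCommGroup W] [InnerProductSpace ℝ W]

/-- The projection on a complete convex set is nonexpansive. -/
theorem exists_continuous_projection [CompleteSpace W] {C : Set W} (hne : C.Nonempty)
    (hcl : IsClosed C) (hC : Convex ℝ C) :
    ∃ P : W → W, Continuous P ∧ (∀ u, P u ∈ C) ∧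
      ∀ u, ∀ w ∈ C, inner ℝ (u - P u) (w - P u) ≤ 0 := by
  choose P hPC hP using fun u => exists_norm_eq_iInf_of_complete_convex hne hcl.isComplete hC u
  have hin : ∀ u, ∀ w ∈ C, inner ℝ (u - P u) (w - P u) ≤ 0 := fun u =>
    (norm_eq_iInf_iff_real_inner_le_zero hC (hPC u)).1 (hP u)
  refine ⟨P, ?_, hPC, hin⟩
  have hlip : LipschitzWith 1 P := by
    refine LipschitzWith.of_dist_le_mul fun u v => ?_
    rw [NNReal.coe_one, one_mul, dist_eq_norm, dist_eq_norm]
    have h1 := hin u (P v) (hPC v)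
    have h2 := hin v (P u) (hPC u)
    have h3 : ‖P u - P v‖ ^ 2 ≤ inner ℝ (u - v) (P u - P v) := by
      have e : inner ℝ (u - v) (P u - P v) - ‖P u - P v‖ ^ 2
          = -(inner ℝ (u - P u) (P v - P u)) - inner ℝ (v - P v) (P u - P v) := by
        rw [← real_inner_self_eq_norm_sq]
        simp only [inner_sub_left, inner_sub_right, real_inner_comm]
        ring
      linarith
    have h4 := real_inner_le_norm (u - v) (P u - P v)
    by_contra h
    push Not at h
    nlinarith [norm_nonneg (u - v)]
  exact hlip.continuous

theorem norm_sq_le_neg_inner_of_projection {C : Set W} {x p g : W} (hx : x ∈ C)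
    (hp : ∀ w ∈ C, inner ℝ (x - g - p) (w - p) ≤ 0) :
    inner ℝ g (p - x) ≤ -‖p - x‖ ^ 2 := by
  have h := hp x hx
  have e : inner ℝ (x - g - p) (x - p) = ‖p - x‖ ^ 2 + inner ℝ g (p - x) := by
    rw [← real_inner_self_eq_norm_sq]
    simp only [inner_sub_left, inner_sub_right]
    ring
  linarith

theorem descent_of_gradient_near {I : W → ℝ} {g : W → W} {x η : W} {ε σ : ℝ} (hσ : 0 ≤ σ)
    (hση : σ ≤ ‖η‖) (hη : inner ℝ (g x) η ≤ -‖η‖ ^ 2)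
    (hI : ∀ s ∈ Icc 0 ε, HasFDerivAt I (innerSL ℝ (g (x + s • η))) (x + s • η))
    (hg : ∀ s ∈ Icc 0 ε, ‖g (x + s • η) - g x‖ ≤ σ / 2) :
    ∀ s ∈ Icc 0 ε, I (x + s • η) ≤ I x - s * (σ ^ 2 / 2) := by
  intro s hs
  have hder : ∀ u ∈ Icc 0 ε, HasDerivAt (fun u : ℝ => I (x + u • η))
      (inner ℝ (g (x + u • η)) η) u := by
    intro u hu
    have h1 : HasDerivAt (fun u : ℝ => x + u • η) η u := by
      simpa using ((hasDerivAt_id u).smul_const η).const_add x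
    exact ((hI u hu).comp_hasDerivAt u h1).congr_deriv (innerSL_apply_apply ..)
  rcases hs.1.eq_or_lt with h | h
  · rw [← h]; simp
  obtain ⟨u, hu, he⟩ := exists_hasDerivAt_eq_slope (fun u : ℝ => I (x + u • η))
    (fun u => inner ℝ (g (x + u • η)) η) h
    (fun u hu => (hder u ⟨hu.1, hu.2.trans hs.2⟩).continuousAt.continuousWithinAt)
    (fun u hu => hder u ⟨hu.1.le, hu.2.le.trans hs.2⟩)
  have hu' : u ∈ Icc 0 ε := ⟨hu.1.le, hu.2.le.trans hs.2⟩
  have h2 : inner ℝ (g (x + u • η)) η ≤ -(σ ^ 2 / 2) := by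
    have e : inner ℝ (g (x + u • η)) η = inner ℝ (g x) η + inner ℝ (g (x + u • η) - g x) η := by
      rw [inner_sub_left]; ring
    have h3 := real_inner_le_norm (g (x + u • η) - g x) η
    have h4 := mul_le_mul_of_nonneg_right (hg u hu') (norm_nonneg η)
    nlinarith
  simp only [zero_smul, add_zero, sub_zero] at he
  rw [he, div_le_iff₀ h] at h2
  linarith

/-- If a functional has no critical point, in the sense of variational inequalities on a convex
set, with values in `[a₀, b]`, then the sublevel set of `b` can be deformed into that of
`a₁ > a₀`. -/
theorem exists_deformation [FiniteDimensional ℝ W] {C O : Set W} (hCcl : IsClosed C)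
    (hC : Convex ℝ C) (hO : IsOpen O) {I : W → ℝ} {g : W → W}
    (hI : ∀ x ∈ O, HasFDerivAt I (innerSL ℝ (g x)) x) (hg : ContinuousOn g O)
    {a₀ a₁ b : ℝ} (ha : a₀ < a₁)
    (hcpt : IsCompact {x | x ∈ C ∧ x ∈ O ∧ a₀ ≤ I x ∧ I x ≤ b})
    (hcrit : ∀ x ∈ C, x ∈ O → a₀ ≤ I x → I x ≤ b → ∃ y ∈ C, inner ℝ (g x) (y - x) < 0) :
    ∃ D : ℝ → W → W, ContinuousOn (fun p : ℝ × W => D p.1 p.2)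
        (univ ×ˢ {x | x ∈ C ∧ x ∈ O ∧ I x ≤ b}) ∧
      (∀ x, D 0 x = x) ∧
      (∀ l x, x ∈ C → x ∈ O → I x ≤ b → D l x ∈ C ∧ D l x ∈ O ∧ I (D l x) ≤ b) ∧
      (∀ x, x ∈ C → x ∈ O → I x ≤ b → I (D 1 x) ≤ a₁) := by
  have : ProperSpace W := FiniteDimensional.proper ℝ W
  rcases C.eq_empty_or_nonempty with hCe | hCne
  · subst hCe
    exact ⟨fun _ x => x, continuousOn_snd, fun _ => rfl, by simp, by simp⟩
  set S := {x | x ∈ C ∧ x ∈ O ∧ a₀ ≤ I x ∧ I x ≤ b} with hS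
  set K := {x | x ∈ C ∧ x ∈ O ∧ I x ≤ b} with hK
  obtain ⟨P, hPcont, hPC, hPin⟩ := exists_continuous_projection hCne hCcl hC
  set η : W → W := fun x => P (x - g x) - x with hη
  have hηO : ContinuousOn η O := by
    have h1 : ContinuousOn (fun x => x - g x) O := continuousOn_id.sub hg
    exact (hPcont.comp_continuousOn h1).sub continuousOn_id
  have hηin : ∀ x ∈ C, inner ℝ (g x) (η x) ≤ -‖η x‖ ^ 2 := fun x hx =>
    norm_sq_le_neg_inner_of_projection hx (hPin _)
  have hηne : ∀ x ∈ S, η x ≠ 0 := by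
    rintro x ⟨h1, h2, h3, h4⟩ h
    obtain ⟨y, hy, hlt⟩ := hcrit x h1 h2 h3 h4
    have h5 : P (x - g x) = x := sub_eq_zero.1 h
    have h6 := hPin (x - g x) y hy
    rw [h5, sub_sub_cancel_left, inner_neg_left] at h6
    linarith
  have hSO : S ⊆ O := fun x hx => hx.2.1
  -- uniform constants
  obtain ⟨σ, hσ, hσS⟩ : ∃ σ > (0 : ℝ), ∀ x ∈ S, σ ≤ ‖η x‖ := by
    rcases S.eq_empty_or_nonempty with hSe | hSne
    · exact ⟨1, one_pos, by simp [hSe]⟩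
    · obtain ⟨x, hx, hmin⟩ := hcpt.exists_isMinOn hSne (hηO.mono hSO).norm
      exact ⟨‖η x‖, norm_pos_iff.2 (hηne x hx), fun y hy => hmin hy⟩
  obtain ⟨M, hM⟩ : ∃ M, ∀ x ∈ S, ‖η x‖ ≤ M := hcpt.exists_bound_of_continuousOn (hηO.mono hSO)
  obtain ⟨ρ, hρ, hρO⟩ := hcpt.exists_cthickening_subset_open hO hSO
  obtain ⟨ρ', hρ', hgu⟩ : ∃ ρ' > 0, ∀ x ∈ S, ∀ y ∈ Metric.cthickening ρ S, dist y x < ρ' →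
      ‖g y - g x‖ ≤ σ / 2 := by
    have huc := (hcpt.cthickening (r := ρ)).uniformContinuousOn_of_continuous (hg.mono hρO)
    obtain ⟨ρ', h1, h2⟩ := Metric.uniformContinuousOn_iff.1 huc (σ / 2) (by positivity)
    refine ⟨ρ', h1, fun x hx y hy hd => ?_⟩
    rw [← dist_eq_norm]
    exact (h2 y hy x (Metric.self_subset_cthickening S hx) hd).le
  obtain ⟨ε, hε, hε1, hεb⟩ : ∃ ε > (0 : ℝ), ε ≤ 1 ∧ ∀ x ∈ S, ∀ s ∈ Icc 0 ε, ‖s • η x‖ < min ρ ρ' := by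
    refine ⟨min 1 (min ρ ρ' / (|M| + 1)), by positivity, min_le_left _ _, fun x hx s hs => ?_⟩
    have hm : 0 < min ρ ρ' := by positivity
    rw [norm_smul, Real.norm_of_nonneg hs.1]
    have h1 : ‖η x‖ < |M| + 1 := by linarith [hM x hx, le_abs_self M]
    have h2 : s ≤ min ρ ρ' / (|M| + 1) := hs.2.trans (min_le_right _ _)
    rw [le_div_iff₀ (by positivity)] at h2
    rcases hs.1.eq_or_lt with h | h
    · rw [← h, zero_mul]; exact hm
    · exact (mul_lt_mul_of_pos_left h1 h).trans_le h2
  have hstepO : ∀ x ∈ S, ∀ s ∈ Icc 0 ε, x + s • η x ∈ Metric.cthickening ρ S := by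
    intro x hx s hs
    refine Metric.mem_cthickening_of_dist_le _ x ρ S hx ?_
    rw [dist_eq_norm, add_sub_cancel_left]
    exact ((hεb x hx s hs).trans_le (min_le_left _ _)).le
  have hdesc : ∀ x ∈ S, ∀ s ∈ Icc 0 ε, I (x + s • η x) ≤ I x - s * (σ ^ 2 / 2) := by
    intro x hx
    refine descent_of_gradient_near hσ.le (hσS x hx) (hηin x hx.1)
      (fun s hs => hI _ (hρO (hstepO x hx s hs))) fun s hs => ?_
    refine hgu x hx _ (hstepO x hx s hs) ?_
    rw [dist_eq_norm, add_sub_cancel_left]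
    exact (hεb x hx s hs).trans_le (min_le_right _ _)
  -- one step of the deformation
  set θ : ℝ → W → ℝ := fun l x => max 0 (min 1 l) * min ε (max 0 (I x - a₀)) with hθ
  have hθmem : ∀ l x, θ l x ∈ Icc 0 ε := by
    intro l x
    have h1 : 0 ≤ max 0 (min 1 l) := le_max_left _ _
    have h2 : max 0 (min 1 l) ≤ 1 := max_le zero_le_one (min_le_left _ _)
    have h3 : 0 ≤ min ε (max 0 (I x - a₀)) := le_min hε.le (le_max_left _ _)
    have h4 : min ε (max 0 (I x - a₀)) ≤ ε := min_le_left _ _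
    exact ⟨mul_nonneg h1 h3, by
      calc _ ≤ 1 * ε := mul_le_mul h2 h4 h3 zero_le_one
        _ = ε := one_mul ε⟩
  set F : ℝ → W → W := fun l x => x + θ l x • η x with hF
  have hF0 : ∀ x, F 0 x = x := by intro x; simp [hF, hθ]
  have hFlow : ∀ l x, I x ≤ a₀ → F l x = x := by
    intro l x hx
    have : max 0 (I x - a₀) = 0 := max_eq_left (by linarith)
    simp [hF, hθ, this, min_eq_right hε.le]
  have hFK : ∀ l x, x ∈ K → F l x ∈ K ∧ I (F l x) ≤ I x := by
    intro l x hx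
    rcases le_or_gt (I x) a₀ with h | h
    · rw [hFlow l x h]; exact ⟨hx, le_rfl⟩
    · have hxS : x ∈ S := ⟨hx.1, hx.2.1, h.le, hx.2.2⟩
      have hm := hθmem l x
      have h1 := hdesc x hxS _ hm
      have h2 : I (F l x) ≤ I x := by
        have : 0 ≤ θ l x * (σ ^ 2 / 2) := mul_nonneg hm.1 (by positivity)
        exact h1.trans (by linarith)
      refine ⟨⟨?_, hρO (hstepO x hxS _ hm), h2.trans hx.2.2⟩, h2⟩
      have : F l x = (1 - θ l x) • x + θ l x • P (x - g x) := by
        simp only [hF, hη, smul_sub, sub_smul, one_smul]; abel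
      rw [this]
      exact hC hx.1 (hPC _) (by linarith [hm.2]) hm.1 (by ring)
  set ν := min ε (a₁ - a₀) * (σ ^ 2 / 2) with hν
  have hν0 : 0 < ν := mul_pos (lt_min hε (by linarith)) (by positivity)
  have hFdec : ∀ x ∈ K, a₁ ≤ I x → I (F 1 x) ≤ I x - ν := by
    intro x hx h
    have hxS : x ∈ S := ⟨hx.1, hx.2.1, by linarith, hx.2.2⟩
    refine (hdesc x hxS _ (hθmem 1 x)).trans ?_
    have h1 : min ε (a₁ - a₀) ≤ θ 1 x := by
      simp only [hθ, min_self, max_eq_right zero_le_one, one_mul]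
      exact min_le_min_left _ (le_max_of_le_right (by linarith))
    have := mul_le_mul_of_nonneg_right h1 (show 0 ≤ σ ^ 2 / 2 by positivity)
    linarith
  have hFcont : ContinuousOn (fun p : ℝ × W => F p.1 p.2) (univ ×ˢ K) := by
    have hKO : MapsTo Prod.snd ((univ : Set ℝ) ×ˢ K) O := fun p hp => hp.2.2.1
    have c1 : ContinuousOn (fun p : ℝ × W => η p.2) (univ ×ˢ K) :=
      hηO.comp continuousOn_snd hKO
    have c2 : ContinuousOn (fun p : ℝ × W => I p.2) (univ ×ˢ K) :=
      ContinuousOn.comp (fun x hx => (hI x hx).continuousAt.continuousWithinAt)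
        continuousOn_snd hKO
    have c3 : ContinuousOn (fun p : ℝ × W => θ p.1 p.2) (univ ×ˢ K) := by
      have c4 : ContinuousOn (fun p : ℝ × W => min ε (max 0 (I p.2 - a₀))) (univ ×ˢ K) :=
        ContinuousOn.inf continuousOn_const
          (ContinuousOn.sup continuousOn_const (c2.sub continuousOn_const))
      have c5 : Continuous fun p : ℝ × W => max 0 (min 1 p.1) := by fun_prop
      exact c5.continuousOn.mul c4
    exact continuousOn_snd.add (c3.smul c1)
  -- iteration
  have hit : ∀ n : ℕ, ContinuousOn (fun p : ℝ × W => (F p.1)^[n] p.2) (univ ×ˢ K) ∧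
      (∀ l x, x ∈ K → (F l)^[n] x ∈ K) ∧
      (∀ x ∈ K, I ((F 1)^[n] x) ≤ max a₁ (I x - n * ν)) := by
    intro n
    induction n with
    | zero => exact ⟨by simpa using continuousOn_snd, fun l x hx => by simpa using hx,
        fun x _ => by simp⟩
    | succ n ih =>
      obtain ⟨i1, i2, i3⟩ := ih
      refine ⟨?_, fun l x hx => ?_, fun x hx => ?_⟩
      · simp only [iterate_succ_apply']
        exact hFcont.comp (f := fun p : ℝ × W => (p.1, (F p.1)^[n] p.2))
          (continuousOn_fst.prodMk i1) fun p hp => ⟨mem_univ _, i2 _ _ hp.2⟩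
      · rw [iterate_succ_apply']
        exact (hFK l _ (i2 l x hx)).1
      · rw [iterate_succ_apply']
        have hy := i2 1 x hx
        have h3 := i3 x hx
        rcases le_or_gt a₁ (I ((F 1)^[n] x)) with h | h
        · have h4 := hFdec _ hy h
          rcases le_max_iff.1 h3 with h5 | h5
          · exact le_max_of_le_left (by linarith)
          · refine le_max_of_le_right ?_
            push_cast
            linarith
        · exact le_max_of_le_left ((hFK 1 _ hy).2.trans h.le)
  obtain ⟨n, hn⟩ := exists_nat_ge ((b - a₁) / ν)
  rw [div_le_iff₀ hν0] at hn
  refine ⟨fun l => (F l)^[n], (hit n).1, fun x => ?_, fun l x h1 h2 h3 => (hit n).2.1 l x ⟨h1, h2, h3⟩,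
    fun x h1 h2 h3 => ((hit n).2.2 x ⟨h1, h2, h3⟩).trans (max_le le_rfl (by linarith))⟩
  exact Function.iterate_fixed (hF0 x) n

end Deformation

end LW

namespace LW

/-! ### Retarded times -/

section Retarded

variable {r : ℝ → E3} {b c : ℝ}

theorem retarded_mono (hc : 0 < c) (hbc : b < c) (hr : ∀ s t, ‖r s - r t‖ ≤ b * |s - t|)
    {t t' s s' : ℝ} {x : E3} (h : s = t - ‖x - r s‖ / c) (h' : s' = t' - ‖x - r s'‖ / c)
    (htt : t = t') : s = s' := by
  have h1 : |s - s'| ≤ b / c * |s - s'| := by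
    have e : s - s' = (‖x - r s'‖ - ‖x - r s‖) / c := by
      rw [sub_div]; linarith
    calc |s - s'| = |‖x - r s'‖ - ‖x - r s‖| / c := by rw [e, abs_div, abs_of_pos hc]
      _ ≤ ‖(x - r s') - (x - r s)‖ / c := by gcongr; exact abs_norm_sub_norm_le _ _
      _ = ‖r s - r s'‖ / c := by congr 2; abel
      _ ≤ b * |s - s'| / c := by gcongr; exact hr _ _
      _ = _ := by ring
  have h2 : b / c < 1 := (div_lt_one hc).2 hbc
  have h3 : |s - s'| = 0 := by nlinarith [abs_nonneg (s - s')]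
  exact sub_eq_zero.1 (abs_eq_zero.1 h3)

theorem ne_retarded {t s : ℝ} {x : E3} (h : s = t - ‖x - r s‖ / c)
    (hx : x ≠ r t) : x ≠ r s := by
  intro h1
  rw [← h1, sub_self, norm_zero, zero_div, sub_zero] at h
  rw [h] at h1
  exact hx h1

theorem norm_sub_retarded_le (hc : 0 < c) (hr : ∀ s t, ‖r s - r t‖ ≤ b * |s - t|)
    {t s : ℝ} {x : E3} (h : s = t - ‖x - r s‖ / c) :
    ‖x - r t‖ ≤ (1 + b / c) * ‖x - r s‖ ∧ (1 - b / c) * ‖x - r s‖ ≤ ‖x - r t‖ := by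
  have h1 := hr s t
  have e : |s - t| = ‖x - r s‖ / c := by
    rw [show s - t = -(‖x - r s‖ / c) by linarith, abs_neg, abs_of_nonneg (by positivity)]
  rw [e] at h1
  have h2 : ‖x - r t‖ ≤ ‖x - r s‖ + ‖r s - r t‖ := by
    have := norm_add_le (x - r s) (r s - r t)
    rwa [sub_add_sub_cancel] at this
  have h3 : ‖x - r s‖ ≤ ‖x - r t‖ + ‖r s - r t‖ := by
    have := norm_sub_le (x - r t) (r s - r t)
    rwa [sub_sub_sub_cancel_right] at this
  have e2 : b / c * ‖x - r s‖ = b * (‖x - r s‖ / c) := by ring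
  constructor <;> linarith

theorem contDiffAt_retarded (hc : 0 < c) (hbc : b < c)
    (hr : ∀ s t, ‖r s - r t‖ ≤ b * |s - t|) (hC : ContDiff ℝ 1 r) {τ : ℝ × E3 → ℝ} {p : ℝ × E3}
    (hp : p.2 ≠ r p.1) (hτ : ∀ᶠ q in 𝓝 p, τ q = q.1 - ‖q.2 - r (τ q)‖ / c) :
    ContDiffAt ℝ 1 τ p := by
  have h0 := hτ.self_of_nhds
  have hne : p.2 - r (τ p) ≠ 0 := sub_ne_zero.2 (ne_retarded h0 hp)
  set f : (ℝ × E3) × ℝ → ℝ := fun w => w.2 - w.1.1 + ‖w.1.2 - r w.2‖ / c with hf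
  have hfC : ContDiffAt ℝ 1 f (p, τ p) := by
    have h1 : ContDiffAt ℝ 1 (fun w : (ℝ × E3) × ℝ => w.1.2 - r w.2) (p, τ p) := by fun_prop
    have h2 : ContDiffAt ℝ 1 (fun w : (ℝ × E3) × ℝ => ‖w.1.2 - r w.2‖) (p, τ p) :=
      h1.norm ℝ hne
    exact (contDiffAt_snd.sub contDiffAt_fst.fst).add (h2.div_const c)
  have hf0 : f (p, τ p) = 0 := by simp only [hf]; linarith
  have hinv : (fderiv ℝ f (p, τ p) ∘L .inr ℝ (ℝ × E3) ℝ).IsInvertible := by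
    set d := (fderiv ℝ f (p, τ p) ∘L .inr ℝ (ℝ × E3) ℝ) 1 with hd
    have hder : HasDerivAt (fun s => f (p, s)) d (τ p) := by
      have h1 := (hfC.differentiableAt one_ne_zero).hasFDerivAt
      have h2 : HasDerivAt (fun s : ℝ => ((p, s) : (ℝ × E3) × ℝ)) (0, 1) (τ p) :=
        (hasDerivAt_const (τ p) p).prodMk (hasDerivAt_id (τ p))
      exact h1.comp_hasDerivAt (τ p) h2
    have hder' : HasDerivAt (fun s => f (p, s) - s) (d - 1) (τ p) := hder.sub (hasDerivAt_id _)
    have hb : 0 ≤ b := by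
      have := (norm_nonneg _).trans (hr 1 0)
      simpa using this
    have hle : ‖d - 1‖ ≤ b / c := by
      refine hder'.le_of_lip' (by positivity) (Eventually.of_forall fun s => ?_)
      have e : f (p, s) - s - (f (p, τ p) - τ p)
          = (‖p.2 - r s‖ - ‖p.2 - r (τ p)‖) / c := by simp only [hf]; ring
      rw [e, Real.norm_eq_abs, Real.norm_eq_abs, abs_div, abs_of_pos hc]
      calc _ ≤ ‖(p.2 - r s) - (p.2 - r (τ p))‖ / c := by
            gcongr; exact abs_norm_sub_norm_le _ _
        _ = ‖r s - r (τ p)‖ / c := by rw [← norm_neg]; congr 2; abel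
        _ ≤ b * |s - τ p| / c := by gcongr; exact hr _ _
        _ = _ := by ring
    have hd0 : d ≠ 0 := by
      intro h
      rw [h] at hle
      have h2 : b / c < 1 := (div_lt_one hc).2 hbc
      norm_num at hle
      linarith
    refine ⟨ContinuousLinearEquiv.unitsEquivAut ℝ (Units.mk0 d hd0), ?_⟩
    ext
    simp [hd]
  have hψC := hfC.contDiffAt_implicitFunction one_ne_zero hinv
  have hψ := hfC.eventually_apply_implicitFunction one_ne_zero hinv
  refine hψC.congr_of_eventuallyEq ?_
  filter_upwards [hτ, hψ] with q h1 h2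
  rw [hf0] at h2
  simp only [hf] at h2
  exact retarded_mono hc hbc hr h1 (by linarith) rfl

end Retarded

end LW

namespace LW

/-- The properties of the charges and the potentials that are used to find periodic motions:
the charges move with speed at most `b < c` at mutual distance at least `d`, the potentials are
continuously differentiable and periodic, and the interaction part of the Lagrangian is
repulsive and controlled by the distances to the charges. -/
structure FieldData (T c κ K b d : ℝ) {N : ℕ} (r : Fin N → ℝ → E3) (V : ℝ → E3 → ℝ)
    (A : ℝ → E3 → E3) : Prop where
  T_pos : 0 < T
  c_pos : 0 < c
  κ_pos : 0 < κ
  K_nonneg : 0 ≤ K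
  b_nonneg : 0 ≤ b
  b_lt : b < c
  d_pos : 0 < d
  r_per : ∀ i, Periodic (r i) T
  r_lip : ∀ i s t, ‖r i s - r i t‖ ≤ b * |s - t|
  r_sep : ∀ i j, i ≠ j → ∀ t, d ≤ ‖r i t - r j t‖
  V_smooth : ∀ p ∈ Omega N r, ContDiffAt ℝ 1 (fun p : ℝ × E3 => V p.1 p.2) p
  A_smooth : ∀ p ∈ Omega N r, ContDiffAt ℝ 1 (fun p : ℝ × E3 => A p.1 p.2) p
  V_per : ∀ p ∈ Omega N r, V (p.1 + T) p.2 = V p.1 p.2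
  A_per : ∀ p ∈ Omega N r, A (p.1 + T) p.2 = A p.1 p.2
  lower : ∀ p ∈ Omega N r, ∀ v : E3, ‖v‖ ≤ c → ∀ i,
    κ / ‖p.2 - r i p.1‖ ≤ -V p.1 p.2 + inner ℝ v (A p.1 p.2)
  upper : ∀ p : ℝ × E3, ∀ δ > 0, (∀ i, δ ≤ ‖p.2 - r i p.1‖) → ∀ v : E3, ‖v‖ ≤ c →
    -V p.1 p.2 + inner ℝ v (A p.1 p.2) ≤ K / δ

theorem dot_eq_inner (u v : E3) : dot u v = inner ℝ u v := by
  simp [dot, toFn, PiLp.inner_apply, mul_comm]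

theorem norm_inv_norm_smul {w : E3} (hw : w ≠ 0) : ‖‖w‖⁻¹ • w‖ = 1 := by
  rw [norm_smul, norm_inv, norm_norm, inv_mul_cancel₀ (norm_ne_zero_iff.2 hw)]

theorem exists_pos_le_of_finite {ι : Type*} [Finite ι] (f : ι → ℝ) (hf : ∀ i, 0 < f i) :
    ∃ m > 0, ∀ i, m ≤ f i := by
  rcases isEmpty_or_nonempty ι with h | h
  · exact ⟨1, one_pos, fun i => isEmptyElim i⟩
  · obtain ⟨i, hi⟩ := Finite.exists_min f
    exact ⟨f i, hf i, hi⟩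

theorem exists_pos_le_of_periodic {T : ℝ} (hT : 0 < T) {f : ℝ → ℝ} (hf : Continuous f)
    (hper : Periodic f T) (hpos : ∀ t ∈ Icc 0 T, 0 < f t) : ∃ m > 0, ∀ t, m ≤ f t := by
  obtain ⟨t, ht, hmin⟩ := (isCompact_Icc (a := 0) (b := T)).exists_isMinOn
    ⟨0, le_rfl, hT.le⟩ hf.continuousOn
  refine ⟨f t, hpos t ht, fun s => ?_⟩
  obtain ⟨s', hs', he⟩ := hper.exists_mem_Ico₀ hT s
  rw [he]
  exact hmin ⟨hs'.1, hs'.2.le⟩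

theorem exists_speed_bound {T c : ℝ} (hT : 0 < T) (hc : 0 < c) {N : ℕ} {r : Fin N → ℝ → E3}
    (hper : ∀ i, Periodic (r i) T) (hC : ∀ i, ContDiff ℝ 1 (r i))
    (hspeed : ∀ i t, ‖deriv (r i) t‖ < c) :
    ∃ b, 0 ≤ b ∧ b < c ∧ (∀ i t, ‖deriv (r i) t‖ ≤ b) ∧
      ∀ i s t, ‖r i s - r i t‖ ≤ b * |s - t| := by
  have h1 : ∀ i, ∃ m > 0, ∀ t, m ≤ c - ‖deriv (r i) t‖ := by
    intro i
    refine exists_pos_le_of_periodic hT ?_ ?_ fun t _ => sub_pos.2 (hspeed i t)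
    · exact continuous_const.sub ((hC i).continuous_deriv le_rfl).norm
    · intro t
      have : deriv (r i) (t + T) = deriv (r i) t := by
        rw [← deriv_comp_add_const, show (fun s => r i (s + T)) = r i from funext (hper i)]
      simp only [this]
  choose m hm hmt using h1
  obtain ⟨e, he, hei⟩ := exists_pos_le_of_finite m hm
  have hb : ∀ i t, ‖deriv (r i) t‖ ≤ max 0 (c - e) := fun i t =>
    le_max_of_le_right (by linarith [hmt i t, hei i])
  refine ⟨max 0 (c - e), le_max_left _ _, max_lt hc (by linarith), hb, fun i s t => ?_⟩
  rw [← Real.norm_eq_abs]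
  exact convex_univ.norm_image_sub_le_of_norm_deriv_le
    (fun u _ => ((hC i).differentiable one_ne_zero).differentiableAt) (fun u _ => hb i u)
    (mem_univ t) (mem_univ s)

theorem isOpen_Omega {N : ℕ} {r : Fin N → ℝ → E3} (hr : ∀ i, Continuous (r i)) :
    IsOpen (Omega N r) := by
  have : Omega N r = ⋂ i, {p : ℝ × E3 | p.2 ≠ r i p.1} := by ext; simp [Omega]
  rw [this]
  exact isOpen_iInter_of_finite fun i =>
    isOpen_ne_fun continuous_snd ((hr i).comp continuous_fst)

theorem contDiffAt_Vi {c ε₀ b : ℝ} (hc : 0 < c) (hbc : b < c) {N : ℕ} (q : Fin N → ℝ)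
    {r : Fin N → ℝ → E3} (hC2 : ∀ i, ContDiff ℝ 2 (r i))
    (hb : ∀ i t, ‖deriv (r i) t‖ ≤ b)
    {τ : Fin N → ℝ → E3 → ℝ} {p : ℝ × E3} (i : Fin N)
    (hτ : ContDiffAt ℝ 1 (fun p : ℝ × E3 => τ i p.1 p.2) p) (hne : p.2 ≠ r i (τ i p.1 p.2)) :
    ContDiffAt ℝ 1 (fun p : ℝ × E3 => Vi c ε₀ q r τ i p.1 p.2) p ∧
    ContDiffAt ℝ 1 (fun p : ℝ × E3 => deriv (r i) (τ i p.1 p.2)) p := by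
  have h1 : ContDiff ℝ 1 (r i) := (hC2 i).of_le (by norm_num)
  have h2 : ContDiff ℝ 1 (deriv (r i)) := by
    have : ContDiff ℝ (1 + 1) (r i) := by
      have := hC2 i
      norm_num
      exact this
    exact (contDiff_succ_iff_deriv.1 this).2.2
  have c1 : ContDiffAt ℝ 1 (fun p : ℝ × E3 => p.2 - r i (τ i p.1 p.2)) p :=
    contDiffAt_snd.sub (h1.contDiffAt.comp p hτ)
  have c2 : ContDiffAt ℝ 1 (fun p : ℝ × E3 => deriv (r i) (τ i p.1 p.2)) p :=
    h2.contDiffAt.comp p hτ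
  have hz : p.2 - r i (τ i p.1 p.2) ≠ 0 := sub_ne_zero.2 hne
  have hz' : ‖p.2 - r i (τ i p.1 p.2)‖ ≠ 0 := norm_ne_zero_iff.2 hz
  have c3 : ContDiffAt ℝ 1 (fun p : ℝ × E3 => ‖p.2 - r i (τ i p.1 p.2)‖) p := c1.norm ℝ hz
  refine ⟨?_, c2⟩
  unfold Vi
  simp only [dot_eq_inner]
  refine contDiffAt_const.mul (ContDiffAt.div contDiffAt_const ?_ ?_)
  · exact (contDiffAt_const.sub (((c3.inv hz').smul c1).inner ℝ (c2.const_smul c⁻¹))).mul c3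
  · refine mul_ne_zero ?_ hz'
    have h3 := abs_real_inner_le_norm ((‖p.2 - r i (τ i p.1 p.2)‖)⁻¹ • (p.2 - r i (τ i p.1 p.2)))
      (c⁻¹ • deriv (r i) (τ i p.1 p.2))
    rw [norm_inv_norm_smul hz, one_mul, norm_smul, norm_inv, Real.norm_of_nonneg hc.le,
      inv_mul_eq_div] at h3
    have h4 : ‖deriv (r i) (τ i p.1 p.2)‖ / c ≤ b / c := by gcongr; exact hb _ _
    have h5 : b / c < 1 := (div_lt_one hc).2 hbc
    have h6 := (abs_le.1 h3).2
    intro h7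
    linarith

/-- Bounds on the interaction term of one charge. -/
theorem Vi_bounds {c ε₀ b : ℝ} (hc : 0 < c) (hb0 : 0 ≤ b) (hbc : b < c) (hε₀ : 0 < ε₀) {N : ℕ}
    {q : Fin N → ℝ} (hq : ∀ i, q i < 0) {r : Fin N → ℝ → E3}
    (hb : ∀ i t, ‖deriv (r i) t‖ ≤ b) (hlip : ∀ i s t, ‖r i s - r i t‖ ≤ b * |s - t|)
    {τ : Fin N → ℝ → E3 → ℝ} {t : ℝ} {x : E3} (i : Fin N)
    (hτ : τ i t x = t - ‖x - r i (τ i t x)‖ / c) (hx : x ≠ r i t) {v : E3} (hv : ‖v‖ ≤ c) :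
    -q i / (4 * Real.pi * ε₀) * ((1 - b / c) ^ 2 / (1 + b / c)) / ‖x - r i t‖
      ≤ -Vi c ε₀ q r τ i t x
        + inner ℝ v ((Vi c ε₀ q r τ i t x / c ^ 2) • deriv (r i) (τ i t x)) ∧
    -Vi c ε₀ q r τ i t x
        + inner ℝ v ((Vi c ε₀ q r τ i t x / c ^ 2) • deriv (r i) (τ i t x))
      ≤ -q i / (4 * Real.pi * ε₀) * ((1 + b / c) ^ 2 / (1 - b / c)) / ‖x - r i t‖ := by
  have hne := ne_retarded hτ hx
  obtain ⟨d1, d2⟩ := norm_sub_retarded_le hc (hlip i) hτ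
  have hz : x - r i (τ i t x) ≠ 0 := sub_ne_zero.2 hne
  unfold Vi
  rw [dot_eq_inner, real_inner_smul_right v]
  set s := τ i t x
  set Q := q i / (4 * Real.pi * ε₀) with hQ
  have hQ0 : Q < 0 := div_neg_of_neg_of_pos (hq i) (by have := Real.pi_pos; positivity)
  set ρ := ‖x - r i s‖
  have hρ : 0 < ρ := norm_pos_iff.2 hz
  have hR : 0 < ‖x - r i t‖ := norm_pos_iff.2 (sub_ne_zero.2 hx)
  set R := ‖x - r i t‖
  set β := b / c with hβ
  have hβ0 : 0 ≤ β := by positivity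
  have hβ1 : β < 1 := (div_lt_one hc).2 hbc
  set u := inner ℝ (ρ⁻¹ • (x - r i s)) (c⁻¹ • deriv (r i) s)
  have hu : |u| ≤ β := by
    have h3 := abs_real_inner_le_norm (ρ⁻¹ • (x - r i s)) (c⁻¹ • deriv (r i) s)
    rw [norm_inv_norm_smul hz, one_mul, norm_smul, norm_inv, Real.norm_of_nonneg hc.le,
      inv_mul_eq_div] at h3
    exact h3.trans (by rw [hβ]; gcongr; exact hb _ _)
  set w := inner ℝ v (deriv (r i) s) with hw
  have hw' : |w / c ^ 2| ≤ β := by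
    rw [abs_div, abs_of_pos (pow_pos hc 2), div_le_iff₀ (pow_pos hc 2)]
    calc |w| ≤ ‖v‖ * ‖deriv (r i) s‖ := abs_real_inner_le_norm _ _
      _ ≤ c * b := mul_le_mul hv (hb _ _) (norm_nonneg _) hc.le
      _ = β * c ^ 2 := by rw [hβ]; field_simp
  rw [abs_le] at hu hw'
  have e : -(Q * (1 / ((1 - u) * ρ))) + Q * (1 / ((1 - u) * ρ)) / c ^ 2 * w
      = -Q * ((1 - w / c ^ 2) / ((1 - u) * ρ)) := by ring
  have e' : -q i / (4 * Real.pi * ε₀) = -Q := by rw [hQ, neg_div]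
  have hu1 : 0 < 1 - u := by linarith
  have p1 : 0 < 1 - β := by linarith
  have p2 : 0 < 1 + β := by linarith
  rw [e, e', mul_div_assoc, mul_div_assoc]
  constructor
  · refine mul_le_mul_of_nonneg_left ?_ (by linarith)
    rw [div_div, div_le_div_iff₀ (by positivity) (by positivity)]
    calc (1 - β) ^ 2 * ((1 - u) * ρ) = ((1 - β) * ρ) * ((1 - β) * (1 - u)) := by ring
      _ ≤ R * ((1 - w / c ^ 2) * (1 + β)) := by
        refine mul_le_mul d2 ?_ (by positivity) hR.le
        exact mul_le_mul (by linarith) (by linarith) hu1.le (by linarith)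
      _ = _ := by ring
  · refine mul_le_mul_of_nonneg_left ?_ (by linarith)
    rw [div_div, div_le_div_iff₀ (by positivity) (by positivity)]
    calc (1 - w / c ^ 2) * ((1 - β) * R) ≤ (1 + β) * ((1 - u) * ((1 + β) * ρ)) := by
          refine mul_le_mul (by linarith) ?_ (by positivity) (by linarith)
          exact mul_le_mul (by linarith) d1 hR.le hu1.le
      _ = _ := by ring

/-- The Liénard–Wiechert potentials of negative charges. -/
theorem exists_fieldData {T c ε₀ : ℝ} (hT : 0 < T) (hc : 0 < c) (hε₀ : 0 < ε₀)
    {N : ℕ} {q : Fin N → ℝ} (hq : ∀ i, q i < 0) {r : Fin N → ℝ → E3}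
    (hper : ∀ i, Periodic (r i) T) (hC2 : ∀ i, ContDiff ℝ 2 (r i))
    (hspeed : ∀ i t, ‖deriv (r i) t‖ < c)
    (hsep : ∀ i j, i ≠ j → ∀ t ∈ Icc (0:ℝ) T, r i t ≠ r j t)
    {τ : Fin N → ℝ → E3 → ℝ}
    (hτ : ∀ i, ∀ p ∈ Omega N r, τ i p.1 p.2 = p.1 - ‖p.2 - r i (τ i p.1 p.2)‖ / c) :
    ∃ κ K b d, FieldData T c κ K b d r (VLW c ε₀ q r τ) (ALW c ε₀ q r τ) := by
  have hpi := Real.pi_pos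
  have hC1 : ∀ i, ContDiff ℝ 1 (r i) := fun i => (hC2 i).of_le (by norm_num)
  obtain ⟨b, hb0, hbc, hb, hlip⟩ := exists_speed_bound hT hc hper hC1 hspeed
  have hsep' : ∀ p : {p : Fin N × Fin N // p.1 ≠ p.2}, ∃ m > 0, ∀ t,
      m ≤ ‖r p.1.1 t - r p.1.2 t‖ := by
    rintro ⟨⟨i, j⟩, hij⟩
    refine exists_pos_le_of_periodic hT ((hC1 i).continuous.sub (hC1 j).continuous).norm ?_ ?_
    · intro t; simp only [hper i t, hper j t]
    · exact fun t ht => norm_pos_iff.2 (sub_ne_zero.2 (hsep i j hij t ht))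
  choose m hm hmt using hsep'
  obtain ⟨d, hd, hdm⟩ := exists_pos_le_of_finite m hm
  have hβ1 : b / c < 1 := (div_lt_one hc).2 hbc
  have hβ0 : 0 ≤ b / c := by positivity
  have p1 : 0 < 1 - b / c := by linarith
  have p2 : 0 < 1 + b / c := by linarith
  have hQ : ∀ i, 0 < -q i / (4 * Real.pi * ε₀) := fun i =>
    div_pos (neg_pos.2 (hq i)) (by positivity)
  obtain ⟨κ, hκ, hκi⟩ := exists_pos_le_of_finite
    (fun i => -q i / (4 * Real.pi * ε₀) * ((1 - b / c) ^ 2 / (1 + b / c)))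
    (fun i => mul_pos (hQ i) (by positivity))
  have hopen := isOpen_Omega fun i => (hC1 i).continuous
  have hτC : ∀ i, ∀ p ∈ Omega N r, ContDiffAt ℝ 1 (fun p : ℝ × E3 => τ i p.1 p.2) p :=
    fun i p hp => contDiffAt_retarded hc hbc (hlip i) (hC1 i) (hp i)
      (by filter_upwards [hopen.mem_nhds hp] with p' hp' using hτ i p' hp')
  have hder : ∀ i t, deriv (r i) (t + T) = deriv (r i) t := by
    intro i t
    rw [← deriv_comp_add_const, show (fun s => r i (s + T)) = r i from funext (hper i)]
  have hτper : ∀ i, ∀ p ∈ Omega N r, τ i (p.1 + T) p.2 = τ i p.1 p.2 + T := by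
    intro i p hp
    have hp' : (p.1 + T, p.2) ∈ Omega N r := fun j => by
      change p.2 ≠ r j (p.1 + T)
      rw [hper j]; exact hp j
    refine retarded_mono hc hbc (hlip i) (hτ i _ hp') (t' := p.1 + T) (x := p.2) ?_ rfl
    rw [hper i, add_sub_right_comm, ← hτ i p hp]
  have hViper : ∀ i, ∀ p ∈ Omega N r, Vi c ε₀ q r τ i (p.1 + T) p.2 = Vi c ε₀ q r τ i p.1 p.2 := by
    intro i p hp
    unfold Vi
    rw [hτper i p hp, hper i, hder i]
  have hsplit : ∀ (t : ℝ) (x v : E3), -VLW c ε₀ q r τ t x + inner ℝ v (ALW c ε₀ q r τ t x)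
      = ∑ i, (-Vi c ε₀ q r τ i t x
        + inner ℝ v ((Vi c ε₀ q r τ i t x / c ^ 2) • deriv (r i) (τ i t x))) := by
    intro t x v
    simp only [VLW, ALW, inner_sum, Finset.sum_add_distrib, Finset.sum_neg_distrib]
  refine ⟨κ, ∑ i, -q i / (4 * Real.pi * ε₀) * ((1 + b / c) ^ 2 / (1 - b / c)), b, d,
    hT, hc, hκ, Finset.sum_nonneg fun i _ => (mul_pos (hQ i) (by positivity)).le, hb0, hbc, hd,
    hper, hlip, fun i j hij t => (hdm ⟨(i, j), hij⟩).trans (hmt ⟨(i, j), hij⟩ t), ?_, ?_, ?_, ?_,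
    ?_, ?_⟩
  · intro p hp
    exact ContDiffAt.sum fun i _ => (contDiffAt_Vi hc hbc q hC2 hb i (hτC i p hp)
      (ne_retarded (hτ i p hp) (hp i))).1
  · intro p hp
    refine ContDiffAt.sum fun i _ => ?_
    obtain ⟨h1, h2⟩ := contDiffAt_Vi (ε₀ := ε₀) hc hbc q hC2 hb i (hτC i p hp)
      (ne_retarded (hτ i p hp) (hp i))
    exact (h1.div_const _).smul h2
  · intro p hp
    simp only [VLW, hViper _ p hp]
  · intro p hp
    simp only [ALW, hViper _ p hp, hτper _ p hp, hder]
  · intro p hp v hv i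
    have hbd := fun j => Vi_bounds hc hb0 hbc hε₀ hq hb hlip j (hτ j p hp) (hp j) hv
    rw [hsplit]
    calc κ / ‖p.2 - r i p.1‖
        ≤ -q i / (4 * Real.pi * ε₀) * ((1 - b / c) ^ 2 / (1 + b / c)) / ‖p.2 - r i p.1‖ := by
          gcongr; exact hκi i
      _ ≤ _ := (hbd i).1
      _ ≤ _ := Finset.single_le_sum (f := fun i => -Vi c ε₀ q r τ i p.1 p.2
        + inner ℝ v ((Vi c ε₀ q r τ i p.1 p.2 / c ^ 2) • deriv (r i) (τ i p.1 p.2)))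
        (fun j _ => le_trans (div_nonneg (mul_nonneg (hQ j).le (by positivity)) (norm_nonneg _))
          (hbd j).1) (Finset.mem_univ i)
  · intro p δ hδ hdist v hv
    have hp : p ∈ Omega N r := fun i h => by
      have := hdist i
      rw [h, sub_self, norm_zero] at this
      linarith
    rw [hsplit, Finset.sum_div]
    refine Finset.sum_le_sum fun i _ => ?_
    refine (Vi_bounds hc hb0 hbc hε₀ hq hb hlip i (hτ i p hp) (hp i) hv).2.trans ?_
    have := mul_pos (hQ i) (show 0 < (1 + b / c) ^ 2 / (1 - b / c) by positivity)
    gcongr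
    exact hdist i

end LW

namespace LW

/-- The Lagrangian `c² - c²√(1 - |v|²/c²) - V(t,x) + ⟨v, A(t,x)⟩`. -/
def lag (c : ℝ) (V : ℝ → E3 → ℝ) (A : ℝ → E3 → E3) (q : ℝ × E3 × E3) : ℝ :=
  c ^ 2 - c ^ 2 * Real.sqrt (1 - ‖q.2.2‖ ^ 2 / c ^ 2) - V q.1 q.2.1
    + inner ℝ q.2.2 (A q.1 q.2.1)

/-- The gradient of the Lagrangian in the position variable. -/
def force (V : ℝ → E3 → ℝ) (A : ℝ → E3 → E3) (q : ℝ × E3 × E3) : E3 :=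
  (InnerProductSpace.toDual ℝ E3).symm
    (-(fderiv ℝ (fun p : ℝ × E3 => V p.1 p.2) (q.1, q.2.1)).comp (.inr ℝ ℝ E3)
      + (innerSL ℝ q.2.2).comp
        ((fderiv ℝ (fun p : ℝ × E3 => A p.1 p.2) (q.1, q.2.1)).comp (.inr ℝ ℝ E3)))

/-- The relativistic momentum. -/
def mom (c : ℝ) (v : E3) : E3 := (Real.sqrt (1 - ‖v‖ ^ 2 / c ^ 2))⁻¹ • v

/-- The velocity with a given relativistic momentum. -/
def velOfMom (c : ℝ) (p : E3) : E3 := (Real.sqrt (1 + ‖p‖ ^ 2 / c ^ 2))⁻¹ • p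

/-- The states with admissible position and velocity. -/
def States (c : ℝ) {N : ℕ} (r : Fin N → ℝ → E3) : Set (ℝ × E3 × E3) :=
  {q | (q.1, q.2.1) ∈ Omega N r ∧ ‖q.2.2‖ < c}

theorem one_sub_sq_div_pos {c a : ℝ} (ha : 0 ≤ a) (hac : a < c) : 0 < 1 - a ^ 2 / c ^ 2 := by
  have hc : 0 < c := ha.trans_lt hac
  rw [sub_pos, div_lt_one (by positivity)]
  exact pow_lt_pow_left₀ hac ha two_ne_zero

theorem velOfMom_mom {c : ℝ} {v : E3} (hv : ‖v‖ < c) : velOfMom c (mom c v) = v := by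
  have h := one_sub_sq_div_pos (norm_nonneg v) hv
  have hc : 0 < c := (norm_nonneg v).trans_lt hv
  set s := Real.sqrt (1 - ‖v‖ ^ 2 / c ^ 2) with hs
  have hs0 : 0 < s := Real.sqrt_pos.2 h
  have hs2 : s ^ 2 = 1 - ‖v‖ ^ 2 / c ^ 2 := Real.sq_sqrt h.le
  have : Real.sqrt (1 + ‖mom c v‖ ^ 2 / c ^ 2) = s⁻¹ := by
    rw [Real.sqrt_eq_iff_mul_self_eq (by positivity) (by positivity), mom, ← hs, norm_smul,
      norm_inv, Real.norm_of_nonneg hs0.le]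
    have : ‖v‖ ^ 2 / c ^ 2 = 1 - s ^ 2 := by rw [hs2]; ring
    have h3 : ‖v‖ ^ 2 = (1 - s ^ 2) * c ^ 2 := by rw [← this]; field_simp
    rw [mul_pow, h3]
    field_simp
    ring
  rw [velOfMom, this, inv_inv, mom, ← hs, smul_smul, mul_inv_cancel₀ hs0.ne', one_smul]

theorem norm_velOfMom_lt {c : ℝ} (hc : 0 < c) (p : E3) : ‖velOfMom c p‖ < c := by
  have h : 0 < 1 + ‖p‖ ^ 2 / c ^ 2 := by positivity
  have h' := Real.sqrt_pos.2 h
  rw [velOfMom, norm_smul, norm_inv, Real.norm_of_nonneg h'.le, inv_mul_lt_iff₀ h', mul_comm]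
  have : ‖p‖ / c < Real.sqrt (1 + ‖p‖ ^ 2 / c ^ 2) := by
    apply Real.lt_sqrt_of_sq_lt
    rw [div_pow]; linarith
  rwa [div_lt_iff₀ hc, mul_comm] at this

theorem mom_velOfMom {c : ℝ} (hc : 0 < c) (p : E3) : mom c (velOfMom c p) = p := by
  have h : 0 < 1 + ‖p‖ ^ 2 / c ^ 2 := by positivity
  set s := Real.sqrt (1 + ‖p‖ ^ 2 / c ^ 2) with hs
  have hs0 : 0 < s := Real.sqrt_pos.2 h
  have hs2 : s ^ 2 = 1 + ‖p‖ ^ 2 / c ^ 2 := Real.sq_sqrt h.le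
  have hv : velOfMom c p = s⁻¹ • p := rfl
  have : Real.sqrt (1 - ‖velOfMom c p‖ ^ 2 / c ^ 2) = s⁻¹ := by
    have h4 := one_sub_sq_div_pos (norm_nonneg _) (norm_velOfMom_lt hc p)
    rw [Real.sqrt_eq_iff_mul_self_eq h4.le (by positivity), hv, norm_smul,
      norm_inv, Real.norm_of_nonneg hs0.le]
    have : ‖p‖ ^ 2 / c ^ 2 = s ^ 2 - 1 := by rw [hs2]; ring
    have h3 : ‖p‖ ^ 2 = (s ^ 2 - 1) * c ^ 2 := by rw [← this]; field_simp
    rw [mul_pow, h3]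
    field_simp
    ring
  rw [mom, this, inv_inv, hv, smul_smul, mul_inv_cancel₀ hs0.ne', one_smul]

theorem continuous_velOfMom {c : ℝ} : Continuous (velOfMom c) := by
  unfold velOfMom
  have hs : Continuous fun p : E3 => Real.sqrt (1 + ‖p‖ ^ 2 / c ^ 2) := by fun_prop
  refine Continuous.smul (hs.inv₀ fun p => ?_) continuous_id
  have h : 0 < 1 + ‖p‖ ^ 2 / c ^ 2 := by positivity
  exact (Real.sqrt_pos.2 h).ne'

theorem continuousOn_mom {c : ℝ} : ContinuousOn (mom c) {v | ‖v‖ < c} := by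
  unfold mom
  have hs : Continuous fun v : E3 => Real.sqrt (1 - ‖v‖ ^ 2 / c ^ 2) := by fun_prop
  refine ContinuousOn.smul (hs.continuousOn.inv₀ fun v hv => ?_) continuousOn_id
  exact (Real.sqrt_pos.2 (one_sub_sq_div_pos (norm_nonneg v) hv)).ne'

theorem inner_force (V : ℝ → E3 → ℝ) (A : ℝ → E3 → E3) (q : ℝ × E3 × E3) (y : E3) :
    inner ℝ (force V A q) y = -fderiv ℝ (fun p : ℝ × E3 => V p.1 p.2) (q.1, q.2.1) (0, y)
      + inner ℝ q.2.2 (fderiv ℝ (fun p : ℝ × E3 => A p.1 p.2) (q.1, q.2.1) (0, y)) := by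
  rw [force, InnerProductSpace.toDual_symm_apply]
  simp

namespace FieldData

variable {T c κ K b d : ℝ} {N : ℕ} {r : Fin N → ℝ → E3} {V : ℝ → E3 → ℝ} {A : ℝ → E3 → E3}

theorem continuous_r (F : FieldData T c κ K b d r V A) (i : Fin N) : Continuous (r i) := by
  have : LipschitzWith ⟨b, F.b_nonneg⟩ (r i) := LipschitzWith.of_dist_le_mul fun s t => by
    rw [dist_eq_norm, Real.dist_eq]; exact F.r_lip i s t
  exact this.continuous

theorem isOpen_Omega (F : FieldData T c κ K b d r V A) : IsOpen (Omega N r) :=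
  LW.isOpen_Omega F.continuous_r

theorem isOpen_States (F : FieldData T c κ K b d r V A) : IsOpen (States c r) :=
  (F.isOpen_Omega.preimage (by fun_prop : Continuous fun q : ℝ × E3 × E3 => (q.1, q.2.1))).inter
    (isOpen_lt (by fun_prop : Continuous fun q : ℝ × E3 × E3 => ‖q.2.2‖) continuous_const)

theorem continuousOn_A (F : FieldData T c κ K b d r V A) :
    ContinuousOn (fun p : ℝ × E3 => A p.1 p.2) (Omega N r) :=
  fun p hp => (F.A_smooth p hp).continuousAt.continuousWithinAt

theorem continuousOn_fderiv_V (F : FieldData T c κ K b d r V A) :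
    ContinuousOn (fderiv ℝ fun p : ℝ × E3 => V p.1 p.2) (Omega N r) :=
  ContDiffOn.continuousOn_fderiv_of_isOpen
    (fun p hp => (F.V_smooth p hp).contDiffWithinAt) F.isOpen_Omega le_rfl

theorem continuousOn_fderiv_A (F : FieldData T c κ K b d r V A) :
    ContinuousOn (fderiv ℝ fun p : ℝ × E3 => A p.1 p.2) (Omega N r) :=
  ContDiffOn.continuousOn_fderiv_of_isOpen
    (fun p hp => (F.A_smooth p hp).contDiffWithinAt) F.isOpen_Omega le_rfl

theorem continuousOn_force (F : FieldData T c κ K b d r V A) :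
    ContinuousOn (force V A) {q : ℝ × E3 × E3 | (q.1, q.2.1) ∈ Omega N r} := by
  have e : ContinuousOn (fun q : ℝ × E3 × E3 => (q.1, q.2.1))
      {q : ℝ × E3 × E3 | (q.1, q.2.1) ∈ Omega N r} := by fun_prop
  have hV := F.continuousOn_fderiv_V.comp e fun q hq => hq
  have hA := F.continuousOn_fderiv_A.comp e fun q hq => hq
  unfold force
  refine (LinearIsometryEquiv.continuous _).comp_continuousOn ?_
  refine ContinuousOn.add (ContinuousOn.neg (hV.clm_comp continuousOn_const)) ?_
  exact ContinuousOn.clm_comp ((innerSL ℝ).continuous.comp_continuousOn (by fun_prop))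
    (hA.clm_comp continuousOn_const)

theorem contDiffAt_lag (F : FieldData T c κ K b d r V A) {q : ℝ × E3 × E3}
    (hq : q ∈ States c r) : ContDiffAt ℝ 1 (lag c V A) q := by
  have e : ContDiffAt ℝ 1 (fun q : ℝ × E3 × E3 => (q.1, q.2.1)) q := by fun_prop
  have hV := (F.V_smooth _ hq.1).comp q e
  have hA := (F.A_smooth _ hq.1).comp q e
  have hv : ContDiffAt ℝ 1 (fun q : ℝ × E3 × E3 => q.2.2) q := by fun_prop
  unfold lag
  refine ((contDiffAt_const.sub (contDiffAt_const.mul (ContDiffAt.sqrt ?_ ?_))).sub hV).add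
    (hv.inner ℝ hA)
  · exact contDiffAt_const.sub (hv.norm_sq ℝ |>.div_const _)
  · exact (one_sub_sq_div_pos (norm_nonneg _) hq.2).ne'

theorem fderiv_lag (F : FieldData T c κ K b d r V A) {q : ℝ × E3 × E3}
    (hq : q ∈ States c r) (y w : E3) :
    fderiv ℝ (lag c V A) q (0, y, w)
      = inner ℝ (force V A q) y + inner ℝ (mom c q.2.2 + A q.1 q.2.1) w := by
  have hd := ((F.contDiffAt_lag hq).differentiableAt one_ne_zero).hasFDerivAt
  have hline : HasDerivAt (fun s : ℝ => q + s • ((0, y, w) : ℝ × E3 × E3)) (0, y, w) 0 := by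
    simpa using ((hasDerivAt_id (0 : ℝ)).smul_const ((0, y, w) : ℝ × E3 × E3)).const_add q
  have h0 : q + (0:ℝ) • ((0, y, w) : ℝ × E3 × E3) = q := by simp
  have h1 := HasFDerivAt.comp_hasDerivAt (f := fun s : ℝ => q + s • ((0, y, w) : ℝ × E3 × E3))
    (0:ℝ) (by rw [h0]; exact hd) hline
  have hV := ((F.V_smooth _ hq.1).differentiableAt one_ne_zero).hasFDerivAt
  have hA := ((F.A_smooth _ hq.1).differentiableAt one_ne_zero).hasFDerivAt
  have hline2 : HasDerivAt (fun s : ℝ => ((q.1, q.2.1) : ℝ × E3) + s • ((0, y) : ℝ × E3))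
      (0, y) 0 := by
    simpa using ((hasDerivAt_id (0 : ℝ)).smul_const ((0, y) : ℝ × E3)).const_add
      ((q.1, q.2.1) : ℝ × E3)
  have h02 : ((q.1, q.2.1) : ℝ × E3) + (0:ℝ) • ((0, y) : ℝ × E3) = (q.1, q.2.1) := by simp
  have hV1 := HasFDerivAt.comp_hasDerivAt
    (f := fun s : ℝ => ((q.1, q.2.1) : ℝ × E3) + s • ((0, y) : ℝ × E3))
    (0:ℝ) (by rw [h02]; exact hV) hline2
  have hA1 := HasFDerivAt.comp_hasDerivAt
    (f := fun s : ℝ => ((q.1, q.2.1) : ℝ × E3) + s • ((0, y) : ℝ × E3))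
    (0:ℝ) (by rw [h02]; exact hA) hline2
  have hv : HasDerivAt (fun s : ℝ => q.2.2 + s • w) w 0 := by
    simpa using ((hasDerivAt_id (0 : ℝ)).smul_const w).const_add q.2.2
  have hpos := one_sub_sq_div_pos (norm_nonneg q.2.2) hq.2
  have hc : 0 < c := (norm_nonneg _).trans_lt hq.2
  have hs := Real.sqrt_pos.2 hpos
  have hn : HasDerivAt (fun s : ℝ => c ^ 2 - c ^ 2 *
      Real.sqrt (1 - ‖q.2.2 + s • w‖ ^ 2 / c ^ 2)) (inner ℝ (mom c q.2.2) w) 0 := by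
    have h2 := ((((hv.norm_sq).div_const (c ^ 2)).const_sub 1).sqrt
      (by simpa using hpos.ne')).const_mul (c ^ 2) |>.const_sub (c ^ 2)
    refine HasDerivAt.congr_deriv h2 ?_
    simp only [zero_smul, add_zero, mom, real_inner_smul_left]
    field_simp
  have h3 := (hn.sub hV1).add (hv.inner ℝ hA1)
  have h4 := h1.unique (h3.congr_of_eventuallyEq (Eventually.of_forall fun s => by
    rfl))
  have e1 : inner ℝ w (A q.1 q.2.1) = inner ℝ (A q.1 q.2.1) w := real_inner_comm _ _
  simp only [h4, inner_force, inner_add_left, comp_apply, zero_smul, add_zero, e1]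
  ring

end FieldData

end LW

namespace LW

section PiecewiseIntegral

variable {J : Type*} [Finite J]

variable {W F : Type*} [NormedAddCommGroup W] [NormedAddCommGroup F]

theorem eventually_forall_norm_le {a b : ℝ} {U : J → Set (ℝ × W)} (hU : ∀ j, IsOpen (U j))
    {f : J → ℝ × W → F} (hf : ∀ j, ContinuousOn (f j) (U j)) {x₀ : W}
    (hx₀ : ∀ t ∈ Icc a b, ∀ j, (t, x₀) ∈ U j) :
    ∃ B : ℝ, ∀ᶠ x in 𝓝 x₀, ∀ t ∈ Icc a b, ∀ j, (t, x) ∈ U j ∧ ‖f j (t, x)‖ ≤ B := by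
  have hc : ∀ j, ContinuousOn (fun t => f j (t, x₀)) (Icc a b) := fun j =>
    (hf j).comp (by fun_prop) fun t ht => hx₀ t ht j
  have h1 : ∀ j, ∃ B, ∀ t ∈ Icc a b, ‖f j (t, x₀)‖ ≤ B := fun j =>
    isCompact_Icc.exists_bound_of_continuousOn (hc j)
  choose B hB using h1
  obtain ⟨M, hM⟩ := (Set.finite_range B).bddAbove
  refine ⟨M + 1, isCompact_Icc.eventually_forall_of_forall_eventually fun t ht => ?_⟩
  refine eventually_all.2 fun j => ?_
  have hm : (t, x₀) ∈ U j := hx₀ t ht j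
  have hcont : ContinuousAt (f j) (t, x₀) := (hf j).continuousAt ((hU j).mem_nhds hm)
  have hlt : ‖f j (t, x₀)‖ < M + 1 :=
    ((hB j t ht).trans (hM (mem_range_self j))).trans_lt (lt_add_one M)
  have h3 : ∀ᶠ p in 𝓝 (t, x₀), p ∈ U j ∧ ‖f j p‖ ≤ M + 1 := by
    filter_upwards [(hU j).mem_nhds hm, hcont.norm.eventually_lt continuousAt_const hlt]
      with p h1 h2 using ⟨h1, h2.le⟩
  exact (continuous_swap.tendsto' (x₀, t) (t, x₀) rfl).eventually h3

theorem isOpen_forall_mem {a b : ℝ} {U : J → Set (ℝ × W)} (hU : ∀ j, IsOpen (U j)) :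
    IsOpen {x : W | ∀ t ∈ Icc a b, ∀ j, (t, x) ∈ U j} := by
  rw [isOpen_iff_mem_nhds]
  intro x hx
  obtain ⟨B, hB⟩ := eventually_forall_norm_le hU (f := fun _ _ => (0:ℝ))
    (fun j => continuousOn_const) hx
  filter_upwards [hB] with y hy t ht j using (hy t ht j).1

variable [MeasurableSpace J] [MeasurableSingletonClass J]

theorem aestronglyMeasurable_piecewise {σ : ℝ → J} (hσ : Measurable σ) {a b : ℝ} (hab : a ≤ b) {f : J → ℝ → F}
    (hf : ∀ j, ContinuousOn (f j) (Icc a b)) :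
    AEStronglyMeasurable (fun t => f (σ t) t) (volume.restrict (uIoc a b)) := by
  classical
  have := Fintype.ofFinite J
  have h : (fun t => f (σ t) t) = ∑ j, (σ ⁻¹' {j}).indicator (f j) := by
    ext t
    rw [Finset.sum_apply, Finset.sum_eq_single (σ t)]
    · simp
    · intro j _ hj
      exact indicator_of_notMem (fun h => hj h.symm) _
    · simp
  rw [h]
  refine Finset.aestronglyMeasurable_sum _ fun j _ =>
    AEStronglyMeasurable.indicator ?_ (hσ (measurableSet_singleton j))
  rw [uIoc_of_le hab]
  exact ((hf j).mono Ioc_subset_Icc_self).aestronglyMeasurable measurableSet_Ioc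

theorem continuousOn_integral_piecewise [NormedSpace ℝ F] {a b : ℝ} (hab : a ≤ b)
    {σ : ℝ → J} (hσ : Measurable σ) {U : J → Set (ℝ × W)} (hU : ∀ j, IsOpen (U j))
    {f : J → ℝ × W → F} (hf : ∀ j, ContinuousOn (f j) (U j)) :
    ContinuousOn (fun x => ∫ t in a..b, f (σ t) (t, x))
      {x : W | ∀ t ∈ Icc a b, ∀ j, (t, x) ∈ U j} := by
  intro x hx
  apply ContinuousAt.continuousWithinAt
  obtain ⟨B, hB⟩ := eventually_forall_norm_le hU hf hx
  refine intervalIntegral.continuousAt_of_dominated_interval (bound := fun _ => B) ?_ ?_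
    intervalIntegrable_const ?_
  · filter_upwards [hB] with y hy
    exact aestronglyMeasurable_piecewise hσ hab (f := fun j t => f j (t, y)) fun j =>
      (hf j).comp (by fun_prop) fun t ht => (hy t ht j).1
  · filter_upwards [hB] with y hy
    refine Eventually.of_forall fun t ht => (hy t ?_ _).2
    rw [uIoc_of_le hab] at ht
    exact Ioc_subset_Icc_self ht
  · refine Eventually.of_forall fun t ht => ?_
    rw [uIoc_of_le hab] at ht
    have hm := hx t (Ioc_subset_Icc_self ht) (σ t)
    exact ((hf _).continuousAt ((hU _).mem_nhds hm)).comp (f := fun x => (t, x))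
      (by fun_prop)

theorem intervalIntegrable_piecewise {a b : ℝ} (hab : a ≤ b)
    {σ : ℝ → J} (hσ : Measurable σ) {f : J → ℝ → F} (hf : ∀ j, ContinuousOn (f j) (Icc a b)) :
    IntervalIntegrable (fun t => f (σ t) t) volume a b := by
  have h1 : ∀ j, ∃ B, ∀ t ∈ Icc a b, ‖f j t‖ ≤ B := fun j =>
    isCompact_Icc.exists_bound_of_continuousOn (hf j)
  choose B hB using h1
  obtain ⟨M, hM⟩ := (Set.finite_range B).bddAbove
  refine (intervalIntegrable_const (c := M)).mono_fun'
    (aestronglyMeasurable_piecewise hσ hab hf) ?_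
  refine (ae_restrict_iff' measurableSet_uIoc).2 (Eventually.of_forall fun t ht => ?_)
  rw [uIoc_of_le hab] at ht
  exact (hB _ t (Ioc_subset_Icc_self ht)).trans (hM (mem_range_self _))

theorem hasFDerivAt_integral_piecewise [NormedSpace ℝ W] {a b : ℝ} (hab : a ≤ b)
    {σ : ℝ → J} (hσ : Measurable σ) {U : J → Set (ℝ × W)} (hU : ∀ j, IsOpen (U j))
    {f : J → ℝ × W → ℝ} {f' : J → ℝ × W → W →L[ℝ] ℝ} (hf : ∀ j, ContinuousOn (f j) (U j))
    (hf' : ∀ j, ContinuousOn (f' j) (U j))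
    (hd : ∀ j, ∀ p ∈ U j, HasFDerivAt (fun x => f j (p.1, x)) (f' j p) p.2)
    {x : W} (hx : ∀ t ∈ Icc a b, ∀ j, (t, x) ∈ U j) :
    HasFDerivAt (fun x => ∫ t in a..b, f (σ t) (t, x)) (∫ t in a..b, f' (σ t) (t, x)) x := by
  obtain ⟨B, hB⟩ := eventually_forall_norm_le hU hf' hx
  refine (intervalIntegral.hasFDerivAt_integral_of_dominated_of_fderiv_le
    (s := {y | ∀ t ∈ Icc a b, ∀ j, (t, y) ∈ U j ∧ ‖f' j (t, y)‖ ≤ B})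
    (F := fun x t => f (σ t) (t, x)) (F' := fun x t => f' (σ t) (t, x))
    (bound := fun _ => B) hB ?_ ?_ ?_ ?_ intervalIntegrable_const ?_)
  · filter_upwards [hB] with y hy
    exact aestronglyMeasurable_piecewise hσ hab (f := fun j t => f j (t, y)) fun j =>
      (hf j).comp (by fun_prop) fun t ht => (hy t ht j).1
  · exact intervalIntegrable_piecewise hab hσ (f := fun j t => f j (t, x)) fun j =>
      (hf j).comp (by fun_prop) fun t ht => hx t ht j
  · exact aestronglyMeasurable_piecewise hσ hab (f := fun j t => f' j (t, x)) fun j =>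
      (hf' j).comp (by fun_prop) fun t ht => hx t ht j
  · refine Eventually.of_forall fun t ht y hy => (hy t ?_ _).2
    rw [uIoc_of_le hab] at ht
    exact Ioc_subset_Icc_self ht
  · refine Eventually.of_forall fun t ht y hy => ?_
    rw [uIoc_of_le hab] at ht
    exact hd _ (t, y) (hy t (Ioc_subset_Icc_self ht) _).1

end PiecewiseIntegral

end LW

namespace LW

/-- Piecewise linear paths: a base point and the velocities on `m` time intervals. -/
abbrev PLSpace (m : ℕ) : Type := PiLp 2 (fun _ : Option (Fin m) => E3)

section PL

variable (T : ℝ) (m : ℕ)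

/-- The time spent up to time `t` in the `j`-th interval. -/
def ramp (j : Fin m) (t : ℝ) : ℝ :=
  max (min t ((j + 1) * (T / m))) (j * (T / m)) - j * (T / m)

/-- The position at time `t` of a piecewise linear path. -/
def posL (t : ℝ) : PLSpace m →L[ℝ] E3 :=
  PiLp.proj 2 (fun _ : Option (Fin m) => E3) none
    + ∑ j, ramp T m j t • PiLp.proj 2 (fun _ : Option (Fin m) => E3) (some j)

/-- The velocity in the `j`-th time interval of a piecewise linear path. -/
def velL (j : Fin m) : PLSpace m →L[ℝ] E3 := PiLp.proj 2 (fun _ : Option (Fin m) => E3) (some j)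

/-- The index of the time interval containing `t`. -/
def cell [NeZero m] (t : ℝ) : Fin m :=
  ⟨min (⌈t / (T / m)⌉₊ - 1) (m - 1), by have := NeZero.pos m; omega⟩

variable {T m}

theorem posL_apply (t : ℝ) (x : PLSpace m) :
    posL T m t x = x none + ∑ j, ramp T m j t • x (some j) := by
  simp [posL]

theorem velL_apply (j : Fin m) (x : PLSpace m) : velL m j x = x (some j) := rfl

theorem continuous_posL : Continuous (posL T m) := by
  unfold posL ramp
  fun_prop

theorem continuous_posL_apply : Continuous fun p : ℝ × PLSpace m => posL T m p.1 p.2 :=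
  (continuous_posL.comp continuous_fst).clm_apply continuous_snd

theorem measurable_cell [NeZero m] : Measurable (cell T m) := by
  have : cell T m = (fun k : ℕ => (⟨min (k - 1) (m - 1), by
      have := NeZero.pos m; omega⟩ : Fin m)) ∘ fun t : ℝ => ⌈t / (T / m)⌉₊ := rfl
  rw [this]
  exact measurable_from_top.comp (Nat.measurable_ceil.comp (measurable_id.div_const _))

variable [NeZero m]

theorem step_pos (hT : 0 < T) : 0 < T / m := div_pos hT (Nat.cast_pos.2 (NeZero.pos m))

theorem step_mul : (m : ℝ) * (T / m) = T :=
  mul_div_cancel₀ _ (Nat.cast_ne_zero.2 (NeZero.ne m))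

theorem cell_eq_iff (hT : 0 < T) {t : ℝ} (h0 : 0 < t) (h1 : t ≤ T) (j : Fin m) :
    cell T m t = j ↔ t ∈ Ioc (j * (T / m)) ((j + 1) * (T / m)) := by
  have hh := step_pos (m := m) hT
  have hm : (m : ℝ) * (T / m) = T := step_mul
  have hc : ⌈t / (T / m)⌉₊ ≤ m := by
    rw [Nat.ceil_le, div_le_iff₀ hh, hm]; exact h1
  have hc0 : 0 < ⌈t / (T / m)⌉₊ := Nat.ceil_pos.2 (div_pos h0 hh)
  have h2 : cell T m t = j ↔ ⌈t / (T / m)⌉₊ = j + 1 := by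
    rw [Fin.ext_iff, cell]
    have := j.2
    simp only
    omega
  rw [h2, Nat.ceil_eq_iff (by omega), mem_Ioc, lt_div_iff₀ hh, div_le_iff₀ hh]
  simp

theorem mul_step_le (hT : 0 < T) (j : Fin m) : (j + 1 : ℝ) * (T / m) ≤ T := by
  have hh := step_pos (m := m) hT
  have hm : (m : ℝ) * (T / m) = T := step_mul
  have : ((j : ℕ) + 1 : ℝ) ≤ m := by exact_mod_cast j.2
  nlinarith

theorem integral_cell (hT : 0 < T) {F : Type*} [NormedAddCommGroup F] [NormedSpace ℝ F]
    {f : Fin m → ℝ → F} (hf : ∀ j, ContinuousOn (f j) (Icc 0 T)) {t : ℝ} (ht : t ∈ Icc 0 T) :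
    ∫ s in (0:ℝ)..t, f (cell T m s) s
      = ∑ j : Fin m, ∫ s in Ioc (j * (T / m)) (min t ((j + 1) * (T / m))), f j s := by
  have hh := step_pos (m := m) hT
  have e : ∀ j : Fin m, Ioc 0 t ∩ Ioc (j * (T / m)) ((j + 1) * (T / m))
      = Ioc (j * (T / m)) (min t ((j + 1) * (T / m))) := fun j => by
    rw [Ioc_inter_Ioc]
    congr 1
    exact sup_eq_right.2 (by positivity)
  calc ∫ s in (0:ℝ)..t, f (cell T m s) s
      = ∫ s in Ioc 0 t, ∑ j : Fin m,
        (Ioc (j * (T / m)) ((j + 1) * (T / m))).indicator (f j) s := by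
        rw [intervalIntegral.integral_of_le ht.1]
        refine setIntegral_congr_fun measurableSet_Ioc fun s hs => ?_
        have hs1 := hs.2.trans ht.2
        rw [Finset.sum_eq_single (cell T m s)]
        · rw [indicator_of_mem ((cell_eq_iff hT hs.1 hs1 _).1 rfl)]
        · intro j _ hj
          exact indicator_of_notMem (fun h => hj ((cell_eq_iff hT hs.1 hs1 j).2 h).symm) _
        · simp
    _ = ∑ j : Fin m, ∫ s in Ioc 0 t,
        (Ioc (j * (T / m)) ((j + 1) * (T / m))).indicator (f j) s := by
        refine integral_finsetSum _ fun j _ => IntegrableOn.indicator ?_ measurableSet_Ioc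
        exact ((hf j).integrableOn_Icc).mono_set
          (Ioc_subset_Icc_self.trans (Icc_subset_Icc_right ht.2))
    _ = _ := by
        refine Finset.sum_congr rfl fun j _ => ?_
        rw [setIntegral_indicator measurableSet_Ioc, e]

theorem integral_cell_period (hT : 0 < T) {F : Type*} [NormedAddCommGroup F] [NormedSpace ℝ F]
    {f : Fin m → ℝ → F} (hf : ∀ j, ContinuousOn (f j) (Icc 0 T)) :
    ∫ s in (0:ℝ)..T, f (cell T m s) s
      = ∑ j : Fin m, ∫ s in (j * (T / m))..((j + 1) * (T / m)), f j s := by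
  rw [integral_cell hT hf ⟨hT.le, le_rfl⟩]
  refine Finset.sum_congr rfl fun j _ => ?_
  have hh := step_pos (m := m) hT
  rw [min_eq_right (mul_step_le hT j), intervalIntegral.integral_of_le (by nlinarith)]

theorem posL_eq_integral (hT : 0 < T) (x : PLSpace m) {t : ℝ} (ht : t ∈ Icc 0 T) :
    posL T m t x = x none + ∫ s in (0:ℝ)..t, x (some (cell T m s)) := by
  rw [posL_apply, integral_cell hT (f := fun j _ => x (some j)) (fun j => continuousOn_const) ht]
  congr 1
  refine Finset.sum_congr rfl fun j _ => ?_
  rw [setIntegral_const, Real.volume_real_Ioc, ramp]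
  congr 1
  rw [← max_sub_sub_right, sub_self]

theorem posL_zero (hT : 0 < T) (x : PLSpace m) : posL T m 0 x = x none := by
  rw [posL_eq_integral hT x ⟨le_rfl, hT.le⟩]; simp

theorem posL_period (hT : 0 < T) (x : PLSpace m) :
    posL T m T x = x none + (T / m) • ∑ j, x (some j) := by
  have hh := step_pos (m := m) hT
  rw [posL_apply, Finset.smul_sum]
  congr 1
  refine Finset.sum_congr rfl fun j _ => ?_
  congr 1
  rw [ramp, min_eq_right (mul_step_le hT j), max_eq_left (by nlinarith)]
  ring

theorem norm_posL_sub_le (hT : 0 < T) {x : PLSpace m} {B : ℝ} (hx : ∀ j, ‖x (some j)‖ ≤ B)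
    {s t : ℝ} (hs : s ∈ Icc 0 T) (ht : t ∈ Icc 0 T) :
    ‖posL T m t x - posL T m s x‖ ≤ B * |t - s| := by
  have hi : ∀ u ∈ Icc 0 T, IntervalIntegrable (fun u => x (some (cell T m u))) volume 0 u :=
    fun u hu => intervalIntegrable_piecewise hu.1 measurable_cell
      (f := fun j _ => x (some j)) fun j => continuousOn_const
  rw [posL_eq_integral hT x ht, posL_eq_integral hT x hs, add_sub_add_left_eq_sub,
    intervalIntegral.integral_interval_sub_left (hi t ht) (hi s hs)]
  exact intervalIntegral.norm_integral_le_of_norm_le_const fun u _ => hx _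

end PL

end LW

namespace LW

/-- The state at time `p.1` of the path `p.2`, if the velocity is that of the interval `j`. -/
def stateL (T : ℝ) (m : ℕ) (j : Fin m) (p : ℝ × PLSpace m) : ℝ × E3 × E3 :=
  (p.1, posL T m p.1 p.2, velL m j p.2)

/-- The differential of the Lagrangian along a piecewise linear path. -/
def lagDeriv (T c : ℝ) (m : ℕ) (V : ℝ → E3 → ℝ) (A : ℝ → E3 → E3) (j : Fin m)
    (p : ℝ × PLSpace m) : PLSpace m →L[ℝ] ℝ :=
  (innerSL ℝ (force V A (stateL T m j p))).comp (posL T m p.1)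
    + (innerSL ℝ (mom c (velL m j p.2) + A p.1 (posL T m p.1 p.2))).comp (velL m j)

/-- The action of a piecewise linear path. -/
def action (T c : ℝ) (m : ℕ) [NeZero m] (V : ℝ → E3 → ℝ) (A : ℝ → E3 → E3) (x : PLSpace m) : ℝ :=
  ∫ t in (0:ℝ)..T, lag c V A (stateL T m (cell T m t) (t, x))

/-- The gradient of the action of piecewise linear paths. -/
def actionGrad (T c : ℝ) (m : ℕ) [NeZero m] (V : ℝ → E3 → ℝ) (A : ℝ → E3 → E3)
    (x : PLSpace m) : PLSpace m :=
  (InnerProductSpace.toDual ℝ (PLSpace m)).symm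
    (∫ t in (0:ℝ)..T, lagDeriv T c m V A (cell T m t) (t, x))

/-- The piecewise linear paths of admissible states. -/
def Paths (T c : ℝ) (m : ℕ) {N : ℕ} (r : Fin N → ℝ → E3) : Set (PLSpace m) :=
  {x | ∀ t ∈ Icc 0 T, ∀ j, (t, x) ∈ stateL T m j ⁻¹' States c r}

theorem continuous_stateL {T : ℝ} {m : ℕ} (j : Fin m) : Continuous (stateL T m j) :=
  continuous_fst.prodMk (continuous_posL_apply.prodMk ((velL m j).continuous.comp continuous_snd))

namespace FieldData

variable {T c κ K b d : ℝ} {N : ℕ} {r : Fin N → ℝ → E3} {V : ℝ → E3 → ℝ} {A : ℝ → E3 → E3}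
  {m : ℕ}

theorem isOpen_preimage_stateL (F : FieldData T c κ K b d r V A) (j : Fin m) :
    IsOpen (stateL T m j ⁻¹' States c r) :=
  F.isOpen_States.preimage (continuous_stateL j)

theorem isOpen_Paths (F : FieldData T c κ K b d r V A) : IsOpen (Paths T c m r) :=
  isOpen_forall_mem F.isOpen_preimage_stateL

theorem continuousOn_lagDeriv (F : FieldData T c κ K b d r V A) (j : Fin m) :
    ContinuousOn (lagDeriv T c m V A j) (stateL T m j ⁻¹' States c r) := by
  have h1 : ContinuousOn (fun p => force V A (stateL T m j p)) (stateL T m j ⁻¹' States c r) :=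
    F.continuousOn_force.comp (continuous_stateL j).continuousOn fun p hp => hp.1
  have h2 : ContinuousOn (fun p : ℝ × PLSpace m => mom c (velL m j p.2))
      (stateL T m j ⁻¹' States c r) :=
    continuousOn_mom.comp (by fun_prop) fun p hp => hp.2
  have h3 : ContinuousOn (fun p : ℝ × PLSpace m => A p.1 (posL T m p.1 p.2))
      (stateL T m j ⁻¹' States c r) :=
    F.continuousOn_A.comp (f := fun p : ℝ × PLSpace m => (p.1, posL T m p.1 p.2))
      (continuous_fst.prodMk continuous_posL_apply).continuousOn fun p hp => hp.1
  unfold lagDeriv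
  refine ContinuousOn.add ?_ ?_
  · exact ((innerSL ℝ).continuous.comp_continuousOn h1).clm_comp
      (continuous_posL.comp continuous_fst).continuousOn
  · exact ((innerSL ℝ).continuous.comp_continuousOn (h2.add h3)).clm_comp continuousOn_const

theorem continuousOn_lag (F : FieldData T c κ K b d r V A) :
    ContinuousOn (lag c V A) (States c r) :=
  fun _ hq => (F.contDiffAt_lag hq).continuousAt.continuousWithinAt

theorem hasFDerivAt_lag_stateL (F : FieldData T c κ K b d r V A) (j : Fin m)
    {p : ℝ × PLSpace m} (hp : p ∈ stateL T m j ⁻¹' States c r) :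
    HasFDerivAt (fun x => lag c V A (stateL T m j (p.1, x))) (lagDeriv T c m V A j p) p.2 := by
  have h1 := ((F.contDiffAt_lag (q := stateL T m j p) hp).differentiableAt
    one_ne_zero).hasFDerivAt
  have h2 : HasFDerivAt (fun x => stateL T m j (p.1, x))
      ((0 : PLSpace m →L[ℝ] ℝ).prod ((posL T m p.1).prod (velL m j))) p.2 :=
    (hasFDerivAt_const p.1 p.2).prodMk
      ((posL T m p.1).hasFDerivAt.prodMk (velL m j).hasFDerivAt)
  refine (HasFDerivAt.comp p.2 h1 h2).congr_fderiv ?_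
  ext z
  exact F.fderiv_lag hp _ _

theorem hasFDerivAt_action [NeZero m] (F : FieldData T c κ K b d r V A) {x : PLSpace m}
    (hx : x ∈ Paths T c m r) :
    HasFDerivAt (action T c m V A) (innerSL ℝ (actionGrad T c m V A x)) x := by
  have h := hasFDerivAt_integral_piecewise F.T_pos.le (measurable_cell (T := T) (m := m))
    F.isOpen_preimage_stateL (f := fun j p => lag c V A (stateL T m j p))
    (f' := lagDeriv T c m V A)
    (fun j => F.continuousOn_lag.comp (continuous_stateL j).continuousOn fun p hp => hp)
    F.continuousOn_lagDeriv (fun j p hp => F.hasFDerivAt_lag_stateL j hp) hx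
  refine h.congr_fderiv ?_
  ext z
  exact (InnerProductSpace.toDual_symm_apply ..).symm

theorem continuousOn_actionGrad [NeZero m] (F : FieldData T c κ K b d r V A) :
    ContinuousOn (actionGrad T c m V A) (Paths T c m r) :=
  (LinearIsometryEquiv.continuous _).comp_continuousOn
    (continuousOn_integral_piecewise F.T_pos.le measurable_cell F.isOpen_preimage_stateL
      F.continuousOn_lagDeriv)

theorem inner_actionGrad [NeZero m] (F : FieldData T c κ K b d r V A) {x : PLSpace m}
    (hx : x ∈ Paths T c m r) (z : PLSpace m) :
    inner ℝ (actionGrad T c m V A x) z = ∫ t in (0:ℝ)..T,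
      (inner ℝ (force V A (stateL T m (cell T m t) (t, x))) (posL T m t z)
      + inner ℝ (mom c (x (some (cell T m t))) + A t (posL T m t x)) (z (some (cell T m t)))) := by
  rw [actionGrad, InnerProductSpace.toDual_symm_apply, ContinuousLinearMap.intervalIntegral_apply]
  · rfl
  · exact intervalIntegrable_piecewise F.T_pos.le measurable_cell
      (f := fun j t => lagDeriv T c m V A j (t, x)) fun j =>
        (F.continuousOn_lagDeriv j).comp (by fun_prop) fun t ht => hx t ht j

end FieldData

end LW

namespace LW

/-- The closed piecewise linear paths with speed at most `c₁`. -/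
def ClosedPaths (c₁ : ℝ) (m : ℕ) : Set (PLSpace m) :=
  {x | ∑ j, x (some j) = 0 ∧ ∀ j, ‖x (some j)‖ ≤ c₁}

theorem isClosed_ClosedPaths {c₁ : ℝ} {m : ℕ} : IsClosed (ClosedPaths c₁ m) := by
  have h : ClosedPaths c₁ m = {x | ∑ j, velL m j x = 0} ∩ ⋂ j, {x | ‖velL m j x‖ ≤ c₁} := by
    ext x; simp [ClosedPaths, velL_apply]
  rw [h]
  refine (isClosed_eq (by fun_prop) continuous_const).inter (isClosed_iInter fun j => ?_)
  exact isClosed_le (by fun_prop) continuous_const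

theorem convex_ClosedPaths {c₁ : ℝ} {m : ℕ} : Convex ℝ (ClosedPaths c₁ m) := by
  intro x hx y hy a b ha hb hab
  refine ⟨?_, fun j => ?_⟩
  · simp [Finset.sum_add_distrib, ← Finset.smul_sum, hx.1, hy.1]
  · calc ‖a • x (some j) + b • y (some j)‖ ≤ a * ‖x (some j)‖ + b * ‖y (some j)‖ := by
          refine (norm_add_le _ _).trans_eq ?_
          rw [norm_smul, norm_smul, Real.norm_of_nonneg ha, Real.norm_of_nonneg hb]
      _ ≤ a * c₁ + b * c₁ := by
          have := hx.2 j; have := hy.2 j; gcongr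
      _ = c₁ := by rw [← add_mul, hab, one_mul]

/-- A lower bound for the integral of a function that blows up like the inverse distance. -/
theorem le_integral_of_inv_dist_le {T c κ δ t₀ : ℝ} (hc : 0 < c) (hκ : 0 < κ)
    (hδ : 0 < δ) (ht₀ : t₀ ∈ Icc 0 T) {f : ℝ → ℝ} (hf : IntervalIntegrable f volume 0 T)
    (hle : ∀ t ∈ Icc 0 T, κ / (δ + 2 * c * |t - t₀|) ≤ f t) :
    κ / (2 * c) * Real.log (1 + c * T / δ) ≤ ∫ t in (0:ℝ)..T, f t := by
  have hT : 0 ≤ T := ht₀.1.trans ht₀.2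
  have hpos : ∀ s : ℝ, 0 < δ + 2 * c * |s| := fun s => by positivity
  have h_int : ∫ s in (0:ℝ)..(T / 2), κ / (δ + 2 * c * |s|)
      = κ / (2 * c) * Real.log (1 + c * T / δ) := by
    have h1 : ∀ s ∈ uIcc 0 (T / 2), HasDerivAt (fun s => κ / (2 * c) * Real.log (δ + 2 * c * s))
        (κ / (δ + 2 * c * |s|)) s := by
      intro s hs
      rw [uIcc_of_le (by positivity)] at hs
      have hs0 := hs.1
      have hp : δ + 2 * c * s ≠ 0 := by positivity
      have := ((((hasDerivAt_id s).const_mul (2 * c)).const_add δ).log hp).const_mul (κ / (2 * c))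
      refine this.congr_deriv ?_
      rw [abs_of_nonneg hs0]
      simp only [id]
      field_simp
    rw [intervalIntegral.integral_eq_sub_of_hasDerivAt h1]
    · rw [← mul_sub, mul_zero, add_zero, ← Real.log_div (by positivity) hδ.ne']
      congr 2
      field_simp
    · exact (Continuous.intervalIntegrable (continuous_const.div (by fun_prop)
        fun s => (hpos s).ne') _ _)
  have hg : Continuous fun t => κ / (δ + 2 * c * |t - t₀|) :=
    continuous_const.div (by fun_prop) fun s => (hpos _).ne'
  have hmono : ∫ t in (0:ℝ)..T, κ / (δ + 2 * c * |t - t₀|) ≤ ∫ t in (0:ℝ)..T, f t :=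
    intervalIntegral.integral_mono_on hT (hg.intervalIntegrable _ _) hf hle
  refine le_trans ?_ hmono
  rw [← h_int]
  have hsub : ∀ α β : ℝ, 0 ≤ α → α ≤ β → β ≤ T → ∫ t in α..β, κ / (δ + 2 * c * |t - t₀|)
      ≤ ∫ t in (0:ℝ)..T, κ / (δ + 2 * c * |t - t₀|) := fun α β h1 h2 h3 =>
    intervalIntegral.integral_mono_interval h1 h2 h3
      (Eventually.of_forall fun t => (div_pos hκ (hpos _)).le) (hg.intervalIntegrable _ _)
  rcases le_total t₀ (T / 2) with h | h
  · refine le_trans (le_of_eq ?_) (hsub t₀ (t₀ + T / 2) ht₀.1 (by linarith) (by linarith))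
    rw [intervalIntegral.integral_comp_sub_right (fun s => κ / (δ + 2 * c * |s|)) t₀]
    simp
  · refine le_trans (le_of_eq ?_) (hsub (t₀ - T / 2) t₀ (by linarith) (by linarith) ht₀.2)
    simp only [abs_sub_comm _ t₀]
    rw [intervalIntegral.integral_comp_sub_left (fun s => κ / (δ + 2 * c * |s|)) t₀]
    simp

theorem kinetic_bounds {c : ℝ} {v : E3} :
    0 ≤ c ^ 2 - c ^ 2 * Real.sqrt (1 - ‖v‖ ^ 2 / c ^ 2) ∧
      c ^ 2 - c ^ 2 * Real.sqrt (1 - ‖v‖ ^ 2 / c ^ 2) ≤ c ^ 2 := by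
  have h1 : Real.sqrt (1 - ‖v‖ ^ 2 / c ^ 2) ≤ 1 := by
    rw [Real.sqrt_le_left zero_le_one]
    have : 0 ≤ ‖v‖ ^ 2 / c ^ 2 := by positivity
    linarith
  have h2 := Real.sqrt_nonneg (1 - ‖v‖ ^ 2 / c ^ 2)
  constructor <;> nlinarith [sq_nonneg c]

namespace FieldData

variable {T c κ K b d : ℝ} {N : ℕ} {r : Fin N → ℝ → E3} {V : ℝ → E3 → ℝ} {A : ℝ → E3 → E3}
  {m : ℕ}

theorem le_lag (F : FieldData T c κ K b d r V A) {q : ℝ × E3 × E3} (hq : q ∈ States c r)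
    (i : Fin N) : κ / ‖q.2.1 - r i q.1‖ ≤ lag c V A q := by
  have := F.lower _ hq.1 q.2.2 hq.2.le i
  have := (kinetic_bounds (c := c) (v := q.2.2)).1
  unfold lag
  linarith

theorem lag_le (F : FieldData T c κ K b d r V A) {q : ℝ × E3 × E3} (hq : ‖q.2.2‖ ≤ c)
    {δ : ℝ} (hδ : 0 < δ) (hdist : ∀ i, δ ≤ ‖q.2.1 - r i q.1‖) :
    lag c V A q ≤ c ^ 2 + K / δ := by
  have := F.upper (q.1, q.2.1) δ hδ hdist q.2.2 hq
  have := (kinetic_bounds (c := c) (v := q.2.2)).2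
  unfold lag
  linarith

theorem mem_Paths_of_dist {x : PLSpace m}
    (hx : ∀ j, ‖x (some j)‖ < c) {δ : ℝ} (hδ : 0 < δ)
    (hdist : ∀ t ∈ Icc 0 T, ∀ i, δ ≤ ‖posL T m t x - r i t‖) : x ∈ Paths T c m r :=
  fun t ht j => ⟨fun i => sub_ne_zero.1 (norm_pos_iff.1 (hδ.trans_le (hdist t ht i))), hx j⟩

variable [NeZero m]

theorem continuousOn_action (F : FieldData T c κ K b d r V A) :
    ContinuousOn (action T c m V A) (Paths T c m r) :=
  continuousOn_integral_piecewise F.T_pos.le measurable_cell F.isOpen_preimage_stateL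
    (f := fun j p => lag c V A (stateL T m j p))
    fun j => F.continuousOn_lag.comp (continuous_stateL j).continuousOn fun _ hp => hp

theorem intervalIntegrable_lag (F : FieldData T c κ K b d r V A) {x : PLSpace m}
    (hx : x ∈ Paths T c m r) :
    IntervalIntegrable (fun t => lag c V A (stateL T m (cell T m t) (t, x))) volume 0 T :=
  intervalIntegrable_piecewise F.T_pos.le measurable_cell
    (f := fun j t => lag c V A (stateL T m j (t, x))) fun j =>
      F.continuousOn_lag.comp ((continuous_stateL j).comp (by fun_prop)).continuousOn
        fun t ht => hx t ht j

/-- A bound on the action gives a bound on the distance to the charges. -/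
theorem le_dist_of_action_le (F : FieldData T c κ K b d r V A) {x : PLSpace m}
    (hx : x ∈ Paths T c m r) {a : ℝ} (ha : action T c m V A x ≤ a) (i : Fin N) {t : ℝ}
    (ht : t ∈ Icc 0 T) : c * T * Real.exp (-(2 * c * a / κ)) ≤ ‖posL T m t x - r i t‖ := by
  by_contra! hlt
  have hc := F.c_pos
  have hT := F.T_pos
  have hκ := F.κ_pos
  set δ := c * T * Real.exp (-(2 * c * a / κ)) with hδ
  have hδ0 : 0 < δ := by positivity
  have hv : ∀ j, ‖x (some j)‖ ≤ c := fun j => (hx t ht j).2.le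
  have h := le_integral_of_inv_dist_le hc hκ hδ0 ht (F.intervalIntegrable_lag hx) fun s hs => by
    refine le_trans ?_ (F.le_lag (hx s hs _) i)
    change _ ≤ κ / ‖posL T m s x - r i s‖
    have hne : 0 < ‖posL T m s x - r i s‖ :=
      norm_pos_iff.2 (sub_ne_zero.2 ((hx s hs (cell T m s)).1 i))
    refine div_le_div_of_nonneg_left hκ.le hne ?_
    have h1 := norm_posL_sub_le hT hv ht hs
    have h2 := F.r_lip i t s
    have h3 : b * |t - s| ≤ c * |s - t| := by
      rw [abs_sub_comm]; exact mul_le_mul_of_nonneg_right F.b_lt.le (abs_nonneg _)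
    have h4 : posL T m s x - r i s = (posL T m t x - r i t) + (posL T m s x - posL T m t x)
      + (r i t - r i s) := by abel
    rw [h4]
    refine (norm_add₃_le).trans ?_
    linarith
  change _ ≤ action T c m V A x at h
  have h5 : 2 * c * a / κ < Real.log (1 + c * T / δ) := by
    rw [Real.lt_log_iff_exp_lt (by positivity)]
    have : c * T / δ = Real.exp (2 * c * a / κ) := by
      rw [hδ, Real.exp_neg]; field_simp
    linarith
  have h6 : a < κ / (2 * c) * Real.log (1 + c * T / δ) := by
    rw [div_lt_iff₀ hκ] at h5
    rw [div_mul_eq_mul_div, lt_div_iff₀ (by positivity)]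
    linarith
  linarith

theorem action_le_of_dist (F : FieldData T c κ K b d r V A) {x : PLSpace m}
    (hx : ∀ j, ‖x (some j)‖ < c) {δ : ℝ} (hδ : 0 < δ)
    (hdist : ∀ t ∈ Icc 0 T, ∀ i, δ ≤ ‖posL T m t x - r i t‖) :
    action T c m V A x ≤ (c ^ 2 + K / δ) * T := by
  have hT := F.T_pos.le
  have h := intervalIntegral.integral_mono_on hT
    (F.intervalIntegrable_lag (mem_Paths_of_dist hx hδ hdist))
    (intervalIntegrable_const (c := c ^ 2 + K / δ)) fun t ht =>
      F.lag_le (q := stateL T m (cell T m t) (t, x)) (hx _).le hδ (hdist t ht)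
  rw [intervalIntegral.integral_const, smul_eq_mul, sub_zero, mul_comm] at h
  exact h

/-- Large action forces the path to approach a charge. -/
theorem exists_dist_lt (F : FieldData T c κ K b d r V A) {x : PLSpace m}
    (hx : ∀ j, ‖x (some j)‖ < c) (ha : (c ^ 2 + K) * T < action T c m V A x) :
    ∃ t ∈ Icc 0 T, ∃ i, ‖posL T m t x - r i t‖ < 1 := by
  by_contra! h
  have := F.action_le_of_dist hx one_pos h
  rw [div_one] at this
  linarith

theorem exists_norm_r_le (F : FieldData T c κ K b d r V A) :
    ∃ R, 0 ≤ R ∧ ∀ t ∈ Icc 0 T, ∀ i, ‖r i t‖ ≤ R := by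
  have h1 : ∀ i, ∃ B, ∀ t ∈ Icc 0 T, ‖r i t‖ ≤ B := fun i =>
    isCompact_Icc.exists_bound_of_continuousOn (F.continuous_r i).continuousOn
  choose B hB using h1
  obtain ⟨M, hM⟩ := (Set.finite_range B).bddAbove
  exact ⟨max M 0, le_max_right _ _, fun t ht i =>
    (hB i t ht).trans ((hM (mem_range_self i)).trans (le_max_left _ _))⟩

theorem norm_posL_le (F : FieldData T c κ K b d r V A) {R : ℝ}
    (hR : ∀ t ∈ Icc 0 T, ∀ i, ‖r i t‖ ≤ R) {x : PLSpace m}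
    (hx : ∀ j, ‖x (some j)‖ < c) (ha : (c ^ 2 + K) * T < action T c m V A x) {t : ℝ}
    (ht : t ∈ Icc 0 T) : ‖posL T m t x‖ ≤ R + 1 + c * T := by
  obtain ⟨s, hs, i, hi⟩ := F.exists_dist_lt hx ha
  have h1 := norm_posL_sub_le F.T_pos (fun j => (hx j).le) hs ht
  have h2 : |t - s| ≤ T := abs_le.2 ⟨by linarith [hs.2, ht.1], by linarith [hs.1, ht.2]⟩
  have h3 : c * |t - s| ≤ c * T := mul_le_mul_of_nonneg_left h2 F.c_pos.le
  have h4 : posL T m t x = (posL T m t x - posL T m s x) + (posL T m s x - r i s) + r i s := by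
    abel
  rw [h4]
  refine (norm_add₃_le).trans ?_
  linarith [hR s hs i]

theorem isCompact_strip (F : FieldData T c κ K b d r V A) {c₁ a₀ a₁ : ℝ} (hc₁ : c₁ < c)
    (ha₀ : (c ^ 2 + K) * T < a₀) :
    IsCompact {x | x ∈ ClosedPaths c₁ m ∧ x ∈ Paths T c m r ∧ a₀ ≤ action T c m V A x ∧
      action T c m V A x ≤ a₁} := by
  have hT := F.T_pos
  obtain ⟨R, hR0, hR⟩ := F.exists_norm_r_le
  set δ := c * T * Real.exp (-(2 * c * a₁ / κ)) with hδ
  have hδ0 : 0 < δ := by have := F.c_pos; positivity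
  set E := ClosedPaths c₁ m ∩ ⋂ t ∈ Icc 0 T, ⋂ i, {x | δ ≤ ‖posL T m t x - r i t‖}
  have hE : IsClosed E := isClosed_ClosedPaths.inter <| isClosed_biInter fun t _ =>
    isClosed_iInter fun i => isClosed_le continuous_const (by fun_prop)
  have hEd : ∀ x ∈ E, ∀ t ∈ Icc 0 T, ∀ i, δ ≤ ‖posL T m t x - r i t‖ := fun x hx t ht i =>
    mem_iInter.1 (mem_iInter₂.1 hx.2 t ht) i
  have hEP : E ⊆ Paths T c m r := fun x hx =>
    mem_Paths_of_dist (fun j => (hx.1.2 j).trans_lt hc₁) hδ0 (hEd x hx)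
  have hcont : ContinuousOn (action T c m V A) E := F.continuousOn_action.mono hEP
  have heq : {x | x ∈ ClosedPaths c₁ m ∧ x ∈ Paths T c m r ∧ a₀ ≤ action T c m V A x ∧
      action T c m V A x ≤ a₁} = E ∩ action T c m V A ⁻¹' Icc a₀ a₁ := by
    ext x
    constructor
    · rintro ⟨h1, h2, h3⟩
      refine ⟨⟨h1, ?_⟩, h3⟩
      exact mem_iInter₂.2 fun t ht => mem_iInter.2 fun i => F.le_dist_of_action_le h2 h3.2 i ht
    · rintro ⟨h1, h2⟩
      exact ⟨h1.1, hEP h1, h2⟩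
  rw [heq]
  have hK : IsCompact ((WithLp.toLp 2 : (Option (Fin m) → E3) → PLSpace m) ''
      Set.pi univ fun _ => Metric.closedBall 0 (R + 1 + c * T + c)) :=
    (isCompact_univ_pi fun _ => isCompact_closedBall _ _).image (PiLp.continuous_toLp 2 _)
  refine hK.of_isClosed_subset (hcont.preimage_isClosed_of_isClosed hE isClosed_Icc) ?_
  rintro x ⟨h1, h2⟩
  have hv : ∀ j, ‖x (some j)‖ < c := fun j => (h1.1.2 j).trans_lt hc₁
  refine ⟨x.ofLp, fun o _ => mem_closedBall_zero_iff.2 ?_, rfl⟩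
  have hc := F.c_pos
  rcases o with _ | j
  · have := F.norm_posL_le hR hv (ha₀.trans_le h2.1) (t := 0) ⟨le_rfl, hT.le⟩
    rw [posL_zero hT] at this
    exact this.trans (by linarith)
  · have : 0 ≤ c * T := by positivity
    exact (hv j).le.trans (by linarith)

end FieldData

end LW

namespace LW

theorem integral_inner_const {f : ℝ → E3} {a b : ℝ} (hf : IntervalIntegrable f volume a b)
    (w : E3) : ∫ t in a..b, inner ℝ (f t) w = inner ℝ (∫ t in a..b, f t) w := by
  have := (innerSL ℝ w).intervalIntegral_comp_comm hf
  simp only [innerSL_apply_apply] at this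
  rw [real_inner_comm, ← this]
  simp only [real_inner_comm]

/-- The path with a single nonzero component. -/
def singlePath {m : ℕ} (o : Option (Fin m)) (w : E3) : PLSpace m := WithLp.toLp 2 (Pi.single o w)

theorem singlePath_apply {m : ℕ} (o o' : Option (Fin m)) (w : E3) :
    singlePath o w o' = if o' = o then w else 0 := by
  simp [singlePath]

theorem posL_singlePath_none {T : ℝ} {m : ℕ} (w : E3) (t : ℝ) :
    posL T m t (singlePath none w) = w := by
  simp [posL_apply, singlePath_apply]

theorem posL_singlePath_some {T : ℝ} {m : ℕ} (j : Fin m) (w : E3) (t : ℝ) :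
    posL T m t (singlePath (some j) w) = ramp T m j t • w := by
  simp [posL_apply, singlePath_apply]

theorem ramp_nonneg {T : ℝ} {m : ℕ} (j : Fin m) (t : ℝ) : 0 ≤ ramp T m j t :=
  sub_nonneg.2 (le_max_right _ _)

theorem ramp_le {T : ℝ} {m : ℕ} [NeZero m] (hT : 0 < T) (j : Fin m) (t : ℝ) :
    ramp T m j t ≤ T / m := by
  have hh := step_pos (m := m) hT
  have : max (min t ((j + 1) * (T / m))) (j * (T / m)) ≤ (j + 1) * (T / m) :=
    max_le (min_le_right _ _) (by nlinarith)
  rw [ramp]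
  linarith

theorem continuous_ramp {T : ℝ} {m : ℕ} (j : Fin m) : Continuous (ramp T m j) := by
  unfold ramp; fun_prop

/-- The derivative of the action of a path in the direction of the velocity of one interval. -/
def elVec (T c : ℝ) (m : ℕ) [NeZero m] (V : ℝ → E3 → ℝ) (A : ℝ → E3 → E3) (x : PLSpace m)
    (j : Fin m) : E3 :=
  (∫ t in (0:ℝ)..T, ramp T m j t • force V A (stateL T m (cell T m t) (t, x)))
    + ((T / m) • mom c (x (some j))
      + ∫ t in (j * (T / m))..((j + 1) * (T / m)), A t (posL T m t x))

theorem cell_subset {T : ℝ} {m : ℕ} [NeZero m] (hT : 0 < T) (j : Fin m) :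
    uIcc (j * (T / m)) ((j + 1) * (T / m)) ⊆ Icc 0 T := by
  have hh := step_pos (m := m) hT
  rw [uIcc_of_le (by nlinarith)]
  exact Icc_subset_Icc (by positivity) (mul_step_le hT j)

namespace FieldData

variable {T c κ K b d : ℝ} {N : ℕ} {r : Fin N → ℝ → E3} {V : ℝ → E3 → ℝ} {A : ℝ → E3 → E3}
  {m : ℕ}

theorem continuousOn_A_posL (F : FieldData T c κ K b d r V A) [NeZero m] {x : PLSpace m}
    (hx : x ∈ Paths T c m r) : ContinuousOn (fun t => A t (posL T m t x)) (Icc 0 T) :=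
  F.continuousOn_A.comp (f := fun t : ℝ => (t, posL T m t x))
    (continuous_id.prodMk (continuous_posL.clm_apply continuous_const)).continuousOn
    fun t ht => (hx t ht 0).1

theorem continuousOn_force_stateL (F : FieldData T c κ K b d r V A) {x : PLSpace m}
    (hx : x ∈ Paths T c m r) (j : Fin m) :
    ContinuousOn (fun t => force V A (stateL T m j (t, x))) (Icc 0 T) :=
  F.continuousOn_force.comp ((continuous_stateL j).comp (by fun_prop)).continuousOn
    fun t ht => (hx t ht j).1

variable [NeZero m]

theorem intervalIntegrable_force (F : FieldData T c κ K b d r V A) {x : PLSpace m}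
    (hx : x ∈ Paths T c m r) :
    IntervalIntegrable (fun t => force V A (stateL T m (cell T m t) (t, x))) volume 0 T :=
  intervalIntegrable_piecewise F.T_pos.le measurable_cell
    (f := fun j t => force V A (stateL T m j (t, x))) (F.continuousOn_force_stateL hx)

theorem intervalIntegrable_ramp_force (F : FieldData T c κ K b d r V A) {x : PLSpace m}
    (hx : x ∈ Paths T c m r) (j : Fin m) :
    IntervalIntegrable (fun t => ramp T m j t • force V A (stateL T m (cell T m t) (t, x)))
      volume 0 T :=
  intervalIntegrable_piecewise F.T_pos.le measurable_cell
    (f := fun k t => ramp T m j t • force V A (stateL T m k (t, x))) fun k =>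
      (continuous_ramp j).continuousOn.smul (F.continuousOn_force_stateL hx k)

theorem inner_actionGrad_some (F : FieldData T c κ K b d r V A) {x : PLSpace m}
    (hx : x ∈ Paths T c m r) (j : Fin m) (w : E3) :
    inner ℝ (actionGrad T c m V A x) (singlePath (some j) w) = inner ℝ (elVec T c m V A x j) w := by
  have hT := F.T_pos
  have hA := F.continuousOn_A_posL hx
  have hAj : IntervalIntegrable (fun t => A t (posL T m t x)) volume (j * (T / m))
      ((j + 1) * (T / m)) := (hA.mono (cell_subset hT j)).intervalIntegrable
  have hcont : ∀ k : Fin m, ContinuousOn (fun t => inner ℝ (mom c (x (some k))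
      + A t (posL T m t x)) (singlePath (some j) w (some k))) (Icc 0 T) := fun k =>
    (continuousOn_const.add hA).inner continuousOn_const
  have h2 : ∫ t in (0:ℝ)..T, inner ℝ (mom c (x (some (cell T m t))) + A t (posL T m t x))
      (singlePath (some j) w (some (cell T m t)))
      = inner ℝ ((T / m) • mom c (x (some j))
      + ∫ t in (j * (T / m))..((j + 1) * (T / m)), A t (posL T m t x)) w := by
    rw [integral_cell_period hT (f := fun k t => inner ℝ (mom c (x (some k))
      + A t (posL T m t x)) (singlePath (some j) w (some k))) hcont, Finset.sum_eq_single j]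
    · simp only [singlePath_apply, if_true]
      rw [integral_inner_const (intervalIntegrable_const.add hAj),
        intervalIntegral.integral_add intervalIntegrable_const hAj,
        intervalIntegral.integral_const]
      congr 3
      ring
    · intro k _ hk
      have hk' : some k ≠ some j := fun h => hk (Option.some.inj h)
      simp [singlePath_apply, hk]
    · simp
  rw [F.inner_actionGrad hx, intervalIntegral.integral_add, h2]
  · refine Eq.trans ?_ (inner_add_left _ _ w).symm
    congr 1
    rw [← integral_inner_const (F.intervalIntegrable_ramp_force hx j)]
    simp only [posL_singlePath_some, real_inner_smul_left, real_inner_smul_right]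
  · exact intervalIntegrable_piecewise hT.le measurable_cell
      (f := fun k t => inner ℝ (force V A (stateL T m k (t, x)))
        (posL T m t (singlePath (some j) w))) fun k =>
      (F.continuousOn_force_stateL hx k).inner
        (continuous_posL.clm_apply continuous_const).continuousOn
  · exact intervalIntegrable_piecewise hT.le measurable_cell
      (f := fun k t => inner ℝ (mom c (x (some k)) + A t (posL T m t x))
        (singlePath (some j) w (some k))) hcont

theorem inner_actionGrad_none (F : FieldData T c κ K b d r V A) {x : PLSpace m}
    (hx : x ∈ Paths T c m r) (w : E3) :
    inner ℝ (actionGrad T c m V A x) (singlePath none w)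
      = inner ℝ (∫ t in (0:ℝ)..T, force V A (stateL T m (cell T m t) (t, x))) w := by
  rw [F.inner_actionGrad hx, ← integral_inner_const (F.intervalIntegrable_force hx)]
  simp [posL_singlePath_none, singlePath_apply]

end FieldData

end LW

namespace LW

theorem inner_mom {c : ℝ} (v w : E3) :
    inner ℝ (mom c v) w = (Real.sqrt (1 - ‖v‖ ^ 2 / c ^ 2))⁻¹ * inner ℝ v w :=
  real_inner_smul_left _ _ _

theorem inner_mom_self {c : ℝ} (v : E3) : inner ℝ (mom c v) v = ‖mom c v‖ * ‖v‖ := by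
  rw [inner_mom, real_inner_self_eq_norm_sq, mom, norm_smul, norm_inv,
    Real.norm_of_nonneg (Real.sqrt_nonneg _)]
  ring

theorem exchange_mem_ClosedPaths {c₁ : ℝ} {m : ℕ} {x : PLSpace m} (hx : x ∈ ClosedPaths c₁ m)
    {j k : Fin m} (hjk : j ≠ k) {w : E3} (hj : ‖x (some j) - w‖ ≤ c₁)
    (hk : ‖x (some k) + w‖ ≤ c₁) :
    x + (singlePath (some k) w - singlePath (some j) w) ∈ ClosedPaths c₁ m := by
  have e : ∀ o, (x + (singlePath (some k) w - singlePath (some j) w)) o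
      = x o + ((if o = some k then w else 0) - if o = some j then w else 0) := fun o => by
    simp [singlePath_apply]
  refine ⟨?_, fun i => ?_⟩
  · simp only [e, Option.some.injEq, Finset.sum_add_distrib, Finset.sum_sub_distrib,
      Finset.sum_ite_eq', Finset.mem_univ, if_true, sub_self, add_zero]
    exact hx.1
  · rw [e]
    by_cases h1 : i = k
    · subst h1
      simpa [hjk.symm] using hk
    · by_cases h2 : i = j
      · subst h2
        simpa [hjk, sub_eq_add_neg] using hj
      · simpa [h1, h2] using hx.2 i

namespace FieldData

variable {T c κ K b d : ℝ} {N : ℕ} {r : Fin N → ℝ → E3} {V : ℝ → E3 → ℝ} {A : ℝ → E3 → E3}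
  {m : ℕ} [NeZero m]

theorem norm_ramp_integral_le (F : FieldData T c κ K b d r V A) {M : ℝ} {x : PLSpace m}
    (hf : ∀ t ∈ Icc 0 T, ∀ j, ‖force V A (stateL T m j (t, x))‖ ≤ M) (j : Fin m) :
    ‖∫ t in (0:ℝ)..T, ramp T m j t • force V A (stateL T m (cell T m t) (t, x))‖
      ≤ T / m * M * T := by
  have hT := F.T_pos
  have := intervalIntegral.norm_integral_le_of_norm_le_const (a := 0) (b := T)
    (C := T / m * M) (f := fun t => ramp T m j t • force V A (stateL T m (cell T m t) (t, x)))
    fun t ht => by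
      rw [uIoc_of_le hT.le] at ht
      rw [norm_smul, Real.norm_of_nonneg (ramp_nonneg j t)]
      exact mul_le_mul (ramp_le hT j t) (hf t ⟨ht.1.le, ht.2⟩ _) (norm_nonneg _)
        (step_pos hT).le
  rwa [sub_zero, abs_of_pos hT] at this

theorem norm_elVec_sub_le (F : FieldData T c κ K b d r V A) {M : ℝ} {x : PLSpace m}
    (hA : ∀ t ∈ Icc 0 T, ‖A t (posL T m t x)‖ ≤ M)
    (hf : ∀ t ∈ Icc 0 T, ∀ j, ‖force V A (stateL T m j (t, x))‖ ≤ M) (j : Fin m) :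
    ‖elVec T c m V A x j - (T / m) • mom c (x (some j))‖ ≤ T / m * ((T + 1) * M) := by
  have hT := F.T_pos
  have hh := step_pos (m := m) hT
  have h2 : ‖∫ t in (j * (T / m))..((j + 1) * (T / m)), A t (posL T m t x)‖ ≤ M * (T / m) := by
    have := intervalIntegral.norm_integral_le_of_norm_le_const (a := j * (T / m))
      (b := (j + 1) * (T / m)) (C := M) (f := fun t => A t (posL T m t x))
      fun t ht => hA t (cell_subset hT j (uIoc_subset_uIcc ht))
    rwa [show ((j:ℝ) + 1) * (T / m) - j * (T / m) = T / m by ring, abs_of_pos hh] at this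
  have e : elVec T c m V A x j - (T / m) • mom c (x (some j))
      = (∫ t in (0:ℝ)..T, ramp T m j t • force V A (stateL T m (cell T m t) (t, x)))
        + ∫ t in (j * (T / m))..((j + 1) * (T / m)), A t (posL T m t x) := by
    rw [elVec]; abel
  rw [e]
  have := F.norm_ramp_integral_le hf j
  refine (norm_add_le _ _).trans ?_
  linarith

/-- At a critical point of the constrained problem the speed bound is not attained. -/
theorem norm_lt_of_critical (F : FieldData T c κ K b d r V A) {M c₁ : ℝ} {x : PLSpace m}
    (hc₀ : 0 < c₁) (hc₁ : c₁ < c) (hx : x ∈ Paths T c m r) (hC : x ∈ ClosedPaths c₁ m)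
    (hA : ∀ t ∈ Icc 0 T, ‖A t (posL T m t x)‖ ≤ M)
    (hf : ∀ t ∈ Icc 0 T, ∀ j, ‖force V A (stateL T m j (t, x))‖ ≤ M)
    (hcrit : ∀ y ∈ ClosedPaths c₁ m, 0 ≤ inner ℝ (actionGrad T c m V A x) (y - x))
    (hM : ∀ p, ‖p‖ ≤ 2 * ((T + 1) * M) → ‖velOfMom c p‖ < c₁) (j : Fin m) :
    ‖x (some j)‖ < c₁ := by
  by_contra! hj
  have hjc : ‖x (some j)‖ = c₁ := (hC.2 j).antisymm hj
  obtain ⟨k, hk⟩ : ∃ k, inner ℝ (x (some k)) (x (some j)) < 0 := by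
    by_contra! h
    have h1 : ∑ k, inner ℝ (x (some k)) (x (some j)) = 0 := by
      rw [← sum_inner, hC.1, inner_zero_left]
    have := (Finset.sum_eq_zero_iff_of_nonneg fun k _ => h k).1 h1 j (Finset.mem_univ _)
    rw [real_inner_self_eq_norm_sq, hjc] at this
    exact hc₀.ne' (pow_eq_zero_iff two_ne_zero |>.1 this)
  have hjk : j ≠ k := by
    rintro rfl
    exact hk.not_ge real_inner_self_nonneg
  set a := inner ℝ (x (some k)) (x (some j)) with ha
  set s := min 1 (-2 * a / c₁ ^ 2) with hs
  have hs0 : 0 < s := lt_min one_pos (div_pos (by linarith) (by positivity))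
  have hs1 : s ≤ 1 := min_le_left _ _
  have hs2 : s * c₁ ^ 2 ≤ -2 * a := by
    rw [← le_div_iff₀ (by positivity)]; exact min_le_right _ _
  have hy := exchange_mem_ClosedPaths hC hjk (w := s • x (some j)) (by
      rw [show x (some j) - s • x (some j) = (1 - s) • x (some j) by rw [sub_smul, one_smul],
        norm_smul, Real.norm_of_nonneg (by linarith), hjc]
      nlinarith) (by
      refine le_of_sq_le_sq ?_ hc₀.le
      rw [norm_add_sq_real, real_inner_smul_right, ← ha, norm_smul, hjc, Real.norm_of_nonneg hs0.le]
      have := pow_le_pow_left₀ (norm_nonneg _) (hC.2 k) 2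
      nlinarith)
  have h := hcrit _ hy
  rw [add_sub_cancel_left, inner_sub_right, F.inner_actionGrad_some hx, F.inner_actionGrad_some hx,
    real_inner_smul_right, real_inner_smul_right, ← mul_sub] at h
  have h := nonneg_of_mul_nonneg_right h hs0
  have hh := step_pos (m := m) F.T_pos
  have bound := F.norm_elVec_sub_le hA hf
  set R := fun i => elVec T c m V A x i - (T / m) • mom c (x (some i)) with hR
  have e : ∀ i, elVec T c m V A x i = (T / m) • mom c (x (some i)) + R i := fun i => by
    simp [hR]
  have h3 : ∀ i, |inner ℝ (R i) (x (some j))| ≤ T / m * ((T + 1) * M) * c₁ := fun i =>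
    (abs_real_inner_le_norm _ _).trans (by rw [hjc]; gcongr; exact bound i)
  rw [e k, e j, inner_add_left, inner_add_left, real_inner_smul_left, real_inner_smul_left,
    inner_mom_self, hjc, inner_mom] at h
  have h4 : (Real.sqrt (1 - ‖x (some k)‖ ^ 2 / c ^ 2))⁻¹ * a ≤ 0 :=
    mul_nonpos_of_nonneg_of_nonpos (by positivity) hk.le
  have h5 := abs_le.1 (h3 k)
  have h6 := abs_le.1 (h3 j)
  have h7 : T / m * ‖mom c (x (some j))‖ * c₁ ≤ T / m * (2 * ((T + 1) * M)) * c₁ := by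
    have := mul_nonpos_of_nonneg_of_nonpos hh.le h4
    linarith
  have h8 := le_of_mul_le_mul_left (le_of_mul_le_mul_right h7 hc₀) hh
  have := hM _ h8
  rw [velOfMom_mom (hjc.trans_lt hc₁)] at this
  exact this.not_ge hj

theorem exists_pos_mul_le {a e : ℝ} (hae : a < e) (w : E3) : ∃ s > (0:ℝ), a + ‖s • w‖ ≤ e := by
  refine ⟨(e - a) / (‖w‖ + 1), div_pos (sub_pos.2 hae) (by positivity), ?_⟩
  rw [norm_smul, Real.norm_of_nonneg (div_nonneg (sub_pos.2 hae).le (by positivity)),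
    div_mul_eq_mul_div]
  have : (e - a) * ‖w‖ / (‖w‖ + 1) ≤ e - a := by
    rw [div_le_iff₀ (by positivity)]
    nlinarith
  linarith

/-- The discrete Euler–Lagrange equations. -/
theorem elVec_eq_of_critical (F : FieldData T c κ K b d r V A) {c₁ : ℝ} {x : PLSpace m}
    (hx : x ∈ Paths T c m r) (hC : x ∈ ClosedPaths c₁ m)
    (hlt : ∀ j, ‖x (some j)‖ < c₁)
    (hcrit : ∀ y ∈ ClosedPaths c₁ m, 0 ≤ inner ℝ (actionGrad T c m V A x) (y - x)) (j k : Fin m) :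
    elVec T c m V A x j = elVec T c m V A x k := by
  rcases eq_or_ne j k with rfl | hjk
  · rfl
  set w := elVec T c m V A x j - elVec T c m V A x k with hw
  obtain ⟨s, hs, h⟩ := exists_pos_mul_le (max_lt (hlt j) (hlt k)) w
  have hy := exchange_mem_ClosedPaths hC hjk (w := s • w)
    (by linarith [norm_sub_le (x (some j)) (s • w), le_max_left ‖x (some j)‖ ‖x (some k)‖])
    (by linarith [norm_add_le (x (some k)) (s • w), le_max_right ‖x (some j)‖ ‖x (some k)‖])
  have h := hcrit _ hy
  rw [add_sub_cancel_left, inner_sub_right, F.inner_actionGrad_some hx, F.inner_actionGrad_some hx,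
    real_inner_smul_right, real_inner_smul_right, ← mul_sub] at h
  have h := nonneg_of_mul_nonneg_right h hs
  rw [← inner_sub_left, ← neg_sub (elVec T c m V A x j), ← hw, inner_neg_left,
    real_inner_self_eq_norm_sq] at h
  have : ‖w‖ = 0 := by nlinarith [norm_nonneg w]
  exact sub_eq_zero.1 (norm_eq_zero.1 this)

theorem integral_force_eq_zero_of_critical (F : FieldData T c κ K b d r V A) {c₁ : ℝ}
    {x : PLSpace m} (hx : x ∈ Paths T c m r) (hC : x ∈ ClosedPaths c₁ m)
    (hcrit : ∀ y ∈ ClosedPaths c₁ m, 0 ≤ inner ℝ (actionGrad T c m V A x) (y - x)) :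
    ∫ t in (0:ℝ)..T, force V A (stateL T m (cell T m t) (t, x)) = 0 := by
  set w := ∫ t in (0:ℝ)..T, force V A (stateL T m (cell T m t) (t, x)) with hw
  have hy : x + singlePath (m := m) none (-w) ∈ ClosedPaths c₁ m := by
    have e : ∀ j : Fin m, (x + singlePath (m := m) none (-w)) (some j) = x (some j) := fun j => by
      rw [PiLp.add_apply, singlePath_apply, if_neg (by simp), add_zero]
    exact ⟨by simp only [e]; exact hC.1, fun j => by rw [e]; exact hC.2 j⟩
  have h := hcrit _ hy
  rw [add_sub_cancel_left, F.inner_actionGrad_none hx, ← hw, inner_neg_right,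
    real_inner_self_eq_norm_sq] at h
  have : ‖w‖ = 0 := by nlinarith [norm_nonneg w]
  exact norm_eq_zero.1 this

end FieldData

end LW

namespace LW

/-- Uniformly bounded, uniformly Lipschitz sequences have pointwise convergent subsequences. -/
theorem exists_subseq_tendsto_of_lipschitz {E : Type*} [NormedAddCommGroup E] [ProperSpace E]
    {a b L R : ℝ} {f : ℕ → ℝ → E}
    (hL : ∀ n, ∀ s ∈ Icc a b, ∀ t ∈ Icc a b, ‖f n t - f n s‖ ≤ L * |t - s|)
    (hR : ∀ n, ∀ t ∈ Icc a b, ‖f n t‖ ≤ R) :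
    ∃ g : ℝ → E, ∃ φ : ℕ → ℕ, StrictMono φ ∧
      ∀ t ∈ Icc a b, Tendsto (fun n => f (φ n) t) atTop (𝓝 (g t)) := by
  have hlip : ∀ n, LipschitzWith L.toNNReal fun t : Icc a b => f n t := fun n =>
    LipschitzWith.of_dist_le_mul fun s t => by
      rw [dist_eq_norm, Subtype.dist_eq, Real.dist_eq]
      exact (hL n t t.2 s s.2).trans (by gcongr; exact Real.le_coe_toNNReal L)
  set F : ℕ → BoundedContinuousFunction (Icc a b) E := fun n =>
    BoundedContinuousFunction.mkOfCompact ⟨fun t => f n t, (hlip n).continuous⟩ with hF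
  have hFa : ∀ n t, F n t = f n t := fun n t => rfl
  have hcomp : IsCompact (closure (range F)) := by
    refine BoundedContinuousFunction.arzela_ascoli (Metric.closedBall 0 R)
      (isCompact_closedBall 0 R) _ ?_ ?_
    · rintro _ t ⟨n, rfl⟩
      rw [mem_closedBall_zero_iff, hFa]
      exact hR n t t.2
    · refine (LipschitzWith.uniformEquicontinuous _ L.toNNReal ?_).equicontinuous
      rintro ⟨_, n, rfl⟩
      exact hlip n
  obtain ⟨g, -, φ, hφ, hlim⟩ := hcomp.tendsto_subseq fun n => subset_closure (mem_range_self n)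
  refine ⟨fun t => if h : t ∈ Icc a b then g ⟨t, h⟩ else 0, φ, hφ, fun t ht => ?_⟩
  simp only [ht, dif_pos]
  exact ((BoundedContinuousFunction.lipschitz_eval_const (⟨t, ht⟩ : Icc a b)).continuous.tendsto g).comp
    hlim

/-- Piecewise linear paths that satisfy the discrete Euler–Lagrange equations, with bounds. -/
structure CritPath (T c : ℝ) {N : ℕ} (r : Fin N → ℝ → E3) (V : ℝ → E3 → ℝ) (A : ℝ → E3 → E3)
    (c₁ δ R M a : ℝ) {m : ℕ} [NeZero m] (x : PLSpace m) : Prop where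
  mem : x ∈ Paths T c m r
  closed : x ∈ ClosedPaths c₁ m
  dist_le : ∀ t ∈ Icc 0 T, ∀ i, δ ≤ ‖posL T m t x - r i t‖
  norm_le : ∀ t ∈ Icc 0 T, ‖posL T m t x‖ ≤ R
  norm_A_le : ∀ t ∈ Icc 0 T, ‖A t (posL T m t x)‖ ≤ M
  norm_force_le : ∀ t ∈ Icc 0 T, ∀ j, ‖force V A (stateL T m j (t, x))‖ ≤ M
  elVec_eq : ∀ j, elVec T c m V A x j = elVec T c m V A x 0
  integral_force : ∫ t in (0:ℝ)..T, force V A (stateL T m (cell T m t) (t, x)) = 0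
  le_action : a ≤ action T c m V A x

theorem ramp_eq_zero {T : ℝ} {m : ℕ} {j : Fin m} {t : ℝ} (ht : t ≤ j * (T / m)) :
    ramp T m j t = 0 := by
  rw [ramp, max_eq_right (min_le_left _ _ |>.trans ht), sub_self]

theorem ramp_eq_step {T : ℝ} {m : ℕ} [NeZero m] (hT : 0 < T) {j : Fin m} {t : ℝ}
    (ht : (j + 1) * (T / m) ≤ t) : ramp T m j t = T / m := by
  have hh := step_pos (m := m) hT
  rw [ramp, min_eq_right ht, max_eq_left (by nlinarith)]
  ring

theorem norm_integral_le_of_eq_zero_of_le {E : Type*} [NormedAddCommGroup E] [NormedSpace ℝ E]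
    {f : ℝ → E} {a b e B : ℝ} (ha : a ≤ e) (hb : e ≤ b)
    (hf : IntervalIntegrable f volume a b) (h0 : ∀ t ∈ Ioc a e, f t = 0)
    (hB : ∀ t ∈ Ioc e b, ‖f t‖ ≤ B) : ‖∫ t in a..b, f t‖ ≤ B * (b - e) := by
  have hab := ha.trans hb
  rw [← intervalIntegral.integral_add_adjacent_intervals (b := e)
    (hf.mono_set (by rw [uIcc_of_le ha, uIcc_of_le hab]; exact Icc_subset_Icc le_rfl hb))
    (hf.mono_set (by rw [uIcc_of_le hb, uIcc_of_le hab]; exact Icc_subset_Icc ha le_rfl))]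
  have h1 : ∫ t in a..e, f t = 0 := intervalIntegral.integral_zero_ae (by
    refine Eventually.of_forall fun t ht => h0 t ?_
    rwa [uIoc_of_le ha] at ht)
  rw [h1, zero_add]
  have := intervalIntegral.norm_integral_le_of_norm_le_const (a := e) (b := b) (C := B) (f := f)
    fun t ht => hB t (by rwa [uIoc_of_le hb] at ht)
  rwa [abs_of_nonneg (sub_nonneg.2 hb)] at this

theorem norm_integral_le_of_le_of_eq_zero {E : Type*} [NormedAddCommGroup E] [NormedSpace ℝ E]
    {f : ℝ → E} {a b e B : ℝ} (ha : a ≤ e) (hb : e ≤ b)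
    (hf : IntervalIntegrable f volume a b) (h0 : ∀ t ∈ Ioc e b, f t = 0)
    (hB : ∀ t ∈ Ioc a e, ‖f t‖ ≤ B) : ‖∫ t in a..b, f t‖ ≤ B * (e - a) := by
  have hab := ha.trans hb
  rw [← intervalIntegral.integral_add_adjacent_intervals (b := e)
    (hf.mono_set (by rw [uIcc_of_le ha, uIcc_of_le hab]; exact Icc_subset_Icc le_rfl hb))
    (hf.mono_set (by rw [uIcc_of_le hb, uIcc_of_le hab]; exact Icc_subset_Icc ha le_rfl))]
  have h1 : ∫ t in e..b, f t = 0 := intervalIntegral.integral_zero_ae (by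
    refine Eventually.of_forall fun t ht => h0 t ?_
    rwa [uIoc_of_le hb] at ht)
  rw [h1, add_zero]
  have := intervalIntegral.norm_integral_le_of_norm_le_const (a := a) (b := e) (C := B) (f := f)
    fun t ht => hB t (by rwa [uIoc_of_le ha] at ht)
  rwa [abs_of_nonneg (sub_nonneg.2 ha)] at this

namespace CritPath

variable {T c κ K b d : ℝ} {N : ℕ} {r : Fin N → ℝ → E3} {V : ℝ → E3 → ℝ} {A : ℝ → E3 → E3}
  {c₁ δ R M a : ℝ} {m : ℕ} [NeZero m] {x : PLSpace m}

/-- The discrete momentum balance. -/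
theorem norm_mom_sub_le (P : CritPath T c r V A c₁ δ R M a x) (F : FieldData T c κ K b d r V A)
    {t : ℝ} (ht : t ∈ Ioc 0 T) :
    ‖mom c (x (some (cell T m t))) - ((T / m)⁻¹ • elVec T c m V A x 0
      + (∫ s in (0:ℝ)..t, force V A (stateL T m (cell T m s) (s, x)))
      - (T / m)⁻¹ • ∫ s in ((cell T m t : ℕ) * (T / m))..(((cell T m t : ℕ) + 1) * (T / m)),
          A s (posL T m s x))‖ ≤ 2 * (T / m) * M := by
  have hT := F.T_pos
  have hh := step_pos (m := m) hT
  obtain ⟨hj1, hj2⟩ := (cell_eq_iff hT ht.1 ht.2 (cell T m t)).1 rfl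
  set j := cell T m t with hj
  set h := T / m with hhd
  set f : ℝ → E3 := fun s => force V A (stateL T m (cell T m s) (s, x)) with hf
  have hfi : IntervalIntegrable f volume 0 T := F.intervalIntegrable_force P.mem
  have hri : IntervalIntegrable (fun s => ramp T m j s • f s) volume 0 T :=
    F.intervalIntegrable_ramp_force P.mem j
  have s1 : uIcc 0 t ⊆ uIcc 0 T := by
    rw [uIcc_of_le ht.1.le, uIcc_of_le hT.le]; exact Icc_subset_Icc le_rfl ht.2
  have s2 : uIcc t T ⊆ uIcc 0 T := by
    rw [uIcc_of_le ht.2, uIcc_of_le hT.le]; exact Icc_subset_Icc ht.1.le le_rfl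
  have hB : ∀ s ∈ Icc 0 T, ‖f s‖ ≤ M := fun s hs => P.norm_force_le s hs _
  have hM : 0 ≤ M := (norm_nonneg _).trans (hB 0 ⟨le_rfl, hT.le⟩)
  have e0 : (∫ s in (0:ℝ)..t, f s) = - ∫ s in t..T, f s := by
    rw [eq_neg_iff_add_eq_zero,
      intervalIntegral.integral_add_adjacent_intervals (hfi.mono_set s1) (hfi.mono_set s2)]
    exact P.integral_force
  have e1 : (∫ s in (0:ℝ)..T, ramp T m j s • f s) + h • (∫ s in (0:ℝ)..t, f s)
      = (∫ s in (0:ℝ)..t, ramp T m j s • f s) + ∫ s in t..T, (ramp T m j s - h) • f s := by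
    simp only [sub_smul]
    rw [intervalIntegral.integral_sub (f := fun s => ramp T m j s • f s) (g := fun s => h • f s)
        (hri.mono_set s2) ((hfi.mono_set s2).smul h),
      intervalIntegral.integral_smul, e0, ← intervalIntegral.integral_add_adjacent_intervals
        (hri.mono_set s1) (hri.mono_set s2), smul_neg]
    abel
  have b1 : ‖∫ s in (0:ℝ)..t, ramp T m j s • f s‖ ≤ h * M * (t - j * h) := by
    refine norm_integral_le_of_eq_zero_of_le (by positivity) hj1.le (hri.mono_set s1)
      (fun s hs => by rw [ramp_eq_zero hs.2, zero_smul]) fun s hs => ?_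
    rw [norm_smul, Real.norm_of_nonneg (ramp_nonneg j s)]
    have h0 : 0 ≤ (j:ℝ) * h := by positivity
    exact mul_le_mul (ramp_le hT j s) (hB s ⟨by linarith [hs.1], hs.2.trans ht.2⟩)
      (norm_nonneg _) hh.le
  have b2 : ‖∫ s in t..T, (ramp T m j s - h) • f s‖ ≤ h * M * ((j + 1) * h - t) := by
    refine norm_integral_le_of_le_of_eq_zero hj2 (mul_step_le hT j) ?_
      (fun s hs => by rw [ramp_eq_step hT hs.1.le, sub_self, zero_smul]) fun s hs => ?_
    · simp only [sub_smul]
      exact (hri.mono_set s2).sub ((hfi.mono_set s2).smul h)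
    · rw [norm_smul, Real.norm_eq_abs, abs_sub_comm,
        abs_of_nonneg (sub_nonneg.2 (ramp_le hT j s))]
      refine mul_le_mul (sub_le_self _ (ramp_nonneg j s))
        (hB s ⟨by linarith [hs.1, ht.1], hs.2.trans (mul_step_le hT j)⟩)
        (norm_nonneg _) hh.le
  have hel : h⁻¹ • elVec T c m V A x 0 = h⁻¹ • (∫ s in (0:ℝ)..T, ramp T m j s • f s)
      + (mom c (x (some j)) + h⁻¹ • ∫ s in (j * h)..((j + 1) * h), A s (posL T m s x)) := by
    rw [← P.elVec_eq j, elVec, smul_add, smul_add, smul_smul h⁻¹ h, inv_mul_cancel₀ hh.ne',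
      one_smul]
  have e2 : mom c (x (some j)) - (h⁻¹ • elVec T c m V A x 0 + (∫ s in (0:ℝ)..t, f s)
      - h⁻¹ • ∫ s in (j * h)..((j + 1) * h), A s (posL T m s x))
      = -(h⁻¹ • ((∫ s in (0:ℝ)..T, ramp T m j s • f s) + h • (∫ s in (0:ℝ)..t, f s))) := by
    rw [hel, smul_add, smul_smul h⁻¹ h, inv_mul_cancel₀ hh.ne', one_smul]
    abel
  rw [e2, e1, norm_neg, norm_smul, norm_inv, Real.norm_of_nonneg hh.le, inv_mul_le_iff₀ hh]
  refine (norm_add_le _ _).trans ((add_le_add b1 b2).trans ?_)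
  have : 0 ≤ h * M * h := by positivity
  nlinarith

end CritPath

end LW

namespace LW

theorem norm_mom_le {c c₁ : ℝ} (hc₁ : c₁ < c) {v : E3} (hv : ‖v‖ ≤ c₁) :
    ‖mom c v‖ ≤ (Real.sqrt (1 - c₁ ^ 2 / c ^ 2))⁻¹ * c₁ := by
  have h0 : 0 ≤ c₁ := (norm_nonneg v).trans hv
  have h1 := one_sub_sq_div_pos h0 hc₁
  rw [mom, norm_smul, norm_inv, Real.norm_of_nonneg (Real.sqrt_nonneg _)]
  have : Real.sqrt (1 - c₁ ^ 2 / c ^ 2) ≤ Real.sqrt (1 - ‖v‖ ^ 2 / c ^ 2) :=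
    Real.sqrt_le_sqrt (by gcongr)
  have h2 := Real.sqrt_pos.2 h1
  gcongr

theorem tendsto_step {T : ℝ} {m : ℕ → ℕ} (hm : Tendsto m atTop atTop) :
    Tendsto (fun n => T / (m n : ℝ)) atTop (𝓝 0) :=
  tendsto_const_nhds.div_atTop (tendsto_natCast_atTop_atTop.comp hm)

namespace CritPath

variable {T c κ K b d : ℝ} {N : ℕ} {r : Fin N → ℝ → E3} {V : ℝ → E3 → ℝ} {A : ℝ → E3 → E3}
  {c₁ δ R M a : ℝ}

theorem norm_elVec_le {m : ℕ} [NeZero m] {x : PLSpace m} (P : CritPath T c r V A c₁ δ R M a x)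
    (F : FieldData T c κ K b d r V A) (hc₁ : c₁ < c) :
    ‖(T / m)⁻¹ • elVec T c m V A x 0‖
      ≤ (Real.sqrt (1 - c₁ ^ 2 / c ^ 2))⁻¹ * c₁ + (T + 1) * M := by
  have hh := step_pos (m := m) F.T_pos
  have h1 := F.norm_elVec_sub_le P.norm_A_le P.norm_force_le 0
  have h2 := norm_mom_le hc₁ (P.closed.2 0)
  have e : (T / m)⁻¹ • elVec T c m V A x 0 = mom c (x (some 0))
      + (T / m)⁻¹ • (elVec T c m V A x 0 - (T / m) • mom c (x (some 0))) := by
    rw [smul_sub, smul_smul, inv_mul_cancel₀ hh.ne', one_smul]; abel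
  rw [e]
  refine (norm_add_le _ _).trans (add_le_add h2 ?_)
  rw [norm_smul, norm_inv, Real.norm_of_nonneg hh.le, inv_mul_le_iff₀ hh]
  exact h1

variable {m : ℕ → ℕ} [∀ n, NeZero (m n)] {x : ∀ n, PLSpace (m n)} {X : ℝ → E3}

theorem lim_dist (P : ∀ n, CritPath T c r V A c₁ δ R M a (x n))
    (hX : ∀ t ∈ Icc 0 T, Tendsto (fun n => posL T (m n) t (x n)) atTop (𝓝 (X t)))
    {t : ℝ} (ht : t ∈ Icc 0 T) (i : Fin N) : δ ≤ ‖X t - r i t‖ :=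
  ge_of_tendsto' ((hX t ht).sub_const _).norm fun n => (P n).dist_le t ht i

theorem lim_mem_Omega (P : ∀ n, CritPath T c r V A c₁ δ R M a (x n)) (hδ : 0 < δ)
    (hX : ∀ t ∈ Icc 0 T, Tendsto (fun n => posL T (m n) t (x n)) atTop (𝓝 (X t)))
    {t : ℝ} (ht : t ∈ Icc 0 T) : (t, X t) ∈ Omega N r := fun i =>
  sub_ne_zero.1 (norm_pos_iff.1 (hδ.trans_le (lim_dist P hX ht i)))

theorem lim_lipschitz (P : ∀ n, CritPath T c r V A c₁ δ R M a (x n)) (hT : 0 < T)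
    (hX : ∀ t ∈ Icc 0 T, Tendsto (fun n => posL T (m n) t (x n)) atTop (𝓝 (X t)))
    {s t : ℝ} (hs : s ∈ Icc 0 T) (ht : t ∈ Icc 0 T) : ‖X t - X s‖ ≤ c₁ * |t - s| :=
  le_of_tendsto' ((hX t ht).sub (hX s hs)).norm fun n =>
    norm_posL_sub_le hT (P n).closed.2 hs ht

/-- The averages of the vector potential over the shrinking intervals converge. -/
theorem tendsto_average (P : ∀ n, CritPath T c r V A c₁ δ R M a (x n))
    (F : FieldData T c κ K b d r V A) (hm : Tendsto m atTop atTop) (hδ : 0 < δ)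
    (hX : ∀ t ∈ Icc 0 T, Tendsto (fun n => posL T (m n) t (x n)) atTop (𝓝 (X t)))
    {t : ℝ} (ht : t ∈ Ioc 0 T) :
    Tendsto (fun n => (T / m n)⁻¹ • ∫ s in ((cell T (m n) t : ℕ) * (T / m n))..
      (((cell T (m n) t : ℕ) + 1) * (T / m n)), A s (posL T (m n) s (x n))) atTop
      (𝓝 (A t (X t))) := by
  have hT := F.T_pos
  have htI : t ∈ Icc 0 T := ⟨ht.1.le, ht.2⟩
  have hcont : ContinuousAt (fun p : ℝ × E3 => A p.1 p.2) (t, X t) :=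
    F.continuousOn_A.continuousAt (F.isOpen_Omega.mem_nhds (lim_mem_Omega P hδ hX htI))
  rw [Metric.tendsto_atTop]
  intro ε hε
  obtain ⟨η, hη, hAη⟩ := Metric.continuousAt_iff.1 hcont (ε / 2) (half_pos hε)
  have hlim : Tendsto (fun n => (1 + c₁) * (T / m n) + ‖posL T (m n) t (x n) - X t‖) atTop
      (𝓝 0) := by
    have := ((tendsto_step hm (T := T)).const_mul (1 + c₁)).add
      (tendsto_iff_norm_sub_tendsto_zero.1 (hX t htI))
    simpa using this
  obtain ⟨n₀, hn₀⟩ := eventually_atTop.1 (hlim.eventually_lt_const hη)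
  refine ⟨n₀, fun n hn => ?_⟩
  have hlt := hn₀ n hn
  have hh := step_pos (m := m n) hT
  have hc₀ : 0 ≤ c₁ := (norm_nonneg _).trans ((P n).closed.2 0)
  obtain ⟨hj1, hj2⟩ := (cell_eq_iff hT ht.1 ht.2 (cell T (m n) t)).1 rfl
  set j := cell T (m n) t
  set h := T / (m n : ℝ)
  have hwidth : ((j:ℝ) + 1) * h - j * h = h := by ring
  have h_int : IntervalIntegrable (fun s => A s (posL T (m n) s (x n))) volume (j * h)
      ((j + 1) * h) := ((F.continuousOn_A_posL (P n).mem).mono (cell_subset hT j)).intervalIntegrable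
  have e : (h⁻¹ • ∫ s in (j * h)..((j + 1) * h), A s (posL T (m n) s (x n))) - A t (X t)
      = h⁻¹ • ∫ s in (j * h)..((j + 1) * h), (A s (posL T (m n) s (x n)) - A t (X t)) := by
    rw [intervalIntegral.integral_sub h_int intervalIntegrable_const,
      intervalIntegral.integral_const, hwidth, smul_sub, smul_smul h⁻¹ h, inv_mul_cancel₀ hh.ne',
      one_smul]
  have hb := intervalIntegral.norm_integral_le_of_norm_le_const (a := j * h) (b := (j + 1) * h)
    (C := ε / 2) (f := fun s => A s (posL T (m n) s (x n)) - A t (X t)) fun s hs => by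
      have hs' := cell_subset hT j (uIoc_subset_uIcc hs)
      rw [uIoc_of_le (by nlinarith)] at hs
      have hst : |s - t| ≤ h := abs_le.2 ⟨by linarith [hs.1, hwidth], by linarith [hs.2, hwidth]⟩
      have h3 := norm_posL_sub_le hT (P n).closed.2 htI hs'
      have h4 : ‖posL T (m n) s (x n) - X t‖ < η := by
        have := norm_sub_le_norm_sub_add_norm_sub (posL T (m n) s (x n)) (posL T (m n) t (x n)) (X t)
        have := mul_le_mul_of_nonneg_left hst hc₀
        linarith
      have h5 : |s - t| < η := by
        have := mul_nonneg hc₀ hh.le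
        linarith [norm_nonneg (posL T (m n) t (x n) - X t)]
      rw [← dist_eq_norm]
      refine (hAη (x := (s, posL T (m n) s (x n))) ?_).le
      rw [Prod.dist_eq, max_lt_iff, Real.dist_eq, dist_eq_norm]
      exact ⟨h5, h4⟩
  rw [hwidth, abs_of_pos hh] at hb
  rw [dist_eq_norm, e, norm_smul, norm_inv, Real.norm_of_nonneg hh.le, inv_mul_lt_iff₀ hh]
  nlinarith

variable {Q : ℝ → E3} {C : E3}

/-- The velocities converge. -/
theorem tendsto_velocity (P : ∀ n, CritPath T c r V A c₁ δ R M a (x n))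
    (F : FieldData T c κ K b d r V A) (hm : Tendsto m atTop atTop) (hδ : 0 < δ) (hc₁ : c₁ < c)
    (hX : ∀ t ∈ Icc 0 T, Tendsto (fun n => posL T (m n) t (x n)) atTop (𝓝 (X t)))
    (hQ : ∀ t ∈ Icc 0 T, Tendsto (fun n => ∫ s in (0:ℝ)..t,
      force V A (stateL T (m n) (cell T (m n) s) (s, x n))) atTop (𝓝 (Q t)))
    (hC : Tendsto (fun n => (T / m n)⁻¹ • elVec T c (m n) V A (x n) 0) atTop (𝓝 C))
    {t : ℝ} (ht : t ∈ Ioc 0 T) :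
    Tendsto (fun n => (x n) (some (cell T (m n) t))) atTop
      (𝓝 (velOfMom c (C + Q t - A t (X t)))) := by
  have h1 := (hC.add (hQ t ⟨ht.1.le, ht.2⟩)).sub (tendsto_average P F hm hδ hX ht)
  have h2 : Tendsto (fun n => 2 * (T / m n) * M) atTop (𝓝 0) := by
    simpa using ((tendsto_step hm (T := T)).const_mul 2).mul_const M
  have h3 := squeeze_zero_norm (fun n => (P n).norm_mom_sub_le F ht) h2
  have h4 := h3.add h1
  simp only [sub_add_cancel, zero_add] at h4
  refine ((continuous_velOfMom.tendsto _).comp h4).congr fun n => ?_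
  exact velOfMom_mom (((P n).closed.2 _).trans_lt hc₁)

end CritPath

end LW

namespace LW

/-- The integrated Euler–Lagrange equations on a period. -/
structure LimitPath (T c : ℝ) {N : ℕ} (r : Fin N → ℝ → E3) (V : ℝ → E3 → ℝ) (A : ℝ → E3 → E3)
    (δ a : ℝ) (X Q : ℝ → E3) (C : E3) : Prop where
  continuousOn_X : ContinuousOn X (Icc 0 T)
  continuousOn_Q : ContinuousOn Q (Icc 0 T)
  dist_le : ∀ t ∈ Icc 0 T, ∀ i, δ ≤ ‖X t - r i t‖
  X_eq : ∀ t ∈ Icc 0 T, X t = X 0 + ∫ s in (0:ℝ)..t, velOfMom c (C + Q s - A s (X s))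
  Q_eq : ∀ t ∈ Icc 0 T,
    Q t = ∫ s in (0:ℝ)..t, force V A (s, X s, velOfMom c (C + Q s - A s (X s)))
  X_period : X T = X 0
  Q_period : Q T = 0
  le_action : a ≤ ∫ s in (0:ℝ)..T, lag c V A (s, X s, velOfMom c (C + Q s - A s (X s)))

theorem continuousOn_of_norm_sub_le {E : Type*} [NormedAddCommGroup E] {f : ℝ → E} {s : Set ℝ}
    {L : ℝ} (h : ∀ x ∈ s, ∀ y ∈ s, ‖f y - f x‖ ≤ L * |y - x|) : ContinuousOn f s := by
  have : LipschitzOnWith L.toNNReal f s := LipschitzOnWith.of_dist_le_mul fun x hx y hy => by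
    rw [dist_eq_norm, Real.dist_eq]
    exact (h y hy x hx).trans (by gcongr; exact Real.le_coe_toNNReal L)
  exact this.continuousOn

namespace CritPath

variable {T c κ K b d : ℝ} {N : ℕ} {r : Fin N → ℝ → E3} {V : ℝ → E3 → ℝ} {A : ℝ → E3 → E3}
  {c₁ δ R M a : ℝ}

theorem norm_integral_force_sub_le {m : ℕ} [NeZero m] {x : PLSpace m}
    (P : CritPath T c r V A c₁ δ R M a x) (F : FieldData T c κ K b d r V A)
    {s t : ℝ} (hs : s ∈ Icc 0 T) (ht : t ∈ Icc 0 T) :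
    ‖(∫ u in (0:ℝ)..t, force V A (stateL T m (cell T m u) (u, x)))
      - ∫ u in (0:ℝ)..s, force V A (stateL T m (cell T m u) (u, x))‖ ≤ M * |t - s| := by
  have hi := F.intervalIntegrable_force P.mem
  have h0 : (0:ℝ) ∈ uIcc 0 T := left_mem_uIcc
  have hI : Icc 0 T ⊆ uIcc 0 T := Icc_subset_uIcc
  rw [intervalIntegral.integral_interval_sub_left
    (hi.mono_set (uIcc_subset_uIcc h0 (hI ht))) (hi.mono_set (uIcc_subset_uIcc h0 (hI hs)))]
  refine intervalIntegral.norm_integral_le_of_norm_le_const fun u hu => P.norm_force_le u ?_ _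
  have := uIcc_subset_uIcc (hI hs) (hI ht) (uIoc_subset_uIcc hu)
  rwa [uIcc_of_le F.T_pos.le] at this

variable {m : ℕ → ℕ} [∀ n, NeZero (m n)] {x : ∀ n, PLSpace (m n)} {X Q : ℝ → E3} {C : E3}

theorem limitPath (P : ∀ n, CritPath T c r V A c₁ δ R M a (x n))
    (F : FieldData T c κ K b d r V A) (i₀ : Fin N) (hm : Tendsto m atTop atTop) (hδ : 0 < δ)
    (hc₁ : c₁ < c)
    (hX : ∀ t ∈ Icc 0 T, Tendsto (fun n => posL T (m n) t (x n)) atTop (𝓝 (X t)))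
    (hQ : ∀ t ∈ Icc 0 T, Tendsto (fun n => ∫ s in (0:ℝ)..t,
      force V A (stateL T (m n) (cell T (m n) s) (s, x n))) atTop (𝓝 (Q t)))
    (hC : Tendsto (fun n => (T / m n)⁻¹ • elVec T c (m n) V A (x n) 0) atTop (𝓝 C)) :
    LimitPath T c r V A δ a X Q C := by
  have hT := F.T_pos
  have h0 : (0:ℝ) ∈ Icc 0 T := ⟨le_rfl, hT.le⟩
  have h1 : T ∈ Icc 0 T := ⟨hT.le, le_rfl⟩
  have hvel := fun t ht => tendsto_velocity P F hm hδ hc₁ hX hQ hC (t := t) ht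
  have hstate : ∀ t ∈ Ioc 0 T, Tendsto (fun n => stateL T (m n) (cell T (m n) t) (t, x n)) atTop
      (𝓝 (t, X t, velOfMom c (C + Q t - A t (X t)))) := fun t ht =>
    tendsto_const_nhds.prodMk_nhds ((hX t ⟨ht.1.le, ht.2⟩).prodMk_nhds (hvel t ht))
  have hmem : ∀ t ∈ Icc 0 T, (t, X t) ∈ Omega N r := fun t ht => lim_mem_Omega P hδ hX ht
  have hsub : ∀ t ∈ Icc 0 T, uIoc 0 t ⊆ Ioc 0 T := fun t ht => by
    rw [uIoc_of_le ht.1]; exact Ioc_subset_Ioc_right ht.2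
  refine ⟨?_, ?_, fun t ht i => lim_dist P hX ht i, fun t ht => ?_, fun t ht => ?_, ?_, ?_, ?_⟩
  · exact continuousOn_of_norm_sub_le fun s hs t ht => lim_lipschitz P hT hX hs ht
  · exact continuousOn_of_norm_sub_le fun s hs t ht =>
      le_of_tendsto' ((hQ t ht).sub (hQ s hs)).norm fun n =>
        (P n).norm_integral_force_sub_le F hs ht
  · refine tendsto_nhds_unique (hX t ht) ?_
    have h : ∀ n, posL T (m n) t (x n) = posL T (m n) 0 (x n)
        + ∫ s in (0:ℝ)..t, (x n) (some (cell T (m n) s)) := fun n => by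
      rw [posL_zero hT, posL_eq_integral hT _ ht]
    simp only [h]
    refine (hX 0 h0).add ?_
    refine intervalIntegral.tendsto_integral_filter_of_dominated_convergence (fun _ => c₁)
      (Eventually.of_forall fun n => ?_) (Eventually.of_forall fun n => Eventually.of_forall
        fun s _ => (P n).closed.2 _) intervalIntegrable_const
      (Eventually.of_forall fun s hs => hvel s (hsub t ht hs))
    exact aestronglyMeasurable_piecewise measurable_cell ht.1 (f := fun j _ => (x n) (some j))
      fun j => continuousOn_const
  · refine tendsto_nhds_unique (hQ t ht) ?_
    refine intervalIntegral.tendsto_integral_filter_of_dominated_convergence (fun _ => M)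
      (Eventually.of_forall fun n => ?_) (Eventually.of_forall fun n => Eventually.of_forall
        fun s hs => (P n).norm_force_le s (Ioc_subset_Icc_self (hsub t ht hs)) _)
      intervalIntegrable_const (Eventually.of_forall fun s hs => ?_)
    · exact aestronglyMeasurable_piecewise measurable_cell ht.1
        (f := fun j s => force V A (stateL T (m n) j (s, x n)))
        fun j => (F.continuousOn_force_stateL (P n).mem j).mono (Icc_subset_Icc_right ht.2)
    · have hs' := hsub t ht hs
      have hO : IsOpen {q : ℝ × E3 × E3 | (q.1, q.2.1) ∈ Omega N r} :=
        F.isOpen_Omega.preimage (continuous_fst.prodMk (continuous_fst.comp continuous_snd))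
      have hc : ContinuousAt (force V A) (s, X s, velOfMom c (C + Q s - A s (X s))) :=
        F.continuousOn_force.continuousAt (hO.mem_nhds (hmem s (Ioc_subset_Icc_self hs')))
      exact hc.tendsto.comp (hstate s hs')
  · refine tendsto_nhds_unique (hX T h1) ((hX 0 h0).congr fun n => ?_)
    rw [posL_zero hT, posL_period hT, (P n).closed.1, smul_zero, add_zero]
  · refine tendsto_nhds_unique (hQ T h1) (tendsto_const_nhds.congr fun n => ?_)
    exact (P n).integral_force.symm
  · refine ge_of_tendsto' (f := fun n => action T c (m n) V A (x n)) (x := atTop) ?_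
      fun n => (P n).le_action
    unfold action
    refine intervalIntegral.tendsto_integral_filter_of_dominated_convergence
      (fun _ => c ^ 2 + K / δ)
      (Eventually.of_forall fun n => ?_) (Eventually.of_forall fun n => Eventually.of_forall
        fun s hs => ?_) intervalIntegrable_const (Eventually.of_forall fun s hs => ?_)
    · exact (F.intervalIntegrable_lag (P n).mem).def'.aestronglyMeasurable
    · have hs' := Ioc_subset_Icc_self (hsub T h1 hs)
      have h2 := F.lag_le (q := stateL T (m n) (cell T (m n) s) (s, x n))
        (((P n).closed.2 _).trans hc₁.le) hδ ((P n).dist_le s hs')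
      have h3 := F.le_lag ((P n).mem s hs' (cell T (m n) s)) i₀
      rw [Real.norm_of_nonneg (le_trans (div_nonneg F.κ_pos.le (norm_nonneg _)) h3)]
      exact h2
    · have hs' := hsub T h1 hs
      have hS : (s, X s, velOfMom c (C + Q s - A s (X s))) ∈ States c r :=
        ⟨hmem s (Ioc_subset_Icc_self hs'), norm_velOfMom_lt F.c_pos _⟩
      have hc := F.continuousOn_lag.continuousAt (F.isOpen_States.mem_nhds hS)
      exact hc.tendsto.comp (hstate s hs')

theorem exists_limitPath (P : ∀ n, CritPath T c r V A c₁ δ R M a (x n))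
    (F : FieldData T c κ K b d r V A) (i₀ : Fin N) (hm : Tendsto m atTop atTop) (hδ : 0 < δ)
    (hc₁ : c₁ < c) : ∃ X Q C, LimitPath T c r V A δ a X Q C := by
  have hT := F.T_pos
  have h0 : (0:ℝ) ∈ Icc 0 T := ⟨le_rfl, hT.le⟩
  have hR : 0 ≤ R := (norm_nonneg _).trans ((P 0).norm_le 0 h0)
  have hM : 0 ≤ M := (norm_nonneg _).trans ((P 0).norm_A_le 0 h0)
  have hc₀ : 0 ≤ c₁ := (norm_nonneg _).trans ((P 0).closed.2 0)
  set B := (Real.sqrt (1 - c₁ ^ 2 / c ^ 2))⁻¹ * c₁ + (T + 1) * M with hB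
  have hB0 : 0 ≤ B := by positivity
  obtain ⟨g, φ, hφ, hg⟩ := exists_subseq_tendsto_of_lipschitz (a := 0) (b := T) (L := c₁ + M)
    (R := R + M * T + B)
    (f := fun n t => (posL T (m n) t (x n),
      (∫ s in (0:ℝ)..t, force V A (stateL T (m n) (cell T (m n) s) (s, x n))),
      (T / m n)⁻¹ • elVec T c (m n) V A (x n) 0))
    (fun n s hs t ht => by
      have e1 := norm_posL_sub_le hT (P n).closed.2 hs ht
      have e2 := (P n).norm_integral_force_sub_le F hs ht
      have e3 := abs_nonneg (t - s)
      rw [Prod.mk_sub_mk, Prod.mk_sub_mk, sub_self, Prod.norm_mk, Prod.norm_mk, norm_zero]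
      refine max_le (e1.trans ?_) (max_le (e2.trans ?_) ?_)
      · nlinarith
      · nlinarith
      · positivity)
    fun n t ht => by
      have e1 := (P n).norm_le t ht
      have e2 := (P n).norm_integral_force_sub_le F h0 ht
      rw [intervalIntegral.integral_same, sub_zero, sub_zero, abs_of_nonneg ht.1] at e2
      have e3 := (P n).norm_elVec_le F hc₁
      have e4 : M * t ≤ M * T := mul_le_mul_of_nonneg_left ht.2 hM
      have e5 : 0 ≤ M * T := by positivity
      rw [Prod.norm_mk, Prod.norm_mk]
      refine max_le ?_ (max_le ?_ ?_) <;> linarith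
  exact ⟨fun t => (g t).1, fun t => (g t).2.1, (g 0).2.2,
    limitPath (m := fun n => m (φ n)) (x := fun n => x (φ n)) (fun n => P (φ n)) F i₀
      (hm.comp hφ.tendsto_atTop) hδ hc₁ (fun t ht => (hg t ht).fst_nhds)
      (fun t ht => (hg t ht).snd_nhds.fst_nhds) (hg 0 h0).snd_nhds.snd_nhds⟩

end CritPath

end LW

namespace LW

theorem exists_periodic_extension {E : Type*} [TopologicalSpace E] {T : ℝ} (hT : 0 < T)
    {f : ℝ → E} (hf : ContinuousOn f (Icc 0 T)) (h : f T = f 0) :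
    ∃ g : ℝ → E, Continuous g ∧ Periodic g T ∧ ∀ t ∈ Icc 0 T, g t = f t := by
  have hc : Continuous ((fun s : ℝ => f (T * s)) ∘ Int.fract) := by
    refine ContinuousOn.comp_fract'' (hf.comp (by fun_prop) fun s hs => ?_) (by simp [h])
    exact ⟨mul_nonneg hT.le hs.1, mul_le_of_le_one_right hT.le hs.2⟩
  refine ⟨fun t => f (T * Int.fract (t / T)), hc.comp (continuous_id.div_const T),
    fun t => ?_, fun t ht => ?_⟩
  · simp only
    rw [add_div, div_self hT.ne', Int.fract_add_one]
  · simp only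
    rcases ht.2.eq_or_lt with rfl | htT
    · rw [div_self hT.ne', Int.fract_one, mul_zero, h]
    · rw [Int.fract_eq_self.2 ⟨div_nonneg ht.1 hT.le, (div_lt_one hT).2 htT⟩,
        mul_div_cancel₀ _ hT.ne']

theorem hasDerivAt_of_periodic {E : Type*} [NormedAddCommGroup E] [NormedSpace ℝ E]
    [CompleteSpace E] {T : ℝ} (hT : 0 < T) {g w : ℝ → E} (hg : Periodic g T) (hw : Periodic w T)
    (hwc : Continuous w) (h : ∀ t ∈ Icc 0 T, g t = g 0 + ∫ s in (0:ℝ)..t, w s) (t : ℝ) :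
    HasDerivAt g (w t) t := by
  have hi : ∀ a b, IntervalIntegrable w volume a b := fun a b => hwc.intervalIntegrable a b
  have h0 : ∫ s in (0:ℝ)..T, w s = 0 := by
    have h1 := h T ⟨hT.le, le_rfl⟩
    have h2 := hg 0
    rw [zero_add] at h2
    rw [h2] at h1
    exact left_eq_add.1 h1
  have hper : Periodic (fun t => (g t, ∫ s in (0:ℝ)..t, w s)) T := fun t => by
    have h1 : ∫ s in (0:ℝ)..(t + T), w s = ∫ s in (0:ℝ)..t, w s := by
      rw [← intervalIntegral.integral_add_adjacent_intervals (hi 0 t) (hi t (t + T)),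
        hw.intervalIntegral_add_eq t 0, zero_add, h0, add_zero]
    simp only [hg t, h1]
  have key : g = fun t => g 0 + ∫ s in (0:ℝ)..t, w s := by
    funext t
    obtain ⟨s, hs, e⟩ := hper.exists_mem_Ico₀ hT t
    rw [Prod.mk.injEq] at e
    rw [e.1, e.2]
    exact h s ⟨hs.1, hs.2.le⟩
  rw [key]
  exact (hwc.integral_hasStrictDerivAt 0 t).hasDerivAt.const_add _

theorem inner_cross_curl (L : E3 →L[ℝ] E3) (v y : E3) :
    inner ℝ (cross v (fromFn
      ![toFn (L (EuclideanSpace.single 1 1)) 2 - toFn (L (EuclideanSpace.single 2 1)) 1,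
        toFn (L (EuclideanSpace.single 2 1)) 0 - toFn (L (EuclideanSpace.single 0 1)) 2,
        toFn (L (EuclideanSpace.single 0 1)) 1 - toFn (L (EuclideanSpace.single 1 1)) 0])) y
      = inner ℝ v (L y) - inner ℝ (L v) y := by
  have hL : ∀ w : E3, L w = w 0 • L (EuclideanSpace.single 0 1)
      + w 1 • L (EuclideanSpace.single 1 1) + w 2 • L (EuclideanSpace.single 2 1) := fun w => by
    have hw : w = w 0 • EuclideanSpace.single 0 1 + w 1 • EuclideanSpace.single 1 1
        + w 2 • (EuclideanSpace.single 2 1 : E3) := by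
      ext i
      fin_cases i <;> simp
    conv_lhs => rw [hw]
    simp only [map_add, map_smul]
  rw [hL y, hL v]
  simp [cross, fromFn, toFn, PiLp.inner_apply, Fin.sum_univ_three]
  ring

namespace FieldData

variable {T c κ K b d : ℝ} {N : ℕ} {r : Fin N → ℝ → E3} {V : ℝ → E3 → ℝ} {A : ℝ → E3 → E3}

theorem force_add_period (F : FieldData T c κ K b d r V A) {t : ℝ} {x : E3}
    (h : (t, x) ∈ Omega N r) (v : E3) : force V A (t + T, x, v) = force V A (t, x, v) := by
  have hn : ∀ᶠ p in 𝓝 (t, x), p ∈ Omega N r := F.isOpen_Omega.mem_nhds h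
  have e : ((t + T, x) : ℝ × E3) = (t, x) + (T, 0) := by simp
  have hV : fderiv ℝ (fun p : ℝ × E3 => V p.1 p.2) (t + T, x)
      = fderiv ℝ (fun p : ℝ × E3 => V p.1 p.2) (t, x) := by
    rw [e, ← fderiv_comp_add_right]
    refine Filter.EventuallyEq.fderiv_eq (hn.mono fun p hp => ?_)
    simpa using F.V_per p hp
  have hA : fderiv ℝ (fun p : ℝ × E3 => A p.1 p.2) (t + T, x)
      = fderiv ℝ (fun p : ℝ × E3 => A p.1 p.2) (t, x) := by
    rw [e, ← fderiv_comp_add_right]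
    refine Filter.EventuallyEq.fderiv_eq (hn.mono fun p hp => ?_)
    simpa using F.A_per p hp
  simp only [force, hV, hA]

/-- The Euler–Lagrange equation is the Lorentz force equation. -/
theorem force_sub_fderiv_A (F : FieldData T c κ K b d r V A) {t : ℝ} {x : E3}
    (h : (t, x) ∈ Omega N r) (v : E3) :
    force V A (t, x, v) - fderiv ℝ (fun p : ℝ × E3 => A p.1 p.2) (t, x) (1, v)
      = -(gradient (V t) x) - deriv (fun s => A s x) t + cross v (curl (A t) x) := by
  have hV := ((F.V_smooth _ h).differentiableAt one_ne_zero).hasFDerivAt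
  have hA := ((F.A_smooth _ h).differentiableAt one_ne_zero).hasFDerivAt
  set DV := fderiv ℝ (fun p : ℝ × E3 => V p.1 p.2) (t, x) with hDV
  set DA := fderiv ℝ (fun p : ℝ × E3 => A p.1 p.2) (t, x) with hDA
  have i2 : HasFDerivAt (fun y : E3 => (t, y)) (ContinuousLinearMap.inr ℝ ℝ E3) x :=
    hasFDerivAt_prodMk_right t x
  have hVx : fderiv ℝ (V t) x = DV.comp (.inr ℝ ℝ E3) :=
    (hV.comp (f := fun y : E3 => (t, y)) x i2).fderiv
  have hAx : fderiv ℝ (A t) x = DA.comp (.inr ℝ ℝ E3) :=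
    (hA.comp (f := fun y : E3 => (t, y)) x i2).fderiv
  have hAt : deriv (fun s => A s x) t = DA (1, 0) := by
    have := (hA.comp_hasDerivAt (f := fun s : ℝ => (s, x)) t
      ((hasDerivAt_id t).prodMk (hasDerivAt_const t x))).deriv
    exact this
  refine ext_inner_right ℝ fun y => ?_
  have hcc := inner_cross_curl (fderiv ℝ (A t) x) v y
  have h1 : DA (1, v) = DA (1, 0) + DA (0, v) := by rw [← map_add]; simp
  rw [inner_sub_left, inner_force, inner_add_left, inner_sub_left, inner_neg_left, gradient,
    InnerProductSpace.toDual_symm_apply, hAt, h1, inner_add_left]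
  simp only [curl, pd]
  rw [hcc, hVx, hAx]
  simp only [ContinuousLinearMap.comp_apply, ContinuousLinearMap.inr_apply, ← hDV, ← hDA]
  ring

end FieldData

namespace LimitPath

variable {T c κ K b d : ℝ} {N : ℕ} {r : Fin N → ℝ → E3} {V : ℝ → E3 → ℝ} {A : ℝ → E3 → E3}
  {δ a : ℝ} {X Q : ℝ → E3} {C : E3}

theorem exists_isSolution (P : LimitPath T c r V A δ a X Q C) (F : FieldData T c κ K b d r V A)
    (hδ : 0 < δ) :
    ∃ x, IsSolution T c r V A x ∧ a ≤ ∫ t in (0:ℝ)..T, lag c V A (t, x t, deriv x t) := by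
  have hT := F.T_pos
  have h0 : (0:ℝ) ∈ Icc 0 T := ⟨le_rfl, hT.le⟩
  have hQ0 : Q 0 = 0 := by rw [P.Q_eq 0 h0, intervalIntegral.integral_same]
  obtain ⟨x, hxc, hxp, hx⟩ := exists_periodic_extension hT P.continuousOn_X P.X_period
  obtain ⟨q, hqc, hqp, hq⟩ := exists_periodic_extension hT P.continuousOn_Q
    (P.Q_period.trans hQ0.symm)
  have hmem : ∀ t, (t, x t) ∈ Omega N r := fun t i => by
    obtain ⟨s, hs, e⟩ := (hxp.sub (F.r_per i)).exists_mem_Ico₀ hT t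
    have hs' : s ∈ Icc 0 T := ⟨hs.1, hs.2.le⟩
    rw [Pi.sub_apply, Pi.sub_apply, hx s hs'] at e
    refine sub_ne_zero.1 (norm_pos_iff.1 ?_)
    rw [e]
    exact hδ.trans_le (P.dist_le s hs' i)
  set v : ℝ → E3 := fun t => velOfMom c (C + q t - A t (x t)) with hv
  have hAc : Continuous fun t => A t (x t) := continuous_iff_continuousAt.2 fun t =>
    (F.continuousOn_A.continuousAt (F.isOpen_Omega.mem_nhds (hmem t))).comp
      (f := fun t : ℝ => (t, x t)) (continuous_id.prodMk hxc).continuousAt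
  have hAp : Periodic (fun t => A t (x t)) T := fun t => by
    simp only [hxp t]
    exact F.A_per _ (hmem t)
  have hvc : Continuous v := continuous_velOfMom.comp ((continuous_const.add hqc).sub hAc)
  have hvp : Periodic v T := fun t => by
    have := hAp t
    simp only at this
    simp only [hv, hqp t, this]
  have hfc : Continuous fun t => force V A (t, x t, v t) := continuous_iff_continuousAt.2 fun t => by
    have hO : IsOpen {q : ℝ × E3 × E3 | (q.1, q.2.1) ∈ Omega N r} :=
      F.isOpen_Omega.preimage (continuous_fst.prodMk (continuous_fst.comp continuous_snd))
    exact (F.continuousOn_force.continuousAt (hO.mem_nhds (hmem t))).comp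
      (f := fun t : ℝ => (t, x t, v t)) (continuous_id.prodMk (hxc.prodMk hvc)).continuousAt
  have hfp : Periodic (fun t => force V A (t, x t, v t)) T := fun t => by
    simp only [hxp t, hvp t]
    exact F.force_add_period (hmem t) _
  have hve : ∀ t ∈ Icc 0 T, v t = velOfMom c (C + Q t - A t (X t)) := fun t ht => by
    simp only [hv, hx t ht, hq t ht]
  have hsub : ∀ t ∈ Icc 0 T, uIcc 0 t ⊆ Icc 0 T := fun t ht => by
    rw [uIcc_of_le ht.1]; exact Icc_subset_Icc_right ht.2
  have hxd : ∀ t, HasDerivAt x (v t) t := hasDerivAt_of_periodic hT hxp hvp hvc fun t ht => by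
    rw [hx t ht, hx 0 h0, P.X_eq t ht]
    congr 1
    exact intervalIntegral.integral_congr fun s hs => (hve s (hsub t ht hs)).symm
  have hqd : ∀ t, HasDerivAt q (force V A (t, x t, v t)) t :=
    hasDerivAt_of_periodic hT hqp hfp hfc fun t ht => by
      rw [hq t ht, hq 0 h0, hQ0, zero_add, P.Q_eq t ht]
      refine intervalIntegral.integral_congr fun s hs => ?_
      simp only [hve s (hsub t ht hs), hx s (hsub t ht hs)]
  have hderiv : deriv x = v := funext fun t => (hxd t).deriv
  refine ⟨x, ⟨hxp, ?_, hmem, fun t => ?_, fun t => ?_⟩, ?_⟩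
  · exact contDiff_one_iff_deriv.2 ⟨fun t => (hxd t).differentiableAt, hderiv ▸ hvc⟩
  · rw [hderiv]
    exact norm_velOfMom_lt F.c_pos _
  · rw [hderiv, ← F.force_sub_fderiv_A (hmem t)]
    have hm : (fun s => (Real.sqrt (1 - ‖v s‖ ^ 2 / c ^ 2))⁻¹ • v s)
        = fun s => C + q s - A s (x s) :=
      funext fun s => mom_velOfMom F.c_pos _
    rw [hm]
    have hA := ((F.A_smooth _ (hmem t)).differentiableAt one_ne_zero).hasFDerivAt.comp_hasDerivAt
      (f := fun s : ℝ => (s, x s)) t ((hasDerivAt_id t).prodMk (hxd t))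
    exact ((hqd t).const_add C).sub hA
  · refine P.le_action.trans_eq (intervalIntegral.integral_congr fun s hs => ?_)
    have hs' := hsub T ⟨hT.le, le_rfl⟩ hs
    simp only [hderiv, hve s hs', hx s hs']

end LimitPath

end LW

namespace LW

/-- The piecewise linear path through the points `X (j T / m)`. -/
def interp (T : ℝ) (m : ℕ) (X : ℝ → E3) : PLSpace m :=
  WithLp.toLp 2 fun o => o.elim (X 0)
    fun j => (m / T) • (X ((j + 1) * (T / m)) - X (j * (T / m)))

theorem interp_none (T : ℝ) (m : ℕ) (X : ℝ → E3) : interp T m X none = X 0 := rfl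

theorem interp_some (T : ℝ) (m : ℕ) (X : ℝ → E3) (j : Fin m) :
    interp T m X (some j) = (m / T) • (X ((j + 1) * (T / m)) - X (j * (T / m))) := rfl

variable {T : ℝ} {m : ℕ}

theorem continuous_interp {S : Type*} [TopologicalSpace S] {X : S → ℝ → E3}
    (hX : ∀ t, Continuous fun s => X s t) : Continuous fun s => interp T m (X s) := by
  refine (PiLp.continuous_toLp 2 _).comp (continuous_pi fun o => ?_)
  cases o with
  | none => exact hX 0
  | some j => exact Continuous.const_smul ((hX _).sub (hX _)) ((m : ℝ) / T)

variable [NeZero m]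

theorem posL_interp_node (hT : 0 < T) (X : ℝ → E3) {i : ℕ} (hi : i ≤ m) :
    posL T m (i * (T / m)) (interp T m X) = X (i * (T / m)) := by
  have hh := step_pos (m := m) hT
  have hm : (m : ℝ) ≠ 0 := by exact_mod_cast NeZero.ne m
  have e : ∀ j : Fin m, ramp T m j (i * (T / m)) • interp T m X (some j)
      = (fun j : ℕ => if j < i then X (((j + 1 : ℕ) : ℝ) * (T / m)) - X (j * (T / m)) else 0) j := by
    intro j
    rw [interp_some, ramp]
    simp only
    split_ifs with h
    · have h' : ((j : ℕ) : ℝ) + 1 ≤ i := by exact_mod_cast h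
      rw [min_eq_right (by gcongr), max_eq_left (by nlinarith), smul_smul]
      have : ((((j : ℕ) : ℝ) + 1) * (T / m) - (j : ℕ) * (T / m)) * (m / T) = 1 := by
        field_simp; ring
      rw [this, one_smul]; push_cast; rfl
    · have h' : (i : ℝ) ≤ (j : ℕ) := by exact_mod_cast not_lt.1 h
      rw [max_eq_right ((min_le_left _ _).trans (by gcongr)), sub_self, zero_smul]
  rw [posL_apply, Finset.sum_congr rfl fun j _ => e j, Fin.sum_univ_eq_sum_range
    (fun j : ℕ => if j < i then X (((j + 1 : ℕ) : ℝ) * (T / m)) - X (j * (T / m)) else 0) m,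
    ← Finset.sum_filter]
  have : (Finset.range m).filter (· < i) = Finset.range i := by
    ext j; simp only [Finset.mem_filter, Finset.mem_range]; omega
  rw [this, Finset.sum_range_sub (fun j : ℕ => X (j * (T / m))), interp_none]
  simp

theorem sum_interp (hT : 0 < T) {X : ℝ → E3} (hX : X T = X 0) :
    ∑ j, interp T m X (some j) = 0 := by
  have h := posL_interp_node hT X (le_refl m)
  have hm : (m : ℝ) ≠ 0 := by exact_mod_cast NeZero.ne m
  rw [mul_div_cancel₀ _ hm, posL_period hT, interp_none, hX, add_eq_left, smul_eq_zero] at h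
  exact h.resolve_left (step_pos hT).ne'

variable {B : ℝ} {X : ℝ → E3}

theorem norm_interp_le (hT : 0 < T) (hX : ∀ s t, ‖X s - X t‖ ≤ B * |s - t|) (j : Fin m) :
    ‖interp T m X (some j)‖ ≤ B := by
  have hh := step_pos (m := m) hT
  have hm : (0 : ℝ) < m := by exact_mod_cast NeZero.pos m
  have h := hX ((j + 1) * (T / m)) (j * (T / m))
  rw [← sub_mul, add_sub_cancel_left, one_mul, abs_of_pos hh] at h
  rw [interp_some, norm_smul, Real.norm_of_nonneg (by positivity)]
  calc (m / T) * _ ≤ (m / T) * (B * (T / m)) := by gcongr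
    _ = B := by field_simp

theorem norm_posL_interp_sub_le (hT : 0 < T) (hX : ∀ s t, ‖X s - X t‖ ≤ B * |s - t|) {t : ℝ}
    (ht : t ∈ Icc 0 T) : ‖posL T m t (interp T m X) - X t‖ ≤ 2 * B * (T / m) := by
  have hh := step_pos (m := m) hT
  have hm : (0 : ℝ) < m := by exact_mod_cast NeZero.pos m
  have hB : 0 ≤ B := by simpa using (norm_nonneg _).trans (hX 1 0)
  set i := ⌊t / (T / m)⌋₊ with hi
  have h0 : 0 ≤ t / (T / m) := div_nonneg ht.1 hh.le
  have h1 : (i : ℝ) * (T / m) ≤ t := (le_div_iff₀ hh).1 (Nat.floor_le h0)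
  have h2 : t ≤ (i + 1) * (T / m) := ((div_lt_iff₀ hh).1 (Nat.lt_floor_add_one _)).le
  have him : i ≤ m := by
    have : (i : ℝ) ≤ m := by
      have : (i : ℝ) * (T / m) ≤ m * (T / m) := by
        rw [mul_div_cancel₀ _ hm.ne']; exact h1.trans ht.2
      exact le_of_mul_le_mul_right this hh
    exact_mod_cast this
  have h3 : |t - i * (T / m)| ≤ T / m := abs_le.2 ⟨by linarith, by linarith⟩
  have h4 := norm_posL_sub_le hT (norm_interp_le (m := m) hT hX)
    (s := i * (T / m)) ⟨by positivity, h1.trans ht.2⟩ ht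
  have h5 := hX (i * (T / m)) t
  rw [abs_sub_comm] at h5
  rw [posL_interp_node hT X him] at h4
  calc _ ≤ _ := norm_sub_le_norm_sub_add_norm_sub _ (X (i * (T / m))) _
    _ ≤ B * (T / m) + B * (T / m) := add_le_add (h4.trans (by gcongr)) (h5.trans (by gcongr))
    _ = _ := by ring

/-- The loops `loopFam` as curves in Euclidean space. -/
def loopE (k : ℕ) [NeZero k] (s : ZMod k → ℝ) (t : ℝ) : E3 := WithLp.toLp 2 (loopFam k s t)

theorem norm_le_two_mul {v : E3} {C : ℝ} (h : ∀ a, |v a| ≤ C) : ‖v‖ ≤ 2 * C := by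
  have hC : 0 ≤ C := (abs_nonneg _).trans (h 0)
  rw [EuclideanSpace.norm_eq]
  refine Real.sqrt_le_iff.2 ⟨by positivity, ?_⟩
  simp only [Fin.sum_univ_three, Real.norm_eq_abs]
  have := fun a => pow_le_pow_left₀ (abs_nonneg _) (h a) 2
  nlinarith [this 0, this 1, this 2]

theorem norm_toFn_le (v : E3) : ‖(fun a => v a : Fin 3 → ℝ)‖ ≤ ‖v‖ :=
  (pi_norm_le_iff_of_nonneg (norm_nonneg _)).2 fun a => PiLp.norm_apply_le v a

theorem continuous_loopE (k : ℕ) [NeZero k] :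
    Continuous fun p : (ZMod k → ℝ) × ℝ => loopE k p.1 p.2 :=
  (PiLp.continuous_toLp 2 _).comp (continuous_pi fun a => continuous_loopFam k a)

theorem norm_loopE_sub_le (k : ℕ) [NeZero k] (s : ZMod k → ℝ) (t t' : ℝ) :
    ‖loopE k s t - loopE k s t'‖ ≤ 2 * (k * (2 * Real.pi * k)) * |t - t'| := by
  refine (norm_le_two_mul fun a => ?_).trans_eq (mul_assoc _ _ _).symm
  exact abs_loopFam_sub_le s a t t'

namespace FieldData

variable {c κ K b d : ℝ} {N : ℕ} {r : Fin N → ℝ → E3} {V : ℝ → E3 → ℝ} {A : ℝ → E3 → E3}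

theorem exists_norm_field_le (F : FieldData T c κ K b d r V A) (R : ℝ) {δ : ℝ} (hδ : 0 < δ) :
    ∃ M, ∀ t ∈ Icc 0 T, ∀ x v : E3, ‖x‖ ≤ R → ‖v‖ ≤ c → (∀ i, δ ≤ ‖x - r i t‖) →
      ‖A t x‖ ≤ M ∧ ‖force V A (t, x, v)‖ ≤ M := by
  set S : Set (ℝ × E3 × E3) := (Icc 0 T ×ˢ Metric.closedBall 0 R ×ˢ Metric.closedBall 0 c) ∩
    {q | ∀ i, δ ≤ ‖q.2.1 - r i q.1‖} with hS
  have hcl : IsClosed {q : ℝ × E3 × E3 | ∀ i, δ ≤ ‖q.2.1 - r i q.1‖} := by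
    simp only [Set.ofPred_forall]
    refine isClosed_iInter fun i => isClosed_le continuous_const ?_
    exact (continuous_snd.fst.sub ((F.continuous_r i).comp continuous_fst)).norm
  have hcpt : IsCompact S :=
    (isCompact_Icc.prod ((isCompact_closedBall _ _).prod (isCompact_closedBall _ _))).inter_right hcl
  have hsub : S ⊆ {q : ℝ × E3 × E3 | (q.1, q.2.1) ∈ Omega N r} := fun q hq i =>
    sub_ne_zero.1 (norm_pos_iff.1 (hδ.trans_le (hq.2 i)))
  have e : ContinuousOn (fun q : ℝ × E3 × E3 => (q.1, q.2.1)) S := by fun_prop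
  obtain ⟨M₁, h1⟩ := hcpt.exists_bound_of_continuousOn (F.continuousOn_A.comp e hsub)
  obtain ⟨M₂, h2⟩ := hcpt.exists_bound_of_continuousOn (F.continuousOn_force.mono hsub)
  refine ⟨max M₁ M₂, fun t ht x v hx hv h => ?_⟩
  have hq : (t, x, v) ∈ S := ⟨⟨ht, by simpa using hx, by simpa using hv⟩, h⟩
  exact ⟨(h1 _ hq).trans (le_max_left _ _), (h2 _ hq).trans (le_max_right _ _)⟩

end FieldData

theorem exists_speed_lt {c B : ℝ} (hc : 0 < c) (hB : B < c) (P : ℝ) :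
    ∃ c₁, 0 < c₁ ∧ B < c₁ ∧ c₁ < c ∧ ∀ p, ‖p‖ ≤ P → ‖velOfMom c p‖ < c₁ := by
  rcases (Metric.closedBall (0 : E3) P).eq_empty_or_nonempty with h | h
  · obtain ⟨c₁, h1, h2⟩ := exists_between (max_lt hB hc)
    refine ⟨c₁, (le_max_right _ _).trans_lt h1, (le_max_left _ _).trans_lt h1, h2, fun p hp => ?_⟩
    exact absurd (show p ∈ Metric.closedBall (0 : E3) P by simpa using hp) (by simp [h])
  · obtain ⟨p₀, -, hp₀⟩ := (isCompact_closedBall (0 : E3) P).exists_isMaxOn h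
      continuous_velOfMom.norm.continuousOn (f := fun p => ‖velOfMom c p‖)
    obtain ⟨c₁, h1, h2⟩ := exists_between (max_lt (max_lt hB hc) (norm_velOfMom_lt hc p₀))
    have h3 := max_lt_iff.1 h1
    have h4 := max_lt_iff.1 h3.1
    exact ⟨c₁, h4.2, h4.1, h2, fun p hp => (hp₀ (by simpa using hp)).trans_lt h3.2⟩

namespace FieldData

variable {c κ K b d : ℝ} {N : ℕ} {r : Fin N → ℝ → E3} {V : ℝ → E3 → ℝ} {A : ℝ → E3 → E3}

theorem exists_small_loops (F : FieldData T c κ K b d r V A) (i₀ : Fin N) (k : ℕ) [NeZero k] :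
    ∃ ρ > (0:ℝ), ∃ δ > (0:ℝ), (∀ s t t', ‖(r i₀ t + ρ • loopE k s (t / T))
        - (r i₀ t' + ρ • loopE k s (t' / T))‖ ≤ (b + c) / 2 * |t - t'|) ∧
      ∀ s t i, δ ≤ ‖r i₀ t + ρ • loopE k s (t / T) - r i t‖ := by
  have hT := F.T_pos
  have hb := F.b_lt
  have hk : (0:ℝ) < k := by exact_mod_cast NeZero.pos k
  have hpi := Real.pi_pos
  set L := 2 * (k * (2 * Real.pi * k)) with hL
  have hL0 : 0 < L := by positivity
  obtain ⟨g, hg, hgle⟩ := exists_le_norm_loopFam k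
  have hgE : ∀ s t, g ≤ ‖loopE k s t‖ := fun s t => (hgle s t).trans (norm_toFn_le (loopE k s t))
  have h6 : ∀ s t, ‖loopE k s t‖ ≤ 6 := fun s t =>
    (norm_le_two_mul fun a => abs_loopFam_le s t a).trans (by norm_num)
  have hd := F.d_pos
  obtain ⟨ρ, hρ, hρL, hρd⟩ : ∃ ρ > 0, ρ * L ≤ (c - b) / 2 * T ∧ ρ * 12 ≤ d :=
    ⟨min ((c - b) / 2 * T / L) (d / 12),
      lt_min (div_pos (mul_pos (by linarith) hT) hL0) (by linarith),
      (le_div_iff₀ hL0).1 (min_le_left _ _), (le_div_iff₀ (by norm_num)).1 (min_le_right _ _)⟩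
  refine ⟨ρ, hρ, min (ρ * g) (d / 2), lt_min (by positivity) (by linarith), fun s t t' => ?_,
    fun s t i => ?_⟩
  · have h1 := norm_loopE_sub_le k s (t / T) (t' / T)
    rw [← sub_div, abs_div, abs_of_pos hT] at h1
    have h2 : ‖ρ • (loopE k s (t / T) - loopE k s (t' / T))‖ ≤ (c - b) / 2 * |t - t'| := by
      rw [norm_smul, Real.norm_of_nonneg hρ.le]
      calc _ ≤ ρ * (L * (|t - t'| / T)) := by gcongr
        _ = ρ * L * |t - t'| / T := by ring
        _ ≤ (c - b) / 2 * T * |t - t'| / T := by gcongr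
        _ = _ := by field_simp
    rw [add_sub_add_comm, ← smul_sub]
    calc _ ≤ _ := norm_add_le _ _
      _ ≤ b * |t - t'| + (c - b) / 2 * |t - t'| := add_le_add (F.r_lip _ _ _) h2
      _ = _ := by ring
  · rcases eq_or_ne i i₀ with rfl | hi
    · rw [add_sub_cancel_left, norm_smul, Real.norm_of_nonneg hρ.le]
      exact (min_le_left _ _).trans (by gcongr; exact hgE _ _)
    · refine (min_le_right _ _).trans ?_
      have h1 := F.r_sep i₀ i hi.symm t
      have h2 : ‖ρ • loopE k s (t / T)‖ ≤ ρ * 6 := by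
        rw [norm_smul, Real.norm_of_nonneg hρ.le]; gcongr; exact h6 _ _
      have h3 := norm_sub_le_norm_add (r i₀ t - r i t) (ρ • loopE k s (t / T))
      rw [sub_add_eq_add_sub] at h3
      linarith

end FieldData

end LW

namespace LW

theorem norm_comp_fract_sub_le {E : Type*} [SeminormedAddCommGroup E] {T L : ℝ} (hT : 0 ≤ T)
    {g : ℝ → E} (hg : ∀ s ∈ Icc 0 T, ∀ t ∈ Icc 0 T, ‖g t - g s‖ ≤ L * |t - s|)
    (h0 : g 0 = g T) (s t : ℝ) :
    ‖g (T * Int.fract t) - g (T * Int.fract s)‖ ≤ L * T * |t - s| := by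
  have hmem : ∀ u : ℝ, T * Int.fract u ∈ Icc 0 T := fun u =>
    ⟨mul_nonneg hT (Int.fract_nonneg u), mul_le_of_le_one_right hT (Int.fract_lt_one u).le⟩
  wlog hst : s ≤ t generalizing s t
  · rw [norm_sub_rev, abs_sub_comm]
    exact this t s (le_of_not_ge hst)
  have hs := Int.floor_add_fract s
  have ht := Int.floor_add_fract t
  rw [abs_of_nonneg (sub_nonneg.2 hst)]
  rcases (Int.floor_mono hst).eq_or_lt with h | h
  · have h1 : Int.fract t - Int.fract s = t - s := by rw [h] at hs; linarith
    refine (hg _ (hmem s) _ (hmem t)).trans_eq ?_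
    rw [← mul_sub, h1, abs_of_nonneg (mul_nonneg hT (sub_nonneg.2 hst)), mul_assoc]
  · have h' : (⌊s⌋ : ℝ) + 1 ≤ ⌊t⌋ := by exact_mod_cast h
    have hTT : T ∈ Icc 0 T := ⟨hT, le_rfl⟩
    have h00 : (0:ℝ) ∈ Icc 0 T := ⟨le_rfl, hT⟩
    have h1 := hg _ (hmem s) _ hTT
    have h2 := hg _ h00 _ (hmem t)
    rw [abs_of_nonneg (sub_nonneg.2 (hmem s).2)] at h1
    rw [sub_zero, abs_of_nonneg (hmem t).1, h0] at h2
    have hLT : 0 ≤ L * T := by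
      have := (norm_nonneg _).trans (hg 0 h00 T hTT)
      rwa [sub_zero, abs_of_nonneg hT] at this
    calc _ ≤ _ := norm_sub_le_norm_sub_add_norm_sub _ (g T) _
      _ ≤ L * (T * Int.fract t) + L * (T - T * Int.fract s) := add_le_add h2 h1
      _ = L * T * (Int.fract t + 1 - Int.fract s) := by ring
      _ ≤ L * T * (t - s) := mul_le_mul_of_nonneg_left (by linarith) hLT

theorem continuous_comp_mul_fract {S S' E : Type*} [TopologicalSpace S] [TopologicalSpace S']
    [TopologicalSpace E] {T : ℝ} {y : S → S' → ℝ → E}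
    (hy : Continuous fun p : (S × S') × ℝ => y p.1.1 p.1.2 p.2) (h : ∀ l s, y l s 0 = y l s T) :
    Continuous fun p : S × S' × ℝ => y p.1 p.2.1 (T * Int.fract p.2.2) := by
  have h1 : Continuous fun p : (S × S') × ℝ => y p.1.1 p.1.2 (T * Int.fract p.2) := by
    refine ContinuousOn.comp_fract' (f := fun (p : S × S') u => y p.1 p.2 (T * u))
      (Continuous.continuousOn ?_)
      fun p => ?_
    · exact hy.comp (continuous_fst.prodMk (continuous_snd.const_mul T))
    · simpa using h p.1 p.2
  exact h1.comp ((continuous_fst.prodMk continuous_snd.fst).prodMk continuous_snd.snd)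

namespace FieldData

variable {T c κ K b d : ℝ} {N : ℕ} {r : Fin N → ℝ → E3} {V : ℝ → E3 → ℝ} {A : ℝ → E3 → E3}

theorem exists_critical (F : FieldData T c κ K b d r V A) (i₀ : Fin N) {k : ℕ} [NeZero k]
    (hk : Odd k) (hk1 : 1 < k) {ρ δ₀ B c₁ a₀ a₁ β : ℝ} (hρ : 0 < ρ) (hδ₀ : 0 < δ₀)
    (hlip : ∀ s t t', ‖(r i₀ t + ρ • loopE k s (t / T))
        - (r i₀ t' + ρ • loopE k s (t' / T))‖ ≤ B * |t - t'|)
    (hdist : ∀ s t i, δ₀ ≤ ‖r i₀ t + ρ • loopE k s (t / T) - r i t‖)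
    (hB : B ≤ c₁) (hc₁ : c₁ < c) (ha₀ : (c ^ 2 + K) * T < a₀) (ha : a₀ < a₁)
    (hka : 4 * (2 * c * T) < k * (c * T * Real.exp (-(2 * c * a₁ / κ))))
    (hβ : β = (c ^ 2 + K / (δ₀ / 2)) * T) {m : ℕ} [NeZero m]
    (hm : 2 * B * (T / m) ≤ δ₀ / 2)
    (hm' : 2 * B * (T / m) < c * T * Real.exp (-(2 * c * β / κ))) :
    ∃ x ∈ Paths T c m r, x ∈ ClosedPaths c₁ m ∧ a₀ ≤ action T c m V A x ∧
      action T c m V A x ≤ β ∧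
      ∀ y ∈ ClosedPaths c₁ m, 0 ≤ inner ℝ (actionGrad T c m V A x) (y - x) := by
  by_contra! hcrit
  have hT := F.T_pos
  have hc := F.c_pos
  obtain ⟨D, hDc, hD0, hD, hD1⟩ := exists_deformation (isClosed_ClosedPaths (c₁ := c₁) (m := m))
    convex_ClosedPaths F.isOpen_Paths (fun x hx => F.hasFDerivAt_action hx)
    F.continuousOn_actionGrad ha (F.isCompact_strip (a₁ := β) hc₁ ha₀)
    (fun x hC hx h1 h2 => hcrit x hx hC h1 h2)
  set X : (ZMod k → ℝ) → ℝ → E3 := fun s t => r i₀ t + ρ • loopE k s (t / T) with hX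
  have hXc : Continuous fun p : (ZMod k → ℝ) × ℝ => X p.1 p.2 :=
    ((F.continuous_r i₀).comp continuous_snd).add (Continuous.const_smul ((continuous_loopE k).comp
      (continuous_fst.prodMk (continuous_snd.div_const T))) ρ)
  have hloop : ∀ s t (n : ℤ), loopE k s (t + n) = loopE k s t := fun s t n => by
    ext a; exact loopFam_add_int_right s t n a
  have hXper : ∀ s, X s T = X s 0 := fun s => by
    have h1 := hloop s 0 1
    have h2 := F.r_per i₀ 0
    rw [zero_add] at h2
    rw [zero_add, Int.cast_one] at h1
    simp only [hX, div_self hT.ne', zero_div, h1, h2]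
  have herr : ∀ s, ∀ t ∈ Icc 0 T, ‖posL T m t (interp T m (X s)) - X s t‖ ≤ 2 * B * (T / m) :=
    fun s t ht => norm_posL_interp_sub_le hT (hlip s) ht
  set f : (ZMod k → ℝ) → PLSpace m := fun s => interp T m (X s) with hf
  have hfc : Continuous f := continuous_interp fun t => hXc.comp (continuous_id.prodMk continuous_const)
  have hfv : ∀ s j, ‖f s (some j)‖ ≤ B := fun s j => norm_interp_le hT (hlip s) j
  have hfC : ∀ s, f s ∈ ClosedPaths c₁ m := fun s =>
    ⟨sum_interp hT (hXper s), fun j => (hfv s j).trans hB⟩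
  have hfd : ∀ s, ∀ t ∈ Icc 0 T, ∀ i, δ₀ / 2 ≤ ‖posL T m t (f s) - r i t‖ := fun s t ht i => by
    have h1 := hdist s t i
    have h2 := herr s t ht
    have h3 := norm_sub_le_norm_sub_add_norm_sub (X s t) (posL T m t (f s)) (r i t)
    rw [norm_sub_rev (X s t) (posL T m t (f s))] at h3
    change δ₀ ≤ ‖X s t - r i t‖ at h1
    linarith
  have hfv' : ∀ s j, ‖f s (some j)‖ < c := fun s j => ((hfv s j).trans hB).trans_lt hc₁
  have hfO : ∀ s, f s ∈ Paths T c m r := fun s => mem_Paths_of_dist (hfv' s) (half_pos hδ₀) (hfd s)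
  have hfβ : ∀ s, action T c m V A (f s) ≤ β := fun s =>
    (F.action_le_of_dist (hfv' s) (half_pos hδ₀) (hfd s)).trans_eq hβ.symm
  have hDf : ∀ l s, D l (f s) ∈ ClosedPaths c₁ m ∧ D l (f s) ∈ Paths T c m r ∧
      action T c m V A (D l (f s)) ≤ β := fun l s => hD l _ (hfC s) (hfO s) (hfβ s)
  have hDfc : Continuous fun p : ℝ × (ZMod k → ℝ) => D p.1 (f p.2) :=
    hDc.comp_continuous (continuous_fst.prodMk (hfc.comp continuous_snd))
      fun p => ⟨mem_univ _, hfC _, hfO _, hfβ _⟩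
  have hposper : ∀ x ∈ ClosedPaths c₁ m, posL T m T x = posL T m 0 x := fun x hx => by
    rw [posL_period hT, posL_zero hT, hx.1, smul_zero, add_zero]
  have hrper : r i₀ T = r i₀ 0 := by simpa using F.r_per i₀ 0
  have hmem : ∀ u : ℝ, T * Int.fract u ∈ Icc 0 T := fun u =>
    ⟨mul_nonneg hT.le (Int.fract_nonneg u), mul_le_of_le_one_right hT.le (Int.fract_lt_one u).le⟩
  set y : ℝ → (ZMod k → ℝ) → ℝ → E3 := fun l s t =>
    (posL T m t (D l (f s)) - r i₀ t) + (1 - l) • (X s t - posL T m t (f s)) with hy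
  have hyper : ∀ l s, y l s 0 = y l s T := fun l s => by
    simp only [hy, hposper _ (hDf l s).1, hposper _ (hfC s), hrper, hXper]
  have hyc : Continuous fun p : (ℝ × (ZMod k → ℝ)) × ℝ => y p.1.1 p.1.2 p.2 := by
    have h1 := (continuous_posL_apply (T := T) (m := m)).comp
      (continuous_snd.prodMk (hDfc.comp continuous_fst) : Continuous
        fun p : (ℝ × (ZMod k → ℝ)) × ℝ => (p.2, D p.1.1 (f p.1.2)))
    have h2 := (continuous_posL_apply (T := T) (m := m)).comp
      (continuous_snd.prodMk (hfc.comp (continuous_snd.comp continuous_fst)) : Continuous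
        fun p : (ℝ × (ZMod k → ℝ)) × ℝ => (p.2, f p.1.2))
    have h3 : Continuous fun p : (ℝ × (ZMod k → ℝ)) × ℝ => X p.1.2 p.2 :=
      hXc.comp (continuous_fst.snd.prodMk continuous_snd)
    exact (h1.sub ((F.continuous_r i₀).comp continuous_snd)).add
      (Continuous.smul (continuous_const.sub continuous_fst.fst) (h3.sub h2))
  have hyfc : Continuous fun p : ℝ × (ZMod k → ℝ) × ℝ => y p.1 p.2.1 (T * Int.fract p.2.2) :=
    continuous_comp_mul_fract hyc hyper
  have hdist' : ∀ l s, ∀ t ∈ Icc 0 T, c * T * Real.exp (-(2 * c * β / κ))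
      ≤ ‖posL T m t (D l (f s)) - r i₀ t‖ := fun l s t ht =>
    F.le_dist_of_action_le (hDf l s).2.1 (hDf l s).2.2 i₀ ht
  have hyne : ∀ l ∈ Icc (0:ℝ) 1, ∀ s, ∀ t ∈ Icc 0 T, y l s t ≠ 0 := fun l hl s t ht h0 => by
    have h1 := hdist' l s t ht
    have h2 : ‖(1 - l) • (X s t - posL T m t (f s))‖ ≤ 2 * B * (T / m) := by
      rw [norm_smul, norm_sub_rev (X s t), Real.norm_of_nonneg (by linarith [hl.2])]
      exact (mul_le_of_le_one_left (norm_nonneg _) (by linarith [hl.1])).trans (herr s t ht)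
    have h3 := congrArg norm (eq_neg_of_add_eq_zero_left h0)
    rw [norm_neg] at h3
    linarith
  have hylip : ∀ s, ∀ t' ∈ Icc 0 T, ∀ t ∈ Icc 0 T, ‖y 1 s t - y 1 s t'‖ ≤ 2 * c * |t - t'| := by
    intro s t' ht' t ht
    have h1 := norm_posL_sub_le hT (fun j => ((hDf 1 s).1.2 j).trans hc₁.le) ht' ht
    have h2 := (F.r_lip i₀ t t').trans (mul_le_mul_of_nonneg_right F.b_lt.le (abs_nonneg _))
    simp only [hy, sub_self, zero_smul, add_zero]
    rw [sub_sub_sub_comm]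
    calc _ ≤ _ := norm_sub_le _ _
      _ ≤ c * |t - t'| + c * |t - t'| := add_le_add h1 h2
      _ = _ := by ring
  have hgap := loop_gap hk hk1 hρ (Y := fun l s t a => y l s (T * Int.fract t) a)
    (L := 2 * c * T) (δ := c * T * Real.exp (-(2 * c * a₁ / κ)))
    (continuous_pi fun a => (PiLp.continuous_apply 2 _ a).comp hyfc)
    (fun l s t n => by
      have h : X (fun j => s j + n j) = X s := by
        funext t
        simp only [hX]
        congr 2
        ext a; exact loopFam_add_int_left s n _ a
      simp only [hy, hf, h])
    (fun l s t n => by simp only [Int.fract_add_intCast])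
    (fun l hl s t h0 => hyne l hl s _ (hmem t) (by ext a; exact congrFun h0 a))
    (fun s t => by
      have h1 : T * Int.fract t / T = Int.fract t := mul_div_cancel_left₀ _ hT.ne'
      have h2 := hloop s (Int.fract t) ⌊t⌋
      rw [Int.fract_add_floor] at h2
      funext a
      simp only [hy, hD0, sub_zero, one_smul]
      have h3 : posL T m (T * Int.fract t) (f s) - r i₀ (T * Int.fract t)
          + (X s (T * Int.fract t) - posL T m (T * Int.fract t) (f s)) = ρ • loopE k s t := by
        rw [sub_add_sub_cancel', hX]
        simp only [add_sub_cancel_left, h1, h2]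
      rw [h3]
      rfl)
    (fun s t t' a => by
      have h := norm_comp_fract_sub_le hT.le (hylip s) (hyper 1 s) t' t
      exact (PiLp.norm_apply_le (y 1 s (T * Int.fract t) - y 1 s (T * Int.fract t')) a).trans h)
    (fun s t => by
      rw [← EuclideanSpace.real_norm_sq_eq]
      have h := F.le_dist_of_action_le (hDf 1 s).2.1 (hD1 _ (hfC s) (hfO s) (hfβ s)) i₀ (hmem t)
      simp only [hy, sub_self, zero_smul, add_zero]
      gcongr)
  exact absurd hgap (not_le.2 hka)

end FieldData

end LW

namespace LW

namespace FieldData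

variable {T c κ K b d : ℝ} {N : ℕ} {r : Fin N → ℝ → E3} {V : ℝ → E3 → ℝ} {A : ℝ → E3 → E3}

theorem exists_isSolution_of_lt (F : FieldData T c κ K b d r V A) (i₀ : Fin N) {a₀ : ℝ}
    (ha₀ : (c ^ 2 + K) * T < a₀) :
    ∃ x, IsSolution T c r V A x ∧ a₀ ≤ ∫ t in (0:ℝ)..T, lag c V A (t, x t, deriv x t) := by
  have hT := F.T_pos
  have hc := F.c_pos
  have hbc := F.b_lt
  have hδ₁ : 0 < c * T * Real.exp (-(2 * c * (a₀ + 1) / κ)) := by positivity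
  obtain ⟨n, hn⟩ := exists_nat_gt
    (4 * (2 * c * T) / (c * T * Real.exp (-(2 * c * (a₀ + 1) / κ))))
  have hn' : (4 * (2 * c * T) / (c * T * Real.exp (-(2 * c * (a₀ + 1) / κ))))
      < ((2 * (n + 1) + 1 : ℕ) : ℝ) := by push_cast; linarith [n.cast_nonneg (α := ℝ)]
  set k := 2 * (n + 1) + 1 with hk
  have : NeZero k := ⟨by omega⟩
  obtain ⟨ρ, hρ, δ₀, hδ₀, hlip, hdist⟩ := F.exists_small_loops i₀ k
  set β := (c ^ 2 + K / (δ₀ / 2)) * T with hβ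
  set δ := c * T * Real.exp (-(2 * c * β / κ)) with hδ
  have hδ' : 0 < δ := by positivity
  obtain ⟨R, -, hR⟩ := F.exists_norm_r_le
  obtain ⟨M, hM⟩ := F.exists_norm_field_le (R + 1 + c * T) hδ'
  obtain ⟨c₁, hc₀, hBc, hc₁, hv⟩ := exists_speed_lt hc (show (b + c) / 2 < c by linarith)
    (2 * ((T + 1) * M))
  have hstep : Tendsto (fun m : ℕ => 2 * ((b + c) / 2) * (T / (m : ℝ))) atTop (𝓝 0) := by
    simpa using (tendsto_const_div_atTop_nhds_zero_nat T).const_mul (2 * ((b + c) / 2))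
  obtain ⟨m₀, hm₀⟩ := eventually_atTop.1
    ((hstep.eventually_lt_const (half_pos hδ₀)).and (hstep.eventually_lt_const hδ'))
  have key : ∀ l : ℕ, ∃ x : PLSpace (m₀ + l + 1),
      CritPath T c r V A c₁ δ (R + 1 + c * T) M a₀ x := by
    intro l
    have hm := hm₀ (m₀ + l + 1) (by omega)
    obtain ⟨x, hx, hC, hxa, hxβ, hcrit⟩ := F.exists_critical i₀ ⟨n + 1, hk⟩ (by omega) hρ hδ₀ hlip
      hdist hBc.le hc₁ ha₀ (lt_add_one a₀) ((div_lt_iff₀ hδ₁).1 hn') hβ hm.1.le hm.2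
    have hxc : ∀ j, ‖x (some j)‖ < c := fun j => (hC.2 j).trans_lt hc₁
    have hdx : ∀ t ∈ Icc 0 T, ∀ i, δ ≤ ‖posL T (m₀ + l + 1) t x - r i t‖ := fun t ht i =>
      F.le_dist_of_action_le hx hxβ i ht
    have hnx : ∀ t ∈ Icc 0 T, ‖posL T (m₀ + l + 1) t x‖ ≤ R + 1 + c * T := fun t ht =>
      F.norm_posL_le hR hxc (ha₀.trans_le hxa) ht
    have hA : ∀ t ∈ Icc 0 T, ‖A t (posL T (m₀ + l + 1) t x)‖ ≤ M := fun t ht =>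
      (hM t ht _ _ (hnx t ht) (hxc 0).le (hdx t ht)).1
    have hf : ∀ t ∈ Icc 0 T, ∀ j, ‖force V A (stateL T (m₀ + l + 1) j (t, x))‖ ≤ M :=
      fun t ht j => (hM t ht _ _ (hnx t ht) (hxc j).le (hdx t ht)).2
    have hlt := F.norm_lt_of_critical hc₀ hc₁ hx hC hA hf hcrit hv
    exact ⟨x, hx, hC, hdx, hnx, hA, hf, fun j => F.elVec_eq_of_critical hx hC hlt hcrit j 0,
      F.integral_force_eq_zero_of_critical hx hC hcrit, hxa⟩
  choose x hx using key
  obtain ⟨X, Q, C, P⟩ := CritPath.exists_limitPath hx F i₀ (tendsto_atTop_mono (fun l => by simp only [id]; omega)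
    tendsto_id) hδ' hc₁
  exact P.exists_isSolution F hδ'

theorem infinite_isSolution (F : FieldData T c κ K b d r V A) (i₀ : Fin N) :
    {x | IsSolution T c r V A x}.Infinite := by
  intro hfin
  obtain ⟨B, hB⟩ := (hfin.image
    fun x => ∫ t in (0:ℝ)..T, lag c V A (t, x t, deriv x t)).bddAbove
  obtain ⟨a, ha⟩ := exists_gt (max B ((c ^ 2 + K) * T))
  obtain ⟨x, hx, hax⟩ := F.exists_isSolution_of_lt i₀ ((le_max_right _ _).trans_lt ha)
  exact absurd (hB (mem_image_of_mem _ hx)) (not_le.2 (((le_max_left _ _).trans_lt ha).trans_le hax))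

end FieldData

theorem isSolution_const {T c : ℝ} (hc : 0 < c) {r : Fin 0 → ℝ → E3} (p : E3) :
    IsSolution T c r (fun _ _ => 0) (fun _ _ => 0) fun _ => p := by
  have h0 : cross 0 (curl (fun _ : E3 => (0 : E3)) p) = 0 := by
    ext i; fin_cases i <;> simp [cross, toFn, fromFn]
  refine ⟨fun _ => rfl, contDiff_const, fun t i => i.elim0, fun t => by simpa using hc, fun t => ?_⟩
  simp only [deriv_const', smul_zero, gradient_fun_const, h0, neg_zero, sub_zero, add_zero]
  exact hasDerivAt_const t _

end LW

/-- **Theorem (Liénard–Wiechert potentials).** Let `q₁,…,q_N < 0` move along `T`-periodic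
`C²` curves `r₁,…,r_N`, slower than light and without collisions, and let `τ i` be the
corresponding retarded times. Then the Lorentz force equation driven by the
Liénard–Wiechert potentials `V = ∑ V_i`, `A = ∑ (β_i/c)V_i` has infinitely many
`T`-periodic classical solutions. -/
theorem LW_infinitely_many_periodic_solutions
    (T c ε₀ : ℝ) (hT : 0 < T) (hc : 0 < c) (hε₀ : 0 < ε₀)
    {N : ℕ} (q : Fin N → ℝ) (hq : ∀ i, q i < 0)
    (r : Fin N → ℝ → LW.E3)
    (hper : ∀ i, Function.Periodic (r i) T)
    (hC2 : ∀ i, ContDiff ℝ 2 (r i))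
    (hspeed : ∀ i t, ‖deriv (r i) t‖ < c)
    (hsep : ∀ i j, i ≠ j → ∀ t ∈ Set.Icc (0:ℝ) T, r i t ≠ r j t)
    (τ : Fin N → ℝ → LW.E3 → ℝ)
    (hτ : ∀ i, ∀ p ∈ LW.Omega N r,
      τ i p.1 p.2 = p.1 - ‖p.2 - r i (τ i p.1 p.2)‖ / c) :
    {x : ℝ → LW.E3 |
      LW.IsSolution T c r (LW.VLW c ε₀ q r τ) (LW.ALW c ε₀ q r τ) x}.Infinite := by
  rcases N with _ | N
  · have hV : LW.VLW c ε₀ q r τ = fun _ _ => 0 := by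
      funext t x; simp [LW.VLW]
    have hA : LW.ALW c ε₀ q r τ = fun _ _ => 0 := by
      funext t x; simp [LW.ALW]
    rw [hV, hA]
    refine (Set.infinite_range_of_injective (f := fun (p : LW.E3) (_ : ℝ) => p)
      fun p p' h => congrFun h 0).mono ?_
    rintro _ ⟨p, rfl⟩
    exact LW.isSolution_const hc p
  · obtain ⟨κ, K, b, d, F⟩ := LW.exists_fieldData hT hc hε₀ hq hper hC2 hspeed hsep hτ
    exact F.infinite_isSolution 0
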